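/- Let d ≥ 1 and j ∈ {1,…,d}, and let R_j denote the j-th Riesz transform. Fix 2 < p < ∞ and ε > 0, and set c_p = (p−1)·((2+√2)p²/((p−1)(p−2)))^{1/p}. If f : ℝ^d → ℂ is a Schwartz function satisfying ‖R_j f‖_{L^p(ℝ^d)} ≥ (cot(π/(2p)) − ε)·‖f‖_{L^p(ℝ^d)}, then ‖ |R_j f| − cot(π/(2p))·|f| ‖_{L^p(ℝ^d)} ≤ c_p · ε^{1/p} · ‖f‖_{L^p(ℝ^d)}. -/

import Mathlib

open MeasureTheory FourierTransform Real

/-- An integrable and square integrable function has the same inverse Fourier transform in the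
sense of integrals and in the sense of `L²`. -/
theorem fourierInv_toLp_two_ae_eq {E : Type*} [NormedAddCommGroup E] [InnerProductSpace ℝ E]
    [FiniteDimensional ℝ E] [MeasurableSpace E] [BorelSpace E] {g : E → ℂ}
    (hg : Integrable g) (hg2 : MemLp g 2) :
    ((𝓕⁻ (hg2.toLp g) : Lp ℂ 2 (volume : Measure E)) : E → ℂ) =ᵐ[volume] 𝓕⁻ g := by
  have hcont : Continuous (𝓕⁻ g) := by
    rw [Real.fourierInv_eq_fourier_comp_neg]
    exact VectorFourier.fourierIntegral_continuous Real.continuous_fourierChar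
      (L := innerₗ E) continuous_inner hg.comp_neg
  apply ae_eq_of_integral_contDiff_smul_eq
  · exact (Lp.memLp _).locallyIntegrable (by norm_num)
  · exact hcont.locallyIntegrable
  · intro φ hφ hφc
    have hg₁ : HasCompactSupport (Complex.ofRealCLM ∘ φ) := hφc.comp_left rfl
    have hg₂ : ContDiff ℝ ((⊤ : ℕ∞) : WithTop ℕ∞) (Complex.ofRealCLM ∘ φ) := by fun_prop
    set ψ : SchwartzMap E ℂ := hg₁.toSchwartzMap hg₂
    have h1 := congrArg (fun T : TemperedDistribution E ℂ => T ψ)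
      (Lp.fourierInv_toTemperedDistribution_eq (hg2.toLp g))
    simp only [TemperedDistribution.fourierInv_apply, Lp.toTemperedDistribution_apply] at h1
    have h2 : ∫ x, (𝓕⁻ ψ) x • (hg2.toLp g) x = ∫ x, 𝓕⁻ (ψ : E → ℂ) x • g x := by
      apply integral_congr_ae
      filter_upwards [hg2.coeFn_toLp] with x hx
      rw [hx, SchwartzMap.fourierInv_coe]
    have h3 : ∫ x, 𝓕⁻ (ψ : E → ℂ) x • g x = ∫ x, ψ x • 𝓕⁻ g x := by
      have := VectorFourier.integral_fourierIntegral_smul_eq_flip (e := 𝐞) (L := -innerₗ E)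
        (μ := volume) (ν := volume) (f := (ψ : E → ℂ)) (g := g) Real.continuous_fourierChar
        (continuous_inner (𝕜 := ℝ) (E := E)).neg ψ.integrable hg
      have e1 : ∀ x, 𝓕⁻ (ψ : E → ℂ) x
          = VectorFourier.fourierIntegral 𝐞 volume (-innerₗ E) (ψ : E → ℂ) x := fun x => by
        simp [Real.fourierInv_eq, VectorFourier.fourierIntegral]
      have e2 : ∀ x, 𝓕⁻ g x
          = VectorFourier.fourierIntegral 𝐞 volume (-innerₗ E).flip g x := fun x => by
        simp [Real.fourierInv_eq, VectorFourier.fourierIntegral, real_inner_comm]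
      simp_rw [e1, e2]
      exact this
    have h4 : ∀ x, ψ x = (φ x : ℂ) := fun x => rfl
    calc ∫ x, φ x • (𝓕⁻ (hg2.toLp g) : Lp ℂ 2 (volume : Measure E)) x
        = ∫ x, ψ x • (𝓕⁻ (hg2.toLp g) : Lp ℂ 2 (volume : Measure E)) x := by
          simp [h4]
      _ = ∫ x, ψ x • 𝓕⁻ g x := by rw [← h1, h2, h3]
      _ = ∫ x, φ x • 𝓕⁻ g x := by simp [h4]

theorem memLp_two_fourierInv {E : Type*} [NormedAddCommGroup E] [InnerProductSpace ℝ E]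
    [FiniteDimensional ℝ E] [MeasurableSpace E] [BorelSpace E] {g : E → ℂ}
    (hg : Integrable g) (hg2 : MemLp g 2) : MemLp (𝓕⁻ g) 2 :=
  (memLp_congr_ae (fourierInv_toLp_two_ae_eq hg hg2)).1 (Lp.memLp _)

/-- Plancherel's theorem for the inverse Fourier transform on `L¹ ∩ L²`. -/
theorem integral_norm_sq_fourierInv {E : Type*} [NormedAddCommGroup E] [InnerProductSpace ℝ E]
    [FiniteDimensional ℝ E] [MeasurableSpace E] [BorelSpace E] {g : E → ℂ}
    (hg : Integrable g) (hg2 : MemLp g 2) : ∫ x, ‖𝓕⁻ g x‖ ^ 2 = ∫ x, ‖g x‖ ^ 2 := by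
  have key : ‖(𝓕⁻ (hg2.toLp g) : Lp ℂ 2 (volume : Measure E))‖ = ‖hg2.toLp g‖ :=
    (Lp.fourierTransformₗᵢ E ℂ).symm.norm_map _
  have hn : ∀ u : Lp ℂ 2 (volume : Measure E), ‖u‖ ^ 2 = ∫ x, ‖u x‖ ^ 2 := by
    intro u
    have := L2.inner_def (𝕜 := ℂ) u u
    rw [inner_self_eq_norm_sq_to_K] at this
    simp only [inner_self_eq_norm_sq_to_K] at this
    have h2 : ((‖u‖ ^ 2 : ℝ) : ℂ) = ((∫ x, ‖u x‖ ^ 2 : ℝ) : ℂ) := by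
      rw [← integral_complex_ofReal]; push_cast; simpa using this
    exact_mod_cast h2
  have h1 : ∫ x, ‖(𝓕⁻ (hg2.toLp g) : Lp ℂ 2 (volume : Measure E)) x‖ ^ 2
      = ∫ x, ‖𝓕⁻ g x‖ ^ 2 := by
    apply integral_congr_ae
    filter_upwards [fourierInv_toLp_two_ae_eq hg hg2] with x hx
    rw [hx]
  have h2 : ∫ x, ‖(hg2.toLp g) x‖ ^ 2 = ∫ x, ‖g x‖ ^ 2 := by
    apply integral_congr_ae
    filter_upwards [hg2.coeFn_toLp] with x hx
    rw [hx]
  rw [← h1, ← h2, ← hn, ← hn, key]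

theorem hasFDerivAt_of_eqOn_of_eqOn {f f₁ f₂ : ℂ → ℝ} {s t : Set ℂ} (hs : IsClosed s)
    (ht : IsClosed t) (hst : s ∪ t = Set.univ) (h₁ : Set.EqOn f f₁ s) (h₂ : Set.EqOn f f₂ t)
    {L : ℂ →L[ℝ] ℝ} {z : ℂ} (d₁ : z ∈ s → HasFDerivAt f₁ L z) (d₂ : z ∈ t → HasFDerivAt f₂ L z) :
    HasFDerivAt f L z := by
  have aux : ∀ (g : ℂ → ℝ) (r : Set ℂ), IsClosed r → Set.EqOn f g r →
      (z ∈ r → HasFDerivAt g L z) → HasFDerivWithinAt f L r z := by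
    intro g r hr hfg hd
    by_cases hz : z ∈ r
    · exact ((hd hz).hasFDerivWithinAt).congr hfg (hfg hz)
    · exact HasFDerivWithinAt.of_notMem_closure (by rwa [hr.closure_eq])
  have := (aux f₁ s hs h₁ d₁).union (aux f₂ t ht h₂ d₂)
  rwa [hst, hasFDerivWithinAt_univ] at this

theorem hasFDerivAt_zero_of_abs_le_rpow {f : ℂ → ℝ} {M q : ℝ} (hq : 1 < q)
    (hf : ∀ z, |f z| ≤ M * ‖z‖ ^ q) : HasFDerivAt f (0 : ℂ →L[ℝ] ℝ) 0 := by
  have h0 : f 0 = 0 := by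
    have := hf 0
    rw [norm_zero, Real.zero_rpow (by linarith), mul_zero] at this
    exact abs_nonpos_iff.1 this
  rw [hasFDerivAt_iff_isLittleO_nhds_zero]
  simp only [zero_add, h0, sub_zero, zero_apply]
  have h1 : f =O[nhds 0] fun z : ℂ => ‖z‖ ^ q :=
    Asymptotics.IsBigO.of_bound M (Filter.Eventually.of_forall fun z => by
      rw [Real.norm_eq_abs, Real.norm_of_nonneg (by positivity)]; exact hf z)
  refine h1.trans_isLittleO ?_
  have h2 : (fun z : ℂ => ‖z‖ ^ q) = fun z : ℂ => ‖z‖ ^ (q - 1) * ‖z‖ := by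
    funext z
    rcases eq_or_ne z 0 with rfl | hz
    · simp [Real.zero_rpow (by linarith : q ≠ 0)]
    · rw [Real.rpow_sub_one (norm_ne_zero_iff.2 hz)]
      field_simp
  rw [h2]
  have h3 : (fun z : ℂ => ‖z‖ ^ (q - 1)) =o[nhds 0] fun _ => (1 : ℝ) := by
    rw [Asymptotics.isLittleO_one_iff]
    have : ContinuousAt (fun z : ℂ => ‖z‖ ^ (q - 1)) 0 :=
      (continuous_norm.continuousAt).rpow_const (Or.inr (by linarith))
    have h := this.tendsto
    simpa [Real.zero_rpow (by linarith : q - 1 ≠ 0)] using h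
  have h4 := h3.mul_isBigO (Asymptotics.isBigO_refl (fun z : ℂ => ‖z‖) (nhds 0))
  simp only [one_mul] at h4
  exact Asymptotics.isLittleO_norm_right.1 h4

/-- The reflected point `|Im z| + i Re z` of the right half-plane. -/
noncomputable def foldPt (z : ℂ) : ℂ := ⟨|z.im|, z.re⟩

theorem norm_foldPt (z : ℂ) : ‖foldPt z‖ = ‖z‖ := by
  rw [Complex.norm_def, Complex.norm_def, Complex.normSq_apply, Complex.normSq_apply, foldPt]
  congr 1
  simp only [abs_mul_abs_self]
  ring

theorem foldPt_mem_slitPlane {z : ℂ} (hz : z.im ≠ 0) : foldPt z ∈ Complex.slitPlane :=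
  Or.inl (abs_pos.2 hz)

theorem hasFDerivAt_foldPt {z : ℂ} (hz : z.im ≠ 0) :
    HasFDerivAt foldPt (((SignType.sign z.im : ℝ) • Complex.imCLM).smulRight (1 : ℂ)
      + Complex.reCLM.smulRight Complex.I) z := by
  have h1 : HasFDerivAt (fun z : ℂ => |z.im|) ((SignType.sign z.im : ℝ) • Complex.imCLM) z :=
    (hasDerivAt_abs hz).comp_hasFDerivAt z Complex.imCLM.hasFDerivAt
  have h2 : HasFDerivAt (fun z : ℂ => z.re) Complex.reCLM z := Complex.reCLM.hasFDerivAt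
  have h3 := (h1.smul_const (1 : ℂ)).add (h2.smul_const Complex.I)
  refine h3.congr_of_eventuallyEq (Filter.Eventually.of_forall fun w => ?_)
  apply Complex.ext <;> simp [foldPt]

theorem hasFDerivAt_foldPt_cpow {z : ℂ} (hz : z.im ≠ 0) (q : ℝ) :
    HasFDerivAt (fun z => foldPt z ^ (q : ℂ))
      ((((SignType.sign z.im : ℝ) • Complex.imCLM).smulRight
          ((q : ℂ) * foldPt z ^ ((q - 1 : ℝ) : ℂ)))
        + Complex.reCLM.smulRight (Complex.I * ((q : ℂ) * foldPt z ^ ((q - 1 : ℝ) : ℂ)))) z := by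
  have h1 : HasDerivAt (fun w : ℂ => w ^ (q : ℂ)) ((q : ℂ) * foldPt z ^ ((q : ℂ) - 1))
      (foldPt z) := by
    simpa using (hasDerivAt_id (foldPt z)).cpow_const (c := (q : ℂ)) (foldPt_mem_slitPlane hz)
  have h2 := (h1.hasFDerivAt.restrictScalars ℝ).comp z (hasFDerivAt_foldPt hz)
  refine h2.congr_fderiv ?_
  ext
  simp
  ring

theorem hasFDerivAt_re_foldPt_cpow {z : ℂ} (hz : z.im ≠ 0) (q : ℝ) :
    HasFDerivAt (fun z => (foldPt z ^ (q : ℂ)).re)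
      ((-(q * (foldPt z ^ ((q - 1 : ℝ) : ℂ)).im)) • Complex.reCLM
        + (q * ((SignType.sign z.im : ℝ) * (foldPt z ^ ((q - 1 : ℝ) : ℂ)).re)) • Complex.imCLM)
      z := by
  have := Complex.reCLM.hasFDerivAt.comp z (hasFDerivAt_foldPt_cpow hz q)
  refine this.congr_fderiv ?_
  ext
  simp
  ring

theorem hasFDerivAt_im_foldPt_cpow {z : ℂ} (hz : z.im ≠ 0) (q : ℝ) :
    HasFDerivAt (fun z => (foldPt z ^ (q : ℂ)).im)
      ((q * (foldPt z ^ ((q - 1 : ℝ) : ℂ)).re) • Complex.reCLM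
        + (q * ((SignType.sign z.im : ℝ) * (foldPt z ^ ((q - 1 : ℝ) : ℂ)).im)) • Complex.imCLM)
      z := by
  have := Complex.imCLM.hasFDerivAt.comp z (hasFDerivAt_foldPt_cpow hz q)
  refine this.congr_fderiv ?_
  ext
  simp
  ring

theorem hasDerivAt_sign {x : ℝ} (hx : x ≠ 0) :
    HasDerivAt (fun x : ℝ => (SignType.sign x : ℝ)) 0 x := by
  apply (hasDerivAt_const x (SignType.sign x : ℝ)).congr_of_eventuallyEq
  rcases hx.lt_or_gt with h | h
  · filter_upwards [Iio_mem_nhds h] with y hy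
    rw [sign_neg h, sign_neg hy]
  · filter_upwards [Ioi_mem_nhds h] with y hy
    rw [sign_pos h, sign_pos hy]

theorem hasDerivAt_abs_rpow_mul_self {a : ℝ} (ha : 0 < a) (y : ℝ) :
    HasDerivAt (fun y : ℝ => |y| ^ a * y) ((a + 1) * |y| ^ a) y := by
  rcases eq_or_ne y 0 with rfl | hy
  · simp only [abs_zero, Real.zero_rpow ha.ne', mul_zero]
    rw [hasDerivAt_iff_isLittleO_nhds_zero]
    simp only [zero_add, abs_zero, Real.zero_rpow ha.ne', mul_zero, sub_zero, smul_zero]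
    have h3 : (fun z : ℝ => |z| ^ a) =o[nhds 0] fun _ => (1 : ℝ) := by
      rw [Asymptotics.isLittleO_one_iff]
      have : ContinuousAt (fun z : ℝ => |z| ^ a) 0 :=
        (continuous_abs.continuousAt).rpow_const (Or.inr ha.le)
      simpa [Real.zero_rpow ha.ne'] using this.tendsto
    simpa using! h3.mul_isBigO (Asymptotics.isBigO_refl (fun z : ℝ => z) (nhds 0))
  · have h := ((hasDerivAt_abs hy).rpow_const (p := a) (Or.inl (abs_ne_zero.2 hy))).mul
      (hasDerivAt_id y)
    refine h.congr_deriv ?_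
    rw [Real.rpow_sub_one (abs_ne_zero.2 hy)]
    have h2 : (SignType.sign y : ℝ) * y = |y| := by rw [mul_comm]; exact self_mul_sign y
    have h3 : |y| ≠ 0 := abs_ne_zero.2 hy
    simp only [id_eq]
    field_simp
    linear_combination a * h2

theorem hasDerivAt_const_mul_abs_rpow {c x : ℝ} (hc : 0 < c) (hx : x ≠ 0) (b : ℝ) :
    HasDerivAt (fun x : ℝ => (c * |x|) ^ b) (c * (SignType.sign x : ℝ) * b * (c * |x|) ^ (b - 1))
      x := by
  have h0 : c * |x| ≠ 0 := mul_ne_zero hc.ne' (abs_ne_zero.2 hx)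
  exact ((hasDerivAt_abs hx).const_mul c).rpow_const (Or.inl h0)

/-- The exponent of the outer branch of the special function. -/
noncomputable def outerExp (p : ℝ) : ℝ := 1 + 2 * (p - 1) * Real.cos (π / (2 * p)) ^ 2

/-- The coefficient of the harmonic branch of the special function. -/
noncomputable def innerCoeff (p : ℝ) : ℝ :=
  Real.cos (π / (2 * p)) ^ (p - 1) / Real.sin (π / (2 * p))

open Classical in
/-- The function equal to `f` on the cone `cot (π / (2 * p)) |Re z| ≤ |Im z|` and to `g` outside. -/
noncomputable def coneGlue (p : ℝ) (f g : ℂ → ℝ) (z : ℂ) : ℝ :=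
  if Real.cot (π / (2 * p)) * |z.re| ≤ |z.im| then f z else g z

/-- The special superharmonic function: harmonic in the cone `cot (π / (2 * p)) |x| ≤ |y|`. -/
noncomputable def specU (p : ℝ) : ℂ → ℝ := coneGlue p
  (fun z => innerCoeff p * (foldPt z ^ (p : ℂ)).re)
  (fun z => p / outerExp p * (|z.im| ^ outerExp p *
    (Real.cot (π / (2 * p)) * |z.re|) ^ (p - outerExp p) - (Real.cot (π / (2 * p)) * |z.re|) ^ p))

/-- The `x`-derivative of `specU`. -/
noncomputable def specUx (p : ℝ) : ℂ → ℝ := coneGlue p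
  (fun z => innerCoeff p * (-(p * (foldPt z ^ ((p - 1 : ℝ) : ℂ)).im)))
  (fun z => p / outerExp p * (Real.cot (π / (2 * p)) * (SignType.sign z.re : ℝ) *
    ((p - outerExp p) * (|z.im| ^ outerExp p *
      (Real.cot (π / (2 * p)) * |z.re|) ^ (p - outerExp p - 1)) -
      p * (Real.cot (π / (2 * p)) * |z.re|) ^ (p - 1))))

/-- The `y`-derivative of `specU`. -/
noncomputable def specUy (p : ℝ) : ℂ → ℝ := coneGlue p
  (fun z => innerCoeff p *
    (p * ((SignType.sign z.im : ℝ) * (foldPt z ^ ((p - 1 : ℝ) : ℂ)).re)))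
  (fun z => p * (|z.im| ^ (outerExp p - 2) * z.im *
    (Real.cot (π / (2 * p)) * |z.re|) ^ (p - outerExp p)))

/-- The second `x`-derivative of `specU`. -/
noncomputable def specUxx (p : ℝ) : ℂ → ℝ := coneGlue p
  (fun z => innerCoeff p * (-(p * ((p - 1) * (foldPt z ^ ((p - 1 - 1 : ℝ) : ℂ)).re))))
  (fun z => p / outerExp p * (Real.cot (π / (2 * p)) ^ 2 *
    ((p - outerExp p) * (p - outerExp p - 1) * (|z.im| ^ outerExp p *
      (Real.cot (π / (2 * p)) * |z.re|) ^ (p - outerExp p - 1 - 1)) -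
      p * (p - 1) * (Real.cot (π / (2 * p)) * |z.re|) ^ (p - 1 - 1))))

/-- The mixed second derivative of `specU`. -/
noncomputable def specUxy (p : ℝ) : ℂ → ℝ := coneGlue p
  (fun z => innerCoeff p *
    (-(p * ((p - 1) * ((SignType.sign z.im : ℝ) * (foldPt z ^ ((p - 1 - 1 : ℝ) : ℂ)).im)))))
  (fun z => p * (Real.cot (π / (2 * p)) * (SignType.sign z.re : ℝ) * (p - outerExp p) *
    (|z.im| ^ (outerExp p - 2) * z.im *
      (Real.cot (π / (2 * p)) * |z.re|) ^ (p - outerExp p - 1))))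

/-- The second `y`-derivative of `specU`. -/
noncomputable def specUyy (p : ℝ) : ℂ → ℝ := coneGlue p
  (fun z => innerCoeff p * (p * ((p - 1) * (foldPt z ^ ((p - 1 - 1 : ℝ) : ℂ)).re)))
  (fun z => p * ((outerExp p - 1) * |z.im| ^ (outerExp p - 2) *
    (Real.cot (π / (2 * p)) * |z.re|) ^ (p - outerExp p)))

section parameters

variable {p : ℝ}

theorem rieszAngle_pos (hp : 2 < p) : 0 < π / (2 * p) := by positivity

theorem rieszAngle_lt (hp : 2 < p) : π / (2 * p) < π / 4 := by
  apply div_lt_div_of_pos_left pi_pos <;> linarith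

theorem mul_rieszAngle (hp : 2 < p) : p * (π / (2 * p)) = π / 2 := by
  field_simp

theorem sin_rieszAngle_pos (hp : 2 < p) : 0 < Real.sin (π / (2 * p)) :=
  Real.sin_pos_of_pos_of_lt_pi (rieszAngle_pos hp) (by linarith [rieszAngle_lt hp, pi_pos])

theorem cos_rieszAngle_pos (hp : 2 < p) : 0 < Real.cos (π / (2 * p)) :=
  Real.cos_pos_of_mem_Ioo ⟨by linarith [rieszAngle_pos hp, pi_pos],
    by linarith [rieszAngle_lt hp, pi_pos]⟩

theorem cot_rieszAngle_pos (hp : 2 < p) : 0 < Real.cot (π / (2 * p)) := by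
  rw [Real.cot_eq_cos_div_sin]
  exact div_pos (cos_rieszAngle_pos hp) (sin_rieszAngle_pos hp)

theorem innerCoeff_pos (hp : 2 < p) : 0 < innerCoeff p :=
  div_pos (rpow_pos_of_pos (cos_rieszAngle_pos hp) _) (sin_rieszAngle_pos hp)

theorem half_lt_sq_cos_rieszAngle (hp : 2 < p) : 1 / 2 < Real.cos (π / (2 * p)) ^ 2 := by
  have h := Real.cos_sq (π / (2 * p))
  have : 0 < Real.cos (2 * (π / (2 * p))) :=
    Real.cos_pos_of_mem_Ioo ⟨by linarith [rieszAngle_pos hp, pi_pos],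
      by linarith [rieszAngle_lt hp, pi_pos]⟩
  linarith

theorem lt_outerExp (hp : 2 < p) : p < outerExp p := by
  have := half_lt_sq_cos_rieszAngle hp
  unfold outerExp
  nlinarith

theorem cos_sub_one_mul_rieszAngle (hp : 2 < p) :
    Real.cos ((p - 1) * (π / (2 * p))) = Real.sin (π / (2 * p)) := by
  rw [sub_mul, mul_rieszAngle hp, one_mul, Real.cos_pi_div_two_sub]

theorem sin_sub_one_mul_rieszAngle (hp : 2 < p) :
    Real.sin ((p - 1) * (π / (2 * p))) = Real.cos (π / (2 * p)) := by
  rw [sub_mul, mul_rieszAngle hp, one_mul, Real.sin_pi_div_two_sub]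

theorem cos_sub_two_mul_rieszAngle (hp : 2 < p) :
    Real.cos ((p - 1 - 1) * (π / (2 * p)))
      = 2 * Real.sin (π / (2 * p)) * Real.cos (π / (2 * p)) := by
  rw [← Real.sin_two_mul, ← Real.cos_pi_div_two_sub, ← mul_rieszAngle hp]
  ring_nf

theorem sin_sub_two_mul_rieszAngle (hp : 2 < p) :
    Real.sin ((p - 1 - 1) * (π / (2 * p))) = 2 * Real.cos (π / (2 * p)) ^ 2 - 1 := by
  rw [← Real.cos_two_mul, ← Real.sin_pi_div_two_sub, ← mul_rieszAngle hp]
  ring_nf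

end parameters

theorem foldPt_cpow_re (z : ℂ) (q : ℝ) :
    (foldPt z ^ (q : ℂ)).re = ‖z‖ ^ q * Real.cos (q * Complex.arg (foldPt z)) := by
  rw [Complex.cpow_ofReal_re, norm_foldPt, mul_comm q]

theorem foldPt_cpow_im (z : ℂ) (q : ℝ) :
    (foldPt z ^ (q : ℂ)).im = ‖z‖ ^ q * Real.sin (q * Complex.arg (foldPt z)) := by
  rw [Complex.cpow_ofReal_im, norm_foldPt, mul_comm q]

theorem norm_mul_cos_arg_foldPt (z : ℂ) : ‖z‖ * Real.cos (Complex.arg (foldPt z)) = |z.im| := by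
  rw [← norm_foldPt, Complex.norm_mul_cos_arg]; rfl

theorem norm_mul_sin_arg_foldPt (z : ℂ) : ‖z‖ * Real.sin (Complex.arg (foldPt z)) = z.re := by
  rw [← norm_foldPt, Complex.norm_mul_sin_arg]; rfl

section junction

variable {p : ℝ} {z : ℂ}

theorem ne_zero_of_junction (hp : 2 < p) (hz : z ≠ 0)
    (h : |z.im| = Real.cot (π / (2 * p)) * |z.re|) : z.re ≠ 0 ∧ z.im ≠ 0 := by
  have hC := cot_rieszAngle_pos hp
  constructor
  · intro hx
    rw [hx, abs_zero, mul_zero, abs_eq_zero] at h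
    exact hz (Complex.ext hx h)
  · intro hy
    rw [hy, abs_zero, eq_comm, mul_eq_zero, abs_eq_zero] at h
    exact hz (Complex.ext (h.resolve_left hC.ne') hy)

theorem norm_eq_of_junction (hp : 2 < p) (h : |z.im| = Real.cot (π / (2 * p)) * |z.re|) :
    |z.im| = ‖z‖ * Real.cos (π / (2 * p)) ∧ |z.re| = ‖z‖ * Real.sin (π / (2 * p)) := by
  have hs := sin_rieszAngle_pos hp
  have hc := cos_rieszAngle_pos hp
  rw [Real.cot_eq_cos_div_sin] at h
  have h1 : |z.re| = ‖z‖ * Real.sin (π / (2 * p)) := by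
    have e : ‖z‖ ^ 2 = |z.re| ^ 2 + |z.im| ^ 2 := by
      rw [Complex.sq_norm, Complex.normSq_apply, sq_abs, sq_abs]; ring
    have e2 : |z.re| ^ 2 = (‖z‖ * Real.sin (π / (2 * p))) ^ 2 := by
      rw [mul_pow, e, h]
      have := Real.sin_sq_add_cos_sq (π / (2 * p))
      field_simp
      rw [this, mul_one]
    exact (sq_eq_sq₀ (abs_nonneg _) (by positivity)).1 e2
  refine ⟨?_, h1⟩
  rw [h, h1]
  field_simp

theorem arg_foldPt_of_junction (hp : 2 < p) (hz : z ≠ 0)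
    (h : |z.im| = Real.cot (π / (2 * p)) * |z.re|) :
    Complex.arg (foldPt z) = (SignType.sign z.re : ℝ) * (π / (2 * p)) := by
  obtain ⟨hx, hy⟩ := ne_zero_of_junction hp hz h
  obtain ⟨h1, h2⟩ := norm_eq_of_junction hp h
  have hpos := rieszAngle_pos hp
  have hlt := rieszAngle_lt hp
  have e : foldPt z = (‖z‖ : ℝ) * (Real.cos ((SignType.sign z.re : ℝ) * (π / (2 * p)))
      + Real.sin ((SignType.sign z.re : ℝ) * (π / (2 * p))) * Complex.I) := by
    apply Complex.ext
    · rcases hx.lt_or_gt with hx | hx <;>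
        simp [foldPt, h1, sign_pos, hx, -Complex.ofReal_cos, -Complex.ofReal_sin]
    · rcases hx.lt_or_gt with hx | hx
      · rw [abs_of_neg hx] at h2
        simp [foldPt, hx, -Complex.ofReal_cos, -Complex.ofReal_sin, ← h2]
      · rw [abs_of_pos hx] at h2
        simp [foldPt, sign_pos, hx, -Complex.ofReal_cos, -Complex.ofReal_sin, ← h2]
  rw [e]
  push_cast
  have := Complex.arg_mul_cos_add_sin_mul_I (r := ‖z‖) (norm_pos_iff.2 hz)
    (θ := (SignType.sign z.re : ℝ) * (π / (2 * p))) (by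
      rcases hx.lt_or_gt with hx | hx <;> simp only [_root_.sign_neg, sign_pos, hx,
        SignType.coe_one, SignType.coe_neg_one] <;>
        constructor <;> linarith [pi_pos])
  push_cast at this
  exact this

theorem foldPt_cpow_re_of_junction (hp : 2 < p) (hz : z ≠ 0)
    (h : |z.im| = Real.cot (π / (2 * p)) * |z.re|) (q : ℝ) :
    (foldPt z ^ (q : ℂ)).re = ‖z‖ ^ q * Real.cos (q * (π / (2 * p))) := by
  rw [foldPt_cpow_re, arg_foldPt_of_junction hp hz h]
  rcases (ne_zero_of_junction hp hz h).1.lt_or_gt with hx | hx <;> simp [sign_pos, hx]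

theorem foldPt_cpow_im_of_junction (hp : 2 < p) (hz : z ≠ 0)
    (h : |z.im| = Real.cot (π / (2 * p)) * |z.re|) (q : ℝ) :
    (foldPt z ^ (q : ℂ)).im
      = (SignType.sign z.re : ℝ) * (‖z‖ ^ q * Real.sin (q * (π / (2 * p)))) := by
  rw [foldPt_cpow_im, arg_foldPt_of_junction hp hz h]
  rcases (ne_zero_of_junction hp hz h).1.lt_or_gt with hx | hx <;> simp [sign_pos, hx]

end junction

section glue

variable {p : ℝ} {f g fx gx fy gy : ℂ → ℝ} {z : ℂ}

theorem coneGlue_of_le (h : Real.cot (π / (2 * p)) * |z.re| ≤ |z.im|) :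
    coneGlue p f g z = f z := if_pos h

theorem coneGlue_of_lt (h : |z.im| < Real.cot (π / (2 * p)) * |z.re|) :
    coneGlue p f g z = g z := if_neg h.not_ge

theorem coneGlue_of_ge
    (hfg : ∀ w : ℂ, |w.im| = Real.cot (π / (2 * p)) * |w.re| → f w = g w)
    (h : |z.im| ≤ Real.cot (π / (2 * p)) * |z.re|) : coneGlue p f g z = g z := by
  rcases h.lt_or_eq with h | h
  · exact coneGlue_of_lt h
  · rw [coneGlue_of_le h.ge, hfg z h]

theorem hasFDerivAt_coneGlue (hp : 2 < p) (hz : z ≠ 0)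
    (hfg : ∀ w : ℂ, |w.im| = Real.cot (π / (2 * p)) * |w.re| → f w = g w)
    (hfgx : ∀ w : ℂ, |w.im| = Real.cot (π / (2 * p)) * |w.re| → fx w = gx w)
    (hfgy : ∀ w : ℂ, |w.im| = Real.cot (π / (2 * p)) * |w.re| → fy w = gy w)
    (df : z.im ≠ 0 → HasFDerivAt f (fx z • Complex.reCLM + fy z • Complex.imCLM) z)
    (dg : z.re ≠ 0 → HasFDerivAt g (gx z • Complex.reCLM + gy z • Complex.imCLM) z) :
    HasFDerivAt (coneGlue p f g)
      (coneGlue p fx gx z • Complex.reCLM + coneGlue p fy gy z • Complex.imCLM) z := by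
  have hC := cot_rieszAngle_pos hp
  have c1 : Continuous fun z : ℂ => Real.cot (π / (2 * p)) * |z.re| := by fun_prop
  have c2 : Continuous fun z : ℂ => |z.im| := by fun_prop
  refine hasFDerivAt_of_eqOn_of_eqOn (isClosed_le c1 c2) (isClosed_le c2 c1) ?_
    (fun w hw => coneGlue_of_le hw) (fun w hw => coneGlue_of_ge hfg hw) (fun h => ?_)
    (fun h => ?_)
  · ext w
    simp [le_total]
  · rw [coneGlue_of_le h, coneGlue_of_le h]
    refine df fun hy => hz (Complex.ext ?_ hy)
    simp only [Set.mem_ofPred_eq, hy, abs_zero] at h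
    exact abs_eq_zero.1 (le_antisymm (by nlinarith [abs_nonneg z.re]) (abs_nonneg _))
  · rw [coneGlue_of_ge hfgx h, coneGlue_of_ge hfgy h]
    refine dg fun hx => hz (Complex.ext hx ?_)
    simp only [Set.mem_ofPred_eq, hx, abs_zero, mul_zero] at h
    exact abs_eq_zero.1 (le_antisymm h (abs_nonneg _))

end glue

section junction

variable {p : ℝ}

theorem re_im_eq_zero_or_ne (z : ℂ) : (z.re = 0 ∧ z.im = 0) ∨ z ≠ 0 := by
  by_cases h : z = 0
  · left; simp [h]
  · exact Or.inr h

theorem foldPt_cpow_eq_zero {z : ℂ} (h : z.re = 0 ∧ z.im = 0) {q : ℝ} (hq : q ≠ 0) :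
    foldPt z ^ (q : ℂ) = 0 := by
  have : foldPt z = 0 := by apply Complex.ext <;> simp [foldPt, h]
  rw [this, Complex.zero_cpow (by exact_mod_cast hq)]

theorem cot_mul_sin_rieszAngle (hp : 2 < p) :
    Real.cot (π / (2 * p)) * Real.sin (π / (2 * p)) = Real.cos (π / (2 * p)) := by
  have := (sin_rieszAngle_pos hp).ne'
  rw [Real.cot_eq_cos_div_sin]; field_simp

theorem innerCoeff_mul_sin (hp : 2 < p) :
    innerCoeff p * Real.sin (π / (2 * p)) = Real.cos (π / (2 * p)) ^ (p - 1) := by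
  have := (sin_rieszAngle_pos hp).ne'
  rw [innerCoeff]; field_simp

theorem innerCoeff_eq (hp : 2 < p) :
    innerCoeff p = Real.cot (π / (2 * p)) * Real.cos (π / (2 * p)) ^ (p - 1 - 1) := by
  have := (cos_rieszAngle_pos hp).ne'
  rw [innerCoeff, Real.cot_eq_cos_div_sin, Real.rpow_sub_one this (p - 1)]
  field_simp

theorem specU_junction (hp : 2 < p) (z : ℂ)
    (h : |z.im| = Real.cot (π / (2 * p)) * |z.re|) :
    innerCoeff p * (foldPt z ^ (p : ℂ)).re = p / outerExp p * (|z.im| ^ outerExp p *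
    (Real.cot (π / (2 * p)) * |z.re|) ^ (p - outerExp p) -
      (Real.cot (π / (2 * p)) * |z.re|) ^ p) := by
  have hn := lt_outerExp hp
  rcases re_im_eq_zero_or_ne z with h0 | hz
  · rw [foldPt_cpow_eq_zero h0 (by linarith), h0.1, h0.2]
    simp [Real.zero_rpow (by linarith : p ≠ 0), Real.zero_rpow (by linarith : outerExp p ≠ 0)]
  · have hA : 0 < |z.im| := abs_pos.2 (ne_zero_of_junction hp hz h).2
    rw [foldPt_cpow_re_of_junction hp hz h, mul_rieszAngle hp, ← h, ← Real.rpow_add hA]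
    simp

theorem specUx_junction (hp : 2 < p) (z : ℂ)
    (h : |z.im| = Real.cot (π / (2 * p)) * |z.re|) :
    innerCoeff p * (-(p * (foldPt z ^ ((p - 1 : ℝ) : ℂ)).im)) =
    p / outerExp p * (Real.cot (π / (2 * p)) * (SignType.sign z.re : ℝ) *
    ((p - outerExp p) * (|z.im| ^ outerExp p *
      (Real.cot (π / (2 * p)) * |z.re|) ^ (p - outerExp p - 1)) -
      p * (Real.cot (π / (2 * p)) * |z.re|) ^ (p - 1))) := by
  have hn := lt_outerExp hp
  rcases re_im_eq_zero_or_ne z with h0 | hz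
  · rw [foldPt_cpow_eq_zero h0 (by linarith), h0.1, h0.2]
    simp
  · have hA : 0 < |z.im| := abs_pos.2 (ne_zero_of_junction hp hz h).2
    have hc := cos_rieszAngle_pos hp
    rw [foldPt_cpow_im_of_junction hp hz h, sin_sub_one_mul_rieszAngle hp, ← h,
      ← Real.rpow_add hA, show outerExp p + (p - outerExp p - 1) = p - 1 by ring,
      (norm_eq_of_junction hp h).1, Real.mul_rpow (norm_nonneg _) hc.le, innerCoeff_eq hp,
      Real.rpow_sub_one hc.ne' (p - 1)]
    have hn0 : outerExp p ≠ 0 := by linarith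
    field_simp
    ring

theorem specUy_junction (hp : 2 < p) (z : ℂ)
    (h : |z.im| = Real.cot (π / (2 * p)) * |z.re|) :
    innerCoeff p *
      (p * ((SignType.sign z.im : ℝ) * (foldPt z ^ ((p - 1 : ℝ) : ℂ)).re)) =
    p * (|z.im| ^ (outerExp p - 2) * z.im *
      (Real.cot (π / (2 * p)) * |z.re|) ^ (p - outerExp p)) := by
  have hn := lt_outerExp hp
  rcases re_im_eq_zero_or_ne z with h0 | hz
  · rw [foldPt_cpow_eq_zero h0 (by linarith), h0.1, h0.2]
    simp
  · have hA : 0 < |z.im| := abs_pos.2 (ne_zero_of_junction hp hz h).2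
    have hc := cos_rieszAngle_pos hp
    have e : |z.im| ^ (outerExp p - 2) * z.im * |z.im| ^ (p - outerExp p) =
        (SignType.sign z.im : ℝ) * |z.im| ^ (p - 1) := by
      conv_lhs => enter [1, 2]; rw [← sign_mul_abs z.im]
      rw [show p - 1 = (outerExp p - 2) + 1 + (p - outerExp p) by ring, Real.rpow_add hA,
        Real.rpow_add hA, Real.rpow_one]
      ring
    rw [foldPt_cpow_re_of_junction hp hz h, cos_sub_one_mul_rieszAngle hp, ← h, e,
      (norm_eq_of_junction hp h).1, Real.mul_rpow (norm_nonneg _) hc.le,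
      ← innerCoeff_mul_sin hp]
    ring

theorem specUxx_junction (hp : 2 < p) (z : ℂ)
    (h : |z.im| = Real.cot (π / (2 * p)) * |z.re|) :
    innerCoeff p * (-(p * ((p - 1) * (foldPt z ^ ((p - 1 - 1 : ℝ) : ℂ)).re))) =
    p / outerExp p * (Real.cot (π / (2 * p)) ^ 2 *
    ((p - outerExp p) * (p - outerExp p - 1) * (|z.im| ^ outerExp p *
      (Real.cot (π / (2 * p)) * |z.re|) ^ (p - outerExp p - 1 - 1)) -
      p * (p - 1) * (Real.cot (π / (2 * p)) * |z.re|) ^ (p - 1 - 1))) := by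
  have hn := lt_outerExp hp
  rcases re_im_eq_zero_or_ne z with h0 | hz
  · rw [foldPt_cpow_eq_zero h0 (by linarith), h0.1, h0.2]
    simp [Real.zero_rpow (by linarith : p - 1 - 1 ≠ 0),
      Real.zero_rpow (by linarith : outerExp p ≠ 0)]
  · have hA : 0 < |z.im| := abs_pos.2 (ne_zero_of_junction hp hz h).2
    have hc := cos_rieszAngle_pos hp
    have hs := sin_rieszAngle_pos hp
    rw [foldPt_cpow_re_of_junction hp hz h, cos_sub_two_mul_rieszAngle hp, ← h,
      ← Real.rpow_add hA, show outerExp p + (p - outerExp p - 1 - 1) = p - 1 - 1 by ring,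
      (norm_eq_of_junction hp h).1, Real.mul_rpow (norm_nonneg _) hc.le, innerCoeff_eq hp]
    have e : (p - outerExp p) * (p - outerExp p - 1) - p * (p - 1)
        = - (outerExp p * (2 * (p - 1) * Real.sin (π / (2 * p)) ^ 2)) := by
      rw [Real.sin_sq, outerExp]; ring
    have e2 := cot_mul_sin_rieszAngle hp
    have hn0 : outerExp p ≠ 0 := by linarith
    rw [← sub_mul, e]
    field_simp
    rw [← e2]
    ring

theorem specUxy_junction (hp : 2 < p) (z : ℂ)
    (h : |z.im| = Real.cot (π / (2 * p)) * |z.re|) :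
    innerCoeff p *
    (-(p * ((p - 1) * ((SignType.sign z.im : ℝ) * (foldPt z ^ ((p - 1 - 1 : ℝ) : ℂ)).im)))) =
    p * (Real.cot (π / (2 * p)) * (SignType.sign z.re : ℝ) * (p - outerExp p) *
    (|z.im| ^ (outerExp p - 2) * z.im *
      (Real.cot (π / (2 * p)) * |z.re|) ^ (p - outerExp p - 1))) := by
  have hn := lt_outerExp hp
  rcases re_im_eq_zero_or_ne z with h0 | hz
  · rw [foldPt_cpow_eq_zero h0 (by linarith), h0.1, h0.2]
    simp
  · have hA : 0 < |z.im| := abs_pos.2 (ne_zero_of_junction hp hz h).2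
    have hc := cos_rieszAngle_pos hp
    have e : |z.im| ^ (outerExp p - 2) * z.im * |z.im| ^ (p - outerExp p - 1) =
        (SignType.sign z.im : ℝ) * |z.im| ^ (p - 1 - 1) := by
      conv_lhs => enter [1, 2]; rw [← sign_mul_abs z.im]
      rw [show p - 1 - 1 = (outerExp p - 2) + 1 + (p - outerExp p - 1) by ring, Real.rpow_add hA,
        Real.rpow_add hA, Real.rpow_one]
      ring
    rw [foldPt_cpow_im_of_junction hp hz h, sin_sub_two_mul_rieszAngle hp, ← h, e,
      (norm_eq_of_junction hp h).1, Real.mul_rpow (norm_nonneg _) hc.le, innerCoeff_eq hp]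
    rw [show p - outerExp p = -((p - 1) * (2 * Real.cos (π / (2 * p)) ^ 2 - 1)) by
      rw [outerExp]; ring]
    ring

theorem specUyy_junction (hp : 2 < p) (z : ℂ)
    (h : |z.im| = Real.cot (π / (2 * p)) * |z.re|) :
    innerCoeff p * (p * ((p - 1) * (foldPt z ^ ((p - 1 - 1 : ℝ) : ℂ)).re)) =
    p * ((outerExp p - 1) * |z.im| ^ (outerExp p - 2) *
      (Real.cot (π / (2 * p)) * |z.re|) ^ (p - outerExp p)) := by
  have hn := lt_outerExp hp
  rcases re_im_eq_zero_or_ne z with h0 | hz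
  · rw [foldPt_cpow_eq_zero h0 (by linarith), h0.1, h0.2]
    simp [Real.zero_rpow (by linarith : outerExp p - 2 ≠ 0)]
  · have hA : 0 < |z.im| := abs_pos.2 (ne_zero_of_junction hp hz h).2
    have hc := cos_rieszAngle_pos hp
    have hs := sin_rieszAngle_pos hp
    rw [foldPt_cpow_re_of_junction hp hz h, cos_sub_two_mul_rieszAngle hp, ← h,
      mul_assoc (outerExp p - 1), ← Real.rpow_add hA,
      show outerExp p - 2 + (p - outerExp p) = p - 1 - 1 by ring,
      (norm_eq_of_junction hp h).1, Real.mul_rpow (norm_nonneg _) hc.le, innerCoeff_eq hp]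
    have e2 := cot_mul_sin_rieszAngle hp
    rw [show outerExp p - 1 = 2 * (p - 1) * Real.cos (π / (2 * p)) ^ 2 by rw [outerExp]; ring]
    linear_combination (p * (p - 1) * ‖z‖ ^ (p - 1 - 1) * 2 * Real.cos (π / (2 * p)) *
      Real.cos (π / (2 * p)) ^ (p - 1 - 1)) * e2

end junction

/-- `f` is bounded by a multiple of `‖z‖ ^ q` on `s`. -/
def PowBdd (s : Set ℂ) (q : ℝ) (f : ℂ → ℝ) : Prop := ∃ M, ∀ z ∈ s, |f z| ≤ M * ‖z‖ ^ q

namespace PowBdd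

variable {s : Set ℂ} {q : ℝ} {f g : ℂ → ℝ}

theorem const_mul (hf : PowBdd s q f) (c : ℝ) : PowBdd s q fun z => c * f z := by
  obtain ⟨M, hM⟩ := hf
  refine ⟨|c| * M, fun z hz => ?_⟩
  rw [abs_mul, mul_assoc]
  exact mul_le_mul_of_nonneg_left (hM z hz) (abs_nonneg c)

theorem neg (hf : PowBdd s q f) : PowBdd s q fun z => -f z := by
  simpa [PowBdd] using hf

theorem sub (hf : PowBdd s q f) (hg : PowBdd s q g) : PowBdd s q fun z => f z - g z := by
  obtain ⟨M, hM⟩ := hf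
  obtain ⟨N, hN⟩ := hg
  refine ⟨M + N, fun z hz => (abs_sub _ _).trans ?_⟩
  rw [add_mul]
  exact add_le_add (hM z hz) (hN z hz)

theorem bdd_mul (hf : PowBdd s q f) (hg : ∀ z, |g z| ≤ 1) : PowBdd s q fun z => g z * f z := by
  obtain ⟨M, hM⟩ := hf
  refine ⟨M, fun z hz => ?_⟩
  rw [abs_mul]
  exact (mul_le_of_le_one_left (abs_nonneg _) (hg z)).trans (hM z hz)

theorem coneGlue {p : ℝ} (hf : PowBdd Set.univ q f)
    (hg : PowBdd {z | |z.im| < Real.cot (π / (2 * p)) * |z.re|} q g) :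
    PowBdd Set.univ q (coneGlue p f g) := by
  obtain ⟨M, hM⟩ := hf
  obtain ⟨N, hN⟩ := hg
  refine ⟨max M N, fun z _ => ?_⟩
  by_cases h : Real.cot (π / (2 * p)) * |z.re| ≤ |z.im|
  · rw [coneGlue_of_le h]
    exact (hM z trivial).trans (by gcongr; exact le_max_left _ _)
  · rw [coneGlue_of_lt (not_le.1 h)]
    exact (hN z (not_le.1 h)).trans (by gcongr; exact le_max_right _ _)

theorem re_foldPt_cpow (q : ℝ) : PowBdd Set.univ q fun z => (foldPt z ^ (q : ℂ)).re :=
  ⟨1, fun z _ => by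
    rw [one_mul, ← norm_foldPt z, ← Complex.norm_cpow_real]; exact Complex.abs_re_le_norm _⟩

theorem im_foldPt_cpow (q : ℝ) : PowBdd Set.univ q fun z => (foldPt z ^ (q : ℂ)).im :=
  ⟨1, fun z _ => by
    rw [one_mul, ← norm_foldPt z, ← Complex.norm_cpow_real]; exact Complex.abs_im_le_norm _⟩

end PowBdd

theorem abs_sign_le_one (x : ℝ) : |(SignType.sign x : ℝ)| ≤ 1 := by
  rcases lt_trichotomy x 0 with h | h | h <;> simp [h]

theorem rpow_mul_rpow_le_rpow_add {y X a b : ℝ} (hy : 0 ≤ y) (hyX : y ≤ X) (hX : 0 < X)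
    (ha : 0 ≤ a) : y ^ a * X ^ b ≤ X ^ (a + b) := by
  rw [Real.rpow_add hX]
  gcongr

section bounds

variable {p : ℝ}

theorem PowBdd.im_rpow_mul (hp : 2 < p) {a b q : ℝ} (ha : 0 ≤ a) (hq : 0 ≤ q) (h : a + b = q) :
    PowBdd {z | |z.im| < Real.cot (π / (2 * p)) * |z.re|} q
      fun z => |z.im| ^ a * (Real.cot (π / (2 * p)) * |z.re|) ^ b := by
  have hC := cot_rieszAngle_pos hp
  refine ⟨Real.cot (π / (2 * p)) ^ q, fun z hz => ?_⟩
  rw [abs_of_nonneg (by positivity)]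
  refine (rpow_mul_rpow_le_rpow_add (abs_nonneg _) hz.le
    ((abs_nonneg _).trans_lt hz) ha).trans ?_
  rw [h, Real.mul_rpow hC.le (abs_nonneg _)]
  gcongr
  exact Complex.abs_re_le_norm z

theorem PowBdd.re_rpow (hp : 2 < p) {q : ℝ} (hq : 0 ≤ q) :
    PowBdd {z | |z.im| < Real.cot (π / (2 * p)) * |z.re|} q
      fun z => (Real.cot (π / (2 * p)) * |z.re|) ^ q := by
  simpa using PowBdd.im_rpow_mul hp le_rfl hq (zero_add q)

theorem PowBdd.im_rpow_mul_self_mul (hp : 2 < p) {a b q : ℝ} (ha : 0 ≤ a) (hq : 0 ≤ q)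
    (h : a + 1 + b = q) :
    PowBdd {z | |z.im| < Real.cot (π / (2 * p)) * |z.re|} q
      fun z => |z.im| ^ a * z.im * (Real.cot (π / (2 * p)) * |z.re|) ^ b := by
  obtain ⟨M, hM⟩ := PowBdd.im_rpow_mul hp (by linarith : 0 ≤ a + 1) hq h
  refine ⟨M, fun z hz => ?_⟩
  have := hM z hz
  rwa [abs_mul, Real.rpow_add_one' (abs_nonneg _) (by linarith), abs_mul, abs_abs,
    ← abs_mul, ← abs_mul] at this

theorem powBdd_specU (hp : 2 < p) : PowBdd Set.univ p (specU p) := by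
  have hn := lt_outerExp hp
  exact PowBdd.coneGlue ((PowBdd.re_foldPt_cpow p).const_mul _)
    (((PowBdd.im_rpow_mul hp (by linarith) (by linarith) (by ring)).sub
      (PowBdd.re_rpow hp (by linarith))).const_mul _)

theorem powBdd_specUx (hp : 2 < p) : PowBdd Set.univ (p - 1) (specUx p) := by
  have hn := lt_outerExp hp
  refine PowBdd.coneGlue (((PowBdd.im_foldPt_cpow _).const_mul _).neg.const_mul _)
    (PowBdd.const_mul ?_ _)
  simp only [mul_assoc]
  exact ((((PowBdd.im_rpow_mul hp (by linarith) (by linarith) (by ring)).const_mul _).sub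
    ((PowBdd.re_rpow hp (by linarith)).const_mul _)).bdd_mul
      fun z => abs_sign_le_one _).const_mul _

theorem powBdd_specUy (hp : 2 < p) : PowBdd Set.univ (p - 1) (specUy p) := by
  have hn := lt_outerExp hp
  exact PowBdd.coneGlue
    ((((PowBdd.re_foldPt_cpow _).bdd_mul fun z => abs_sign_le_one _).const_mul _).const_mul _)
    ((PowBdd.im_rpow_mul_self_mul hp (by linarith) (by linarith) (by ring)).const_mul _)

theorem powBdd_specUxx (hp : 2 < p) : PowBdd Set.univ (p - 1 - 1) (specUxx p) := by
  have hn := lt_outerExp hp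
  exact PowBdd.coneGlue
    ((((PowBdd.re_foldPt_cpow _).const_mul _).const_mul _).neg.const_mul _)
    (((((PowBdd.im_rpow_mul hp (by linarith) (by linarith) (by ring)).const_mul _).sub
    ((PowBdd.re_rpow hp (by linarith)).const_mul _)).const_mul _).const_mul _)

theorem powBdd_specUxy (hp : 2 < p) : PowBdd Set.univ (p - 1 - 1) (specUxy p) := by
  have hn := lt_outerExp hp
  refine PowBdd.coneGlue (((((PowBdd.im_foldPt_cpow _).bdd_mul
    fun z => abs_sign_le_one _).const_mul _).const_mul _).neg.const_mul _) (PowBdd.const_mul ?_ _)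
  have h := ((((PowBdd.im_rpow_mul_self_mul hp (by linarith : 0 ≤ outerExp p - 2)
    (by linarith : 0 ≤ p - 1 - 1) (by ring : _ + 1 + (p - outerExp p - 1) = _)).const_mul
      (p - outerExp p)).bdd_mul fun z => abs_sign_le_one z.re).const_mul
      (Real.cot (π / (2 * p))))
  simpa only [mul_assoc] using h

theorem powBdd_specUyy (hp : 2 < p) : PowBdd Set.univ (p - 1 - 1) (specUyy p) := by
  have hn := lt_outerExp hp
  refine PowBdd.coneGlue ((((PowBdd.re_foldPt_cpow _).const_mul _).const_mul _).const_mul _)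
    (PowBdd.const_mul ?_ _)
  simp only [mul_assoc]
  exact (PowBdd.im_rpow_mul hp (by linarith) (by linarith) (by ring)).const_mul _

end bounds

section derivatives

variable {p : ℝ}

theorem PowBdd.apply_zero {q : ℝ} (hq : q ≠ 0) {f : ℂ → ℝ} (hf : PowBdd Set.univ q f) :
    f 0 = 0 := by
  obtain ⟨M, hM⟩ := hf
  have := hM 0 trivial
  rw [norm_zero, Real.zero_rpow hq, mul_zero] at this
  exact abs_nonpos_iff.1 this

theorem PowBdd.hasFDerivAt_zero {q r : ℝ} (hq : 1 < q) (hr : r ≠ 0) {f fx fy : ℂ → ℝ}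
    (hf : PowBdd Set.univ q f) (hx : PowBdd Set.univ r fx) (hy : PowBdd Set.univ r fy) :
    HasFDerivAt f (fx 0 • Complex.reCLM + fy 0 • Complex.imCLM) 0 := by
  rw [hx.apply_zero hr, hy.apply_zero hr]
  obtain ⟨M, hM⟩ := hf
  simpa using hasFDerivAt_zero_of_abs_le_rpow hq fun z => hM z trivial

theorem hasFDerivAt_re_comp {h : ℝ → ℝ} {h' : ℝ} {z : ℂ} (hh : HasDerivAt h h' z.re) :
    HasFDerivAt (fun z : ℂ => h z.re) (h' • Complex.reCLM) z :=
  hh.comp_hasFDerivAt z Complex.reCLM.hasFDerivAt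

theorem hasFDerivAt_im_comp {h : ℝ → ℝ} {h' : ℝ} {z : ℂ} (hh : HasDerivAt h h' z.im) :
    HasFDerivAt (fun z : ℂ => h z.im) (h' • Complex.imCLM) z :=
  hh.comp_hasFDerivAt z Complex.imCLM.hasFDerivAt

theorem hasDerivAt_abs_rpow_sub_two {n : ℝ} (hn : 2 < n) (y : ℝ) :
    HasDerivAt (fun y : ℝ => |y| ^ (n - 2) * y) ((n - 1) * |y| ^ (n - 2)) y :=
  (hasDerivAt_abs_rpow_mul_self (by linarith : 0 < n - 2) y).congr_deriv (by ring)

theorem hasFDerivAt_specU (hp : 2 < p) (z : ℂ) :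
    HasFDerivAt (specU p) (specUx p z • Complex.reCLM + specUy p z • Complex.imCLM) z := by
  have hn := lt_outerExp hp
  have hC := cot_rieszAngle_pos hp
  rcases eq_or_ne z 0 with rfl | hz
  · exact (powBdd_specU hp).hasFDerivAt_zero (by linarith) (by linarith) (powBdd_specUx hp)
      (powBdd_specUy hp)
  refine hasFDerivAt_coneGlue hp hz (specU_junction hp) (specUx_junction hp)
    (specUy_junction hp) (fun hy => ?_) (fun hx => ?_)
  · refine ((hasFDerivAt_re_foldPt_cpow hy p).const_mul (innerCoeff p)).congr_fderiv ?_
    ext; simp; ring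
  · have h1 := hasFDerivAt_im_comp (hasDerivAt_abs_rpow z.im (by linarith : 1 < outerExp p))
    have h2 := hasFDerivAt_re_comp (hasDerivAt_const_mul_abs_rpow hC hx (p - outerExp p))
    have h3 := hasFDerivAt_re_comp (hasDerivAt_const_mul_abs_rpow hC hx p)
    refine (((h1.mul h2).sub h3).const_mul (p / outerExp p)).congr_fderiv ?_
    have hn0 : outerExp p ≠ 0 := by linarith
    ext
    simp
    field_simp
    ring

theorem hasFDerivAt_specUx (hp : 2 < p) (z : ℂ) :
    HasFDerivAt (specUx p) (specUxx p z • Complex.reCLM + specUxy p z • Complex.imCLM) z := by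
  have hn := lt_outerExp hp
  have hC := cot_rieszAngle_pos hp
  rcases eq_or_ne z 0 with rfl | hz
  · exact (powBdd_specUx hp).hasFDerivAt_zero (by linarith) (by linarith) (powBdd_specUxx hp)
      (powBdd_specUxy hp)
  refine hasFDerivAt_coneGlue hp hz (specUx_junction hp) (specUxx_junction hp)
    (specUxy_junction hp) (fun hy => ?_) (fun hx => ?_)
  · refine ((((hasFDerivAt_im_foldPt_cpow hy (p - 1)).const_mul p).neg).const_mul
      (innerCoeff p)).congr_fderiv ?_
    ext; simp; ring
  · have h1 := hasFDerivAt_im_comp (hasDerivAt_abs_rpow z.im (by linarith : 1 < outerExp p))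
    have h2 := hasFDerivAt_re_comp (hasDerivAt_const_mul_abs_rpow hC hx (p - outerExp p - 1))
    have h3 := hasFDerivAt_re_comp (hasDerivAt_const_mul_abs_rpow hC hx (p - 1))
    have h4 := hasFDerivAt_re_comp (hasDerivAt_sign hx)
    refine (((h4.const_mul (Real.cot (π / (2 * p)))).mul
      (((h1.mul h2).const_mul (p - outerExp p)).sub (h3.const_mul p))).const_mul
        (p / outerExp p)).congr_fderiv ?_
    have hn0 : outerExp p ≠ 0 := by linarith
    have hsq : (SignType.sign z.re : ℝ) ^ 2 = 1 := by
      rcases hx.lt_or_gt with h | h <;> simp [h]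
    ext
    simp
    field_simp
    ring_nf
    rw [hsq]
    ring

theorem hasFDerivAt_specUy (hp : 2 < p) (z : ℂ) :
    HasFDerivAt (specUy p) (specUxy p z • Complex.reCLM + specUyy p z • Complex.imCLM) z := by
  have hn := lt_outerExp hp
  have hC := cot_rieszAngle_pos hp
  rcases eq_or_ne z 0 with rfl | hz
  · exact (powBdd_specUy hp).hasFDerivAt_zero (by linarith) (by linarith) (powBdd_specUxy hp)
      (powBdd_specUyy hp)
  refine hasFDerivAt_coneGlue hp hz (specUy_junction hp) (specUxy_junction hp)
    (specUyy_junction hp) (fun hy => ?_) (fun hx => ?_)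
  · have h4 := hasFDerivAt_im_comp (hasDerivAt_sign hy)
    refine (((h4.mul (hasFDerivAt_re_foldPt_cpow hy (p - 1))).const_mul p).const_mul
      (innerCoeff p)).congr_fderiv ?_
    have hsq : (SignType.sign z.im : ℝ) ^ 2 = 1 := by
      rcases hy.lt_or_gt with h | h <;> simp [h]
    ext
    simp
    ring_nf
    rw [hsq]
    ring
  · have h1 := hasFDerivAt_im_comp
      (hasDerivAt_abs_rpow_sub_two (by linarith : 2 < outerExp p) z.im)
    have h2 := hasFDerivAt_re_comp (hasDerivAt_const_mul_abs_rpow hC hx (p - outerExp p))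
    refine ((h1.mul h2).const_mul p).congr_fderiv ?_
    ext
    simp
    ring

end derivatives

section measurability

variable {p : ℝ}

theorem Measurable.coneGlue {f g : ℂ → ℝ} (hf : Measurable f) (hg : Measurable g) :
    Measurable (coneGlue p f g) := by
  classical
  refine Measurable.ite (measurableSet_le ?_ ?_) hf hg <;> fun_prop

theorem measurable_foldPt_cpow (q : ℂ) : Measurable fun z => foldPt z ^ q := by
  have : foldPt = fun z : ℂ => ((|z.im| : ℝ) : ℂ) + (z.re : ℂ) * Complex.I := by
    funext z; apply Complex.ext <;> simp [foldPt]
  rw [this]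
  fun_prop

theorem measurable_specUxx : Measurable (specUxx p) := by
  have h := measurable_foldPt_cpow ((p - 1 - 1 : ℝ) : ℂ)
  refine Measurable.coneGlue ?_ ?_ <;> fun_prop

theorem measurable_coe_sign : Measurable fun x : ℝ => (SignType.sign x : ℝ) := by
  have : (fun x : ℝ => (SignType.sign x : ℝ)) = fun x => if 0 < x then 1 else if x < 0 then -1 else 0 := by
    funext x
    rw [sign_apply]
    split_ifs <;> simp
  rw [this]
  exact Measurable.ite measurableSet_Ioi measurable_const
    (Measurable.ite measurableSet_Iio measurable_const measurable_const)

theorem measurable_specUxy : Measurable (specUxy p) := by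
  have h := measurable_foldPt_cpow ((p - 1 - 1 : ℝ) : ℂ)
  have h1 : Measurable fun z : ℂ => (SignType.sign z.re : ℝ) :=
    measurable_coe_sign.comp Complex.measurable_re
  have h2 : Measurable fun z : ℂ => (SignType.sign z.im : ℝ) :=
    measurable_coe_sign.comp Complex.measurable_im
  refine Measurable.coneGlue ?_ ?_ <;> fun_prop

theorem measurable_specUyy : Measurable (specUyy p) := by
  have h := measurable_foldPt_cpow ((p - 1 - 1 : ℝ) : ℂ)
  refine Measurable.coneGlue ?_ ?_ <;> fun_prop

end measurability

section signs

variable {p : ℝ}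

theorem abs_arg_foldPt_le_pi_div_two (z : ℂ) : |Complex.arg (foldPt z)| ≤ π / 2 :=
  Complex.abs_arg_le_pi_div_two_iff.2 (abs_nonneg z.im)

theorem norm_mul_sin_abs_arg_foldPt (z : ℂ) :
    ‖z‖ * Real.sin |Complex.arg (foldPt z)| = |z.re| := by
  have h1 : |Complex.arg (foldPt z)| ≤ π := (abs_arg_foldPt_le_pi_div_two z).trans
    (by linarith [pi_pos])
  rw [← Real.abs_sin_eq_sin_abs_of_abs_le_pi h1, ← norm_mul_sin_arg_foldPt, abs_mul, abs_norm]

theorem norm_mul_cos_abs_arg_foldPt (z : ℂ) :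
    ‖z‖ * Real.cos |Complex.arg (foldPt z)| = |z.im| := by
  rw [Real.cos_abs, norm_mul_cos_arg_foldPt]

theorem abs_arg_foldPt_le (hp : 2 < p) {z : ℂ}
    (h : Real.cot (π / (2 * p)) * |z.re| ≤ |z.im|) :
    |Complex.arg (foldPt z)| ≤ π / (2 * p) := by
  have hs := sin_rieszAngle_pos hp
  rcases eq_or_ne z 0 with rfl | hz
  · have : foldPt 0 = 0 := by apply Complex.ext <;> simp [foldPt]
    simp [this, (rieszAngle_pos hp).le]
  by_contra! hlt
  have hn : 0 < ‖z‖ := norm_pos_iff.2 hz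
  rw [← norm_mul_sin_abs_arg_foldPt, ← norm_mul_cos_abs_arg_foldPt, Real.cot_eq_cos_div_sin,
    div_mul_eq_mul_div, div_le_iff₀ hs] at h
  have h2 : 0 < Real.sin (|Complex.arg (foldPt z)| - π / (2 * p)) := by
    apply Real.sin_pos_of_pos_of_lt_pi
    · linarith
    · linarith [abs_arg_foldPt_le_pi_div_two z, rieszAngle_pos hp, pi_pos]
  rw [Real.sin_sub] at h2
  nlinarith [mul_pos hn h2]

theorem specUyy_nonneg (hp : 2 < p) (z : ℂ) : 0 ≤ specUyy p z := by
  have hn := lt_outerExp hp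
  have hC := cot_rieszAngle_pos hp
  by_cases h : Real.cot (π / (2 * p)) * |z.re| ≤ |z.im|
  · rw [specUyy, coneGlue_of_le h, foldPt_cpow_re, ← Real.cos_abs, abs_mul,
      abs_of_nonneg (by linarith : 0 ≤ p - 1 - 1)]
    have h1 := abs_arg_foldPt_le hp h
    have h2 : 0 ≤ Real.cos ((p - 1 - 1) * |Complex.arg (foldPt z)|) := by
      apply Real.cos_nonneg_of_neg_pi_div_two_le_of_le
      · have : 0 ≤ (p - 1 - 1) * |Complex.arg (foldPt z)| :=
          mul_nonneg (by linarith) (abs_nonneg _)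
        linarith [pi_pos]
      · rw [← mul_rieszAngle hp]
        exact mul_le_mul (by linarith) h1 (abs_nonneg _) (by linarith)
    have := innerCoeff_pos hp
    have : 0 ≤ p - 1 := by linarith
    positivity
  · rw [specUyy, coneGlue_of_lt (not_le.1 h)]
    have : 0 ≤ outerExp p - 1 := by linarith
    positivity

theorem specUxx_add_specUyy_nonpos (hp : 2 < p) (z : ℂ) : specUxx p z + specUyy p z ≤ 0 := by
  have hn := lt_outerExp hp
  have hC := cot_rieszAngle_pos hp
  by_cases h : Real.cot (π / (2 * p)) * |z.re| ≤ |z.im|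
  · rw [specUyy, coneGlue_of_le h, specUxx, coneGlue_of_le h]
    exact le_of_eq (by ring)
  · have h := not_le.1 h
    rw [specUyy, coneGlue_of_lt h, specUxx, coneGlue_of_lt h]
    have hX := (abs_nonneg z.im).trans_lt h
    set X := Real.cot (π / (2 * p)) * |z.re|
    have h1 := rpow_mul_rpow_le_rpow_add (b := p - outerExp p - 1 - 1) (abs_nonneg z.im) h.le hX
      (by linarith : 0 ≤ outerExp p)
    have h2 := rpow_mul_rpow_le_rpow_add (b := p - outerExp p) (abs_nonneg z.im) h.le hX
      (by linarith : 0 ≤ outerExp p - 2)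
    rw [show outerExp p + (p - outerExp p - 1 - 1) = p - 1 - 1 by ring] at h1
    rw [show outerExp p - 2 + (p - outerExp p) = p - 1 - 1 by ring] at h2
    have e2 : Real.cot (π / (2 * p)) ^ 2 * Real.sin (π / (2 * p)) ^ 2
        = Real.cos (π / (2 * p)) ^ 2 := by rw [← mul_pow, cot_mul_sin_rieszAngle hp]
    have e : (p - outerExp p) * (p - outerExp p - 1) - p * (p - 1)
        = - (outerExp p * (2 * (p - 1) * Real.sin (π / (2 * p)) ^ 2)) := by
      rw [Real.sin_sq, outerExp]; ring
    have hk : 0 ≤ (p - outerExp p) * (p - outerExp p - 1) := by nlinarith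
    calc _ ≤ p / outerExp p * (Real.cot (π / (2 * p)) ^ 2 *
          ((p - outerExp p) * (p - outerExp p - 1) * X ^ (p - 1 - 1) -
            p * (p - 1) * X ^ (p - 1 - 1))) + p * ((outerExp p - 1) * X ^ (p - 1 - 1)) := by
          rw [mul_assoc (outerExp p - 1)]
          have : 0 ≤ outerExp p - 1 := by linarith
          have : 0 ≤ p / outerExp p := div_nonneg (by linarith) (by linarith)
          gcongr
      _ = 0 := by
        have hn0 : outerExp p ≠ 0 := by linarith
        rw [← sub_mul, e]
        have h4 : outerExp p - 1 = 2 * (p - 1) * Real.cos (π / (2 * p)) ^ 2 := by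
          rw [outerExp]; ring
        rw [h4, ← e2]
        field_simp
        ring

theorem hasDerivAt_specU_im (hp : 2 < p) (x y : ℝ) :
    HasDerivAt (fun y : ℝ => specU p ⟨x, y⟩) (specUy p ⟨x, y⟩) y ∧
    HasDerivAt (fun y : ℝ => specUy p ⟨x, y⟩) (specUyy p ⟨x, y⟩) y := by
  have h : HasDerivAt (fun y : ℝ => (⟨x, y⟩ : ℂ)) Complex.I y := by
    have := ((Complex.ofRealCLM.hasDerivAt (x := y)).mul_const Complex.I).const_add (x : ℂ)
    simp only [Complex.ofRealCLM_apply, Complex.ofReal_one, one_mul, ← Complex.mk_eq_add_mul_I]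
      at this
    exact this
  constructor
  · exact ((hasFDerivAt_specU hp ⟨x, y⟩).comp_hasDerivAt y h).congr_deriv (by simp)
  · exact ((hasFDerivAt_specUy hp ⟨x, y⟩).comp_hasDerivAt y h).congr_deriv (by simp)

theorem convexOn_specU_im (hp : 2 < p) (x : ℝ) :
    ConvexOn ℝ Set.univ fun y : ℝ => specU p ⟨x, y⟩ := by
  have h1 := fun y => (hasDerivAt_specU_im hp x y).1
  have h2 := fun y => (hasDerivAt_specU_im hp x y).2
  apply Monotone.convexOn_univ_of_deriv (fun y => (h1 y).differentiableAt)
  have : deriv (fun y : ℝ => specU p ⟨x, y⟩) = fun y => specUy p ⟨x, y⟩ :=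
    funext fun y => (h1 y).deriv
  rw [this]
  apply monotone_of_deriv_nonneg (fun y => (h2 y).differentiableAt)
  intro y
  rw [(h2 y).deriv]
  exact specUyy_nonneg hp _

theorem continuous_specU (hp : 2 < p) : Continuous (specU p) :=
  continuous_iff_continuousAt.2 fun z => (hasFDerivAt_specU hp z).continuousAt

theorem continuous_specUx (hp : 2 < p) : Continuous (specUx p) :=
  continuous_iff_continuousAt.2 fun z => (hasFDerivAt_specUx hp z).continuousAt

theorem continuous_specUy (hp : 2 < p) : Continuous (specUy p) :=
  continuous_iff_continuousAt.2 fun z => (hasFDerivAt_specUy hp z).continuousAt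

end signs

theorem mul_sin_mul_cos_le {a b θ : ℝ} (ha : 0 ≤ a) (hab : a ≤ b) (hθ : 0 ≤ θ)
    (hb : b * θ ≤ π) :
    b * (Real.sin (a * θ) * Real.cos (b * θ)) ≤ a * (Real.cos (a * θ) * Real.sin (b * θ)) := by
  let h : ℝ → ℝ := fun t => a * (Real.cos (a * t) * Real.sin (b * t)) -
    b * (Real.sin (a * t) * Real.cos (b * t))
  have hd : ∀ t, HasDerivAt h ((b ^ 2 - a ^ 2) * (Real.sin (a * t) * Real.sin (b * t))) t := by
    intro t
    have ea : HasDerivAt (fun t : ℝ => a * t) a t := by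
      simpa using (hasDerivAt_id t).const_mul a
    have eb : HasDerivAt (fun t : ℝ => b * t) b t := by
      simpa using (hasDerivAt_id t).const_mul b
    exact (((ea.cos.mul eb.sin).const_mul a).sub ((ea.sin.mul eb.cos).const_mul b)).congr_deriv
      (by ring)
  have hm : MonotoneOn h (Set.Icc 0 θ) := by
    apply monotoneOn_of_deriv_nonneg (convex_Icc 0 θ)
      (fun t _ => (hd t).continuousAt.continuousWithinAt)
      (fun t _ => (hd t).differentiableAt.differentiableWithinAt)
    intro t ht
    rw [interior_Icc] at ht
    rw [(hd t).deriv]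
    have h1 : b * t ≤ π := (mul_le_mul_of_nonneg_left ht.2.le (ha.trans hab)).trans hb
    have h2 : a * t ≤ b * t := mul_le_mul_of_nonneg_right hab ht.1.le
    have s1 : 0 ≤ Real.sin (a * t) :=
      Real.sin_nonneg_of_nonneg_of_le_pi (mul_nonneg ha ht.1.le) (h2.trans h1)
    have s2 : 0 ≤ Real.sin (b * t) :=
      Real.sin_nonneg_of_nonneg_of_le_pi (mul_nonneg (ha.trans hab) ht.1.le) h1
    have : 0 ≤ b ^ 2 - a ^ 2 := by nlinarith
    positivity
  have := hm ⟨le_rfl, hθ⟩ ⟨hθ, le_rfl⟩ hθ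
  simp [h] at this
  linarith

theorem sin_mul_div_sin_mul_le {a b θ φ : ℝ} (ha : 0 ≤ a) (hab : a ≤ b) (hθ : 0 < θ)
    (hθφ : θ ≤ φ) (hb : b * φ < π) (hb0 : 0 < b) :
    Real.sin (a * θ) / Real.sin (b * θ) ≤ Real.sin (a * φ) / Real.sin (b * φ) := by
  have hpos : ∀ t ∈ Set.Icc θ φ, 0 < Real.sin (b * t) := fun t ht =>
    Real.sin_pos_of_pos_of_lt_pi (mul_pos hb0 (hθ.trans_le ht.1))
      ((mul_le_mul_of_nonneg_left ht.2 hb0.le).trans_lt hb)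
  have hd : ∀ t ∈ Set.Icc θ φ, HasDerivAt (fun t => Real.sin (a * t) / Real.sin (b * t))
      ((a * (Real.cos (a * t) * Real.sin (b * t)) - b * (Real.sin (a * t) * Real.cos (b * t))) /
        Real.sin (b * t) ^ 2) t := by
    intro t ht
    have ea : HasDerivAt (fun t : ℝ => a * t) a t := by
      simpa using (hasDerivAt_id t).const_mul a
    have eb : HasDerivAt (fun t : ℝ => b * t) b t := by
      simpa using (hasDerivAt_id t).const_mul b
    exact (ea.sin.div eb.sin (hpos t ht).ne').congr_deriv (by ring)
  have hm : MonotoneOn (fun t => Real.sin (a * t) / Real.sin (b * t)) (Set.Icc θ φ) := by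
    apply monotoneOn_of_deriv_nonneg (convex_Icc θ φ)
      (fun t ht => (hd t ht).continuousAt.continuousWithinAt)
      (fun t ht => (hd t (interior_subset ht)).differentiableAt.differentiableWithinAt)
    intro t ht
    have ht := interior_subset ht
    rw [(hd t ht).deriv]
    apply div_nonneg _ (sq_nonneg _)
    have := mul_sin_mul_cos_le ha hab (hθ.le.trans ht.1)
      ((mul_le_mul_of_nonneg_left ht.2 hb0.le).trans hb.le)
    linarith
  exact hm ⟨le_rfl, hθφ⟩ ⟨hθφ, le_rfl⟩ hθφ

/-- The stability constant in the pointwise inequality. -/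
noncomputable def gapCoeff (p : ℝ) : ℝ := (p - 2) / ((2 + Real.sqrt 2) * p)

section gap

variable {p : ℝ}

theorem gapCoeff_pos (hp : 2 < p) : 0 < gapCoeff p :=
  div_pos (by linarith) (by positivity)

theorem two_mul_gapCoeff_le (hp : 2 < p) : 2 * (gapCoeff p * p) ≤ p - 2 := by
  have h := Real.sqrt_nonneg 2
  have : gapCoeff p * p = (p - 2) / (2 + Real.sqrt 2) := by
    rw [gapCoeff]; field_simp
  rw [this, mul_div_assoc', div_le_iff₀ (by positivity)]
  nlinarith

theorem mul_le_one_add_mul_sin {y : ℝ} (h0 : 0 ≤ y) (h1 : y ≤ 1) :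
    2 * (2 - Real.sqrt 2) * y ≤ (1 + y) * Real.sin (π / 2 * y) := by
  have h2 : (1.4142 : ℝ) ≤ Real.sqrt 2 := Real.le_sqrt_of_sq_le (by norm_num)
  have hpi := pi_gt_d2
  have hpi2 := pi_lt_d2
  rcases le_total y 0.172 with h | h
  · rcases h0.eq_or_lt with rfl | h0
    · simp
    have h3 := Real.sin_gt_sub_cube (x := π / 2 * y) (by positivity)
    have h4 : π / 2 * y ≤ 0.28 := by nlinarith [mul_le_mul hpi2.le h h0.le (by norm_num)]
    have h4 : (π / 2 * y) ^ 2 ≤ 0.08 := by nlinarith [mul_pos pi_pos h0]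
    have h5 : (π / 2 * y) * 0.98 ≤ Real.sin (π / 2 * y) := by
      have : 0 < π / 2 * y := by positivity
      nlinarith
    have h6 : 1.5 * y ≤ Real.sin (π / 2 * y) := by nlinarith
    nlinarith
  · have h3 : y ≤ Real.sin (π / 2 * y) := by
      have := Real.mul_le_sin (x := π / 2 * y) (by positivity) (by nlinarith)
      convert this using 1
      field_simp
    nlinarith

theorem two_mul_gapCoeff_le_cos (hp : 2 < p) :
    2 * (gapCoeff p * p) ≤ (p - 1) * (2 * Real.cos (π / (2 * p)) ^ 2 - 1) := by
  have h := Real.sqrt_nonneg 2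
  have hs : Real.sqrt 2 ^ 2 = 2 := Real.sq_sqrt (by norm_num)
  have e : 2 * (gapCoeff p * p) = (2 - Real.sqrt 2) * (p - 2) := by
    rw [gapCoeff]; field_simp; linear_combination (p - 2) * hs
  have h1 := mul_le_one_add_mul_sin (y := (p - 2) / p)
    (div_nonneg (by linarith) (by linarith)) (by rw [div_le_one (by linarith)]; linarith)
  have h2 : Real.sin (π / 2 * ((p - 2) / p)) = 2 * Real.cos (π / (2 * p)) ^ 2 - 1 := by
    rw [← Real.cos_two_mul, ← Real.sin_pi_div_two_sub]
    congr 1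
    field_simp
  rw [h2] at h1
  rw [e]
  have h3 := mul_le_mul_of_nonneg_left h1 (by linarith : 0 ≤ p / 2)
  calc _ = p / 2 * (2 * (2 - Real.sqrt 2) * ((p - 2) / p)) := by field_simp
    _ ≤ _ := h3
    _ = _ := by field_simp; ring

theorem two_mul_gapCoeff_mul_sin_le (hp : 2 < p) {θ : ℝ} (h0 : 0 < θ) (h1 : θ ≤ π / (2 * p)) :
    2 * (gapCoeff p * p) * Real.sin ((p - 1) * θ) ≤
      (p - 1) * (Real.sin ((p - 2) * θ) * Real.cos θ) := by
  have hpos := rieszAngle_pos hp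
  have hlt := rieszAngle_lt hp
  have hm := mul_rieszAngle hp
  have hθ : p * θ ≤ π / 2 := hm ▸ mul_le_mul_of_nonneg_left h1 (by linarith)
  have hs : 0 < Real.sin ((p - 1) * θ) :=
    Real.sin_pos_of_pos_of_lt_pi (mul_pos (by linarith) h0) (by nlinarith [pi_pos])
  rcases le_total 3 p with h3 | h3
  · have h4 := mul_sin_mul_cos_le (a := 1) (b := p - 2) zero_le_one (by linarith) h0.le
      (by nlinarith [pi_pos])
    rw [one_mul, one_mul] at h4
    have h5 : Real.sin ((p - 1) * θ) = Real.sin ((p - 2) * θ) * Real.cos θ +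
        Real.cos ((p - 2) * θ) * Real.sin θ := by
      rw [← Real.sin_add]; ring_nf
    refine (mul_le_mul_of_nonneg_right (two_mul_gapCoeff_le hp) hs.le).trans ?_
    rw [h5]
    linarith
  · have h4 := sin_mul_div_sin_mul_le (a := 3 - p) (b := p - 1) (by linarith) (by linarith) h0 h1
      (by nlinarith [pi_pos]) (by linarith)
    have hc := cos_rieszAngle_pos hp
    have h6 : Real.sin ((3 - p) * (π / (2 * p))) =
        (1 - 2 * (2 * Real.cos (π / (2 * p)) ^ 2 - 1)) * Real.cos (π / (2 * p)) := by
      rw [show (3 - p) * (π / (2 * p)) = π / (2 * p) - (p - 1 - 1) * (π / (2 * p)) by ring,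
        Real.sin_sub, cos_sub_two_mul_rieszAngle hp, sin_sub_two_mul_rieszAngle hp]
      have := Real.sin_sq (π / (2 * p))
      linear_combination 2 * Real.cos (π / (2 * p)) * this
    rw [h6, sin_sub_one_mul_rieszAngle hp, mul_div_cancel_right₀ _ hc.ne', div_le_iff₀ hs] at h4
    have h7 : Real.sin ((3 - p) * θ) =
        Real.sin ((p - 1) * θ) - 2 * (Real.sin ((p - 2) * θ) * Real.cos θ) := by
      rw [show (3 - p) * θ = θ - (p - 2) * θ by ring, show (p - 1) * θ = (p - 2) * θ + θ by ring,
        Real.sin_sub, Real.sin_add]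
      ring
    have h8 := mul_le_mul_of_nonneg_right (two_mul_gapCoeff_le_cos hp) hs.le
    nlinarith

end gap

theorem one_sub_rpow_le {T p : ℝ} (h0 : 0 ≤ T) (h1 : T ≤ 1) (hp : 2 ≤ p) :
    (1 - T) ^ p ≤ (1 - T ^ p) ^ 2 := by
  have h2 : T ^ p ≤ T := by
    simpa using Real.rpow_le_rpow_of_exponent_ge' h0 h1 zero_le_one (by linarith : 1 ≤ p)
  calc (1 - T) ^ p ≤ (1 - T) ^ (2 : ℝ) :=
        Real.rpow_le_rpow_of_exponent_ge' (by linarith) (by linarith) (by norm_num) hp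
    _ = (1 - T) ^ 2 := by norm_cast
    _ ≤ _ := by gcongr

theorem half_mul_sq_le {ν t : ℝ} (h1 : 1 < ν) (h2 : ν ≤ 2) (ht0 : 0 ≤ t) (ht1 : t ≤ 1) :
    (ν - 1) / 2 * (1 - t) ^ 2 ≤ (t ^ ν - 1) / ν - (t - 1) := by
  let g : ℝ → ℝ := fun t => (t ^ ν - 1) / ν - (t - 1) - (ν - 1) / 2 * (1 - t) ^ 2
  have hd : ∀ t, HasDerivAt g (t ^ (ν - 1) - 1 + (ν - 1) * (1 - t)) t := by
    intro t
    have e1 := ((Real.hasDerivAt_rpow_const (x := t) (Or.inr h1.le)).sub_const 1).div_const ν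
    have e2 := (hasDerivAt_id t).sub_const 1
    have e3 := ((((hasDerivAt_id t).const_sub 1).pow 2).const_mul ((ν - 1) / 2))
    refine ((e1.sub e2).sub e3).congr_deriv ?_
    have : ν ≠ 0 := by linarith
    simp only [id_eq]
    field_simp
    ring
  have hm : AntitoneOn g (Set.Icc 0 1) := by
    apply antitoneOn_of_deriv_nonpos (convex_Icc 0 1)
      (fun t _ => (hd t).continuousAt.continuousWithinAt)
      (fun t _ => (hd t).differentiableAt.differentiableWithinAt)
    intro t ht
    rw [interior_Icc] at ht
    rw [(hd t).deriv]
    have := _root_.rpow_one_add_le_one_add_mul_self (s := t - 1) (p := ν - 1)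
      (by linarith [ht.1]) (by linarith) (by linarith)
    rw [add_sub_cancel] at this
    linarith
  have := hm ⟨ht0, ht1⟩ ⟨zero_le_one, le_rfl⟩ ht1
  simp [g] at this
  linarith

section pointwise

variable {p : ℝ}

theorem specU_ge_of_lt (hp : 2 < p) {z : ℂ} (h : |z.im| < Real.cot (π / (2 * p)) * |z.re|) :
    |z.im| ^ p - (Real.cot (π / (2 * p)) * |z.re|) ^ p +
      gapCoeff p * |(|z.im| - Real.cot (π / (2 * p)) * |z.re|)| ^ p ≤ specU p z := by
  have hn := lt_outerExp hp
  have hκ := gapCoeff_pos hp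
  have hX := (abs_nonneg z.im).trans_lt h
  rw [specU, coneGlue_of_lt h]
  set X := Real.cot (π / (2 * p)) * |z.re|
  obtain ⟨T, hT0, hT1, hT⟩ : ∃ T, 0 ≤ T ∧ T ≤ 1 ∧ |z.im| = T * X :=
    ⟨|z.im| / X, by positivity, by rw [div_le_one hX]; exact h.le, by field_simp⟩
  rw [hT, show T * X - X = -((1 - T) * X) by ring, abs_neg,
    abs_of_nonneg (mul_nonneg (by linarith) hX.le), Real.mul_rpow hT0 hX.le,
    Real.mul_rpow (by linarith) hX.le, Real.mul_rpow hT0 hX.le, mul_assoc (T ^ outerExp p),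
    ← Real.rpow_add hX, add_sub_cancel]
  have hXp : 0 < X ^ p := by positivity
  have hν : 1 < outerExp p / p := by rw [one_lt_div (by linarith)]; exact hn
  have hν2 : outerExp p / p ≤ 2 := by
    rw [div_le_iff₀ (by linarith), outerExp]
    nlinarith [Real.cos_sq_le_one (π / (2 * p))]
  have h1 := half_mul_sq_le hν hν2 (Real.rpow_nonneg hT0 p)
    (Real.rpow_le_one hT0 hT1 (by linarith))
  rw [← Real.rpow_mul hT0, mul_div_cancel₀ _ (by linarith)] at h1
  have h2 : gapCoeff p ≤ (outerExp p / p - 1) / 2 := by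
    have h3 := two_mul_gapCoeff_le_cos hp
    have e : (outerExp p / p - 1) / 2 =
        (p - 1) * (2 * Real.cos (π / (2 * p)) ^ 2 - 1) / (2 * p) := by
      rw [outerExp]; field_simp; ring
    rw [e, le_div_iff₀ (by linarith)]
    linarith
  have h3 := mul_le_mul h2 (one_sub_rpow_le hT0 hT1 hp.le)
    (Real.rpow_nonneg (by linarith) _) (by linarith)
  have h4 := mul_le_mul_of_nonneg_right (h3.trans h1) hXp.le
  have e : (T ^ outerExp p - 1) / (outerExp p / p) = p / outerExp p * (T ^ outerExp p - 1) := by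
    field_simp
  rw [e] at h4
  linarith

theorem log_sin_ge (hp : 2 < p) {θ : ℝ} (h0 : 0 < θ) (h1 : θ ≤ π / (2 * p)) :
    Real.log (Real.cos (π / (2 * p))) - (p - 1) * Real.log (Real.sin (π / (2 * p))) +
      2 * (gapCoeff p * p) * (Real.log (Real.sin (π / (2 * p))) -
        Real.log (Real.cos (π / (2 * p)))) ≤
    Real.log (Real.sin ((p - 1) * θ)) - (p - 1) * Real.log (Real.sin θ) +
      2 * (gapCoeff p * p) * (Real.log (Real.sin θ) - Real.log (Real.cos θ)) := by
  have hlt := rieszAngle_lt hp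
  have hm := mul_rieszAngle hp
  let L : ℝ → ℝ := fun θ => Real.log (Real.sin ((p - 1) * θ)) - (p - 1) * Real.log (Real.sin θ) +
      2 * (gapCoeff p * p) * (Real.log (Real.sin θ) - Real.log (Real.cos θ))
  have hpos : ∀ t ∈ Set.Icc θ (π / (2 * p)), 0 < Real.sin ((p - 1) * t) ∧ 0 < Real.sin t ∧
      0 < Real.cos t := by
    intro t ht
    have ht0 : 0 < t := h0.trans_le ht.1
    have : p * t ≤ π / 2 := hm ▸ mul_le_mul_of_nonneg_left ht.2 (by linarith)
    refine ⟨Real.sin_pos_of_pos_of_lt_pi (mul_pos (by linarith) ht0) (by nlinarith [pi_pos]),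
      Real.sin_pos_of_pos_of_lt_pi ht0 (by linarith [ht.2, pi_pos]),
      Real.cos_pos_of_mem_Ioo ⟨by linarith [pi_pos], by linarith [ht.2, pi_pos]⟩⟩
  have hd : ∀ t ∈ Set.Icc θ (π / (2 * p)), HasDerivAt L
      ((2 * (gapCoeff p * p) * Real.sin ((p - 1) * t) -
        (p - 1) * (Real.sin ((p - 2) * t) * Real.cos t)) /
        (Real.sin ((p - 1) * t) * Real.sin t * Real.cos t)) t := by
    intro t ht
    obtain ⟨s1, s2, s3⟩ := hpos t ht
    have ea : HasDerivAt (fun t : ℝ => (p - 1) * t) (p - 1) t := by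
      simpa using (hasDerivAt_id t).const_mul (p - 1)
    have e1 := ea.sin.log s1.ne'
    have e2 := (Real.hasDerivAt_sin t).log s2.ne'
    have e3 := (Real.hasDerivAt_cos t).log s3.ne'
    refine ((e1.sub (e2.const_mul (p - 1))).add
      ((e2.sub e3).const_mul (2 * (gapCoeff p * p)))).congr_deriv ?_
    have h5 : Real.sin ((p - 2) * t) = Real.sin ((p - 1) * t) * Real.cos t -
        Real.cos ((p - 1) * t) * Real.sin t := by
      rw [← Real.sin_sub]; ring_nf
    rw [h5]
    have h6 := Real.sin_sq_add_cos_sq t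
    field_simp
    linear_combination (2 * (gapCoeff p * p)) * Real.sin ((p - 1) * t) * h6
  have hanti : AntitoneOn L (Set.Icc θ (π / (2 * p))) := by
    apply antitoneOn_of_deriv_nonpos (convex_Icc _ _)
      (fun t ht => (hd t ht).continuousAt.continuousWithinAt)
      (fun t ht => (hd t (interior_subset ht)).differentiableAt.differentiableWithinAt)
    intro t ht
    have ht := interior_subset ht
    obtain ⟨s1, s2, s3⟩ := hpos t ht
    rw [(hd t ht).deriv]
    have := two_mul_gapCoeff_mul_sin_le hp (h0.trans_le ht.1) ht.2
    exact div_nonpos_of_nonpos_of_nonneg (by linarith) (by positivity)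
  have := hanti ⟨le_rfl, h1⟩ ⟨h1, le_rfl⟩ h1
  simp only [L, sin_sub_one_mul_rieszAngle hp] at this
  exact this

theorem cot_rpow_mul_sin_rpow_le (hp : 2 < p) {θ : ℝ} (h0 : 0 < θ) (h1 : θ ≤ π / (2 * p)) :
    Real.cot (π / (2 * p)) ^ p * Real.sin θ ^ (p - 1) *
      (1 + 2 * gapCoeff p * (1 - (Real.cot (π / (2 * p)) * (Real.sin θ / Real.cos θ)) ^ p)) ≤
    innerCoeff p * Real.sin ((p - 1) * θ) := by
  have hs := sin_rieszAngle_pos hp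
  have hc := cos_rieszAngle_pos hp
  have hC := cot_rieszAngle_pos hp
  have hκ := gapCoeff_pos hp
  have hlt := rieszAngle_lt hp
  have hm := mul_rieszAngle hp
  have : p * θ ≤ π / 2 := hm ▸ mul_le_mul_of_nonneg_left h1 (by linarith)
  have s1 : 0 < Real.sin ((p - 1) * θ) :=
    Real.sin_pos_of_pos_of_lt_pi (mul_pos (by linarith) h0) (by nlinarith [pi_pos])
  have s2 : 0 < Real.sin θ := Real.sin_pos_of_pos_of_lt_pi h0 (by linarith [pi_pos])
  have s3 : 0 < Real.cos θ :=
    Real.cos_pos_of_mem_Ioo ⟨by linarith [pi_pos], by linarith [pi_pos]⟩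
  have hD : innerCoeff p = Real.cot (π / (2 * p)) ^ p *
      (Real.sin (π / (2 * p)) ^ (p - 1) / Real.cos (π / (2 * p))) := by
    rw [innerCoeff, Real.cot_eq_cos_div_sin, Real.div_rpow hc.le hs.le,
      Real.rpow_sub_one hc.ne', Real.rpow_sub_one hs.ne']
    field_simp
  set ρ := Real.sin (π / (2 * p)) ^ (p - 1) / Real.cos (π / (2 * p)) *
    (Real.sin ((p - 1) * θ) / Real.sin θ ^ (p - 1)) with hρ
  have hρ0 : 0 < ρ := by positivity
  have hXp : 0 < (Real.cot (π / (2 * p)) * (Real.sin θ / Real.cos θ)) ^ p := by positivity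
  have l1 : Real.log ρ = (p - 1) * Real.log (Real.sin (π / (2 * p))) -
      Real.log (Real.cos (π / (2 * p))) + (Real.log (Real.sin ((p - 1) * θ)) -
        (p - 1) * Real.log (Real.sin θ)) := by
    rw [hρ, Real.log_mul (by positivity) (by positivity), Real.log_div (by positivity) hc.ne',
      Real.log_div s1.ne' (by positivity), Real.log_rpow hs, Real.log_rpow s2]
  have l2 : Real.log ((Real.cot (π / (2 * p)) * (Real.sin θ / Real.cos θ)) ^ p) =
      p * (Real.log (Real.cos (π / (2 * p))) - Real.log (Real.sin (π / (2 * p))) +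
        (Real.log (Real.sin θ) - Real.log (Real.cos θ))) := by
    rw [Real.log_rpow (by positivity), Real.log_mul hC.ne' (by positivity),
      Real.cot_eq_cos_div_sin, Real.log_div hc.ne' hs.ne', Real.log_div s2.ne' s3.ne']
  have h2 := log_sin_ge hp h0 h1
  have h3 := Real.log_le_sub_one_of_pos hρ0
  have h4 := mul_le_mul_of_nonneg_left (Real.log_le_sub_one_of_pos hXp) hκ.le
  rw [l2] at h4
  rw [l1] at h3
  have h5 : 1 + 2 * gapCoeff p *
      (1 - (Real.cot (π / (2 * p)) * (Real.sin θ / Real.cos θ)) ^ p) ≤ ρ := by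
    nlinarith
  calc _ ≤ Real.cot (π / (2 * p)) ^ p * Real.sin θ ^ (p - 1) * ρ := by gcongr
    _ = _ := by rw [hD, hρ]; field_simp

theorem innerCoeff_mul_cos_ge (hp : 2 < p) {θ : ℝ} (h0 : 0 ≤ θ) (h1 : θ ≤ π / (2 * p)) :
    gapCoeff p * (1 - (Real.cot (π / (2 * p)) * (Real.sin θ / Real.cos θ)) ^ p) ^ 2 ≤
      innerCoeff p * (Real.cos (p * θ) * Real.cos θ ^ (-p)) - 1 +
        (Real.cot (π / (2 * p)) * (Real.sin θ / Real.cos θ)) ^ p := by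
  have hs := sin_rieszAngle_pos hp
  have hc := cos_rieszAngle_pos hp
  have hC := cot_rieszAngle_pos hp
  have hlt := rieszAngle_lt hp
  let X : ℝ → ℝ := fun t => (Real.cot (π / (2 * p)) * (Real.sin t / Real.cos t)) ^ p
  let N : ℝ → ℝ := fun t => innerCoeff p * (Real.cos (p * t) * Real.cos t ^ (-p)) - 1 + X t -
    gapCoeff p * (1 - X t) ^ 2
  have hcos : ∀ t ∈ Set.Icc θ (π / (2 * p)), 0 < Real.cos t := fun t ht =>
    Real.cos_pos_of_mem_Ioo ⟨by linarith [pi_pos, ht.1], by linarith [pi_pos, ht.2]⟩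
  have hd : ∀ t ∈ Set.Icc θ (π / (2 * p)), HasDerivAt N
      (p * (Real.cos t ^ (-p) / Real.cos t) * (Real.cot (π / (2 * p)) ^ p * Real.sin t ^ (p - 1) *
        (1 + 2 * gapCoeff p * (1 - X t)) - innerCoeff p * Real.sin ((p - 1) * t))) t := by
    intro t ht
    have c0 := hcos t ht
    have s0 : 0 ≤ Real.sin t := Real.sin_nonneg_of_nonneg_of_le_pi (h0.trans ht.1)
      (by linarith [ht.2, pi_pos])
    have ea : HasDerivAt (fun t : ℝ => p * t) p t := by
      simpa using (hasDerivAt_id t).const_mul p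
    have e1 := ea.cos.mul ((Real.hasDerivAt_cos t).rpow_const (p := -p) (Or.inl c0.ne'))
    have e2 : HasDerivAt X (p * (Real.cos t ^ (-p) / Real.cos t) *
        (Real.cot (π / (2 * p)) ^ p * Real.sin t ^ (p - 1))) t := by
      refine ((((Real.hasDerivAt_sin t).div (Real.hasDerivAt_cos t) c0.ne').const_mul
        (Real.cot (π / (2 * p)))).rpow_const (p := p) (Or.inr (by linarith))).congr_deriv ?_
      have h6 := Real.sin_sq_add_cos_sq t
      simp only [Pi.div_apply]
      rw [Real.mul_rpow hC.le (by positivity), Real.div_rpow s0 c0.le,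
        Real.rpow_sub_one hC.ne', Real.rpow_sub_one c0.ne', Real.rpow_neg c0.le]
      field_simp
      linear_combination Real.sin t ^ (p - 1) * h6
    refine ((((e1.const_mul (innerCoeff p)).sub_const 1).add e2).sub
      (((e2.const_sub 1).pow 2).const_mul (gapCoeff p))).congr_deriv ?_
    have h5 : Real.sin ((p - 1) * t) = Real.sin (p * t) * Real.cos t -
        Real.cos (p * t) * Real.sin t := by
      rw [← Real.sin_sub]; ring_nf
    rw [h5, Real.rpow_sub_one c0.ne' (-p)]
    field_simp
    ring
  have hanti : AntitoneOn N (Set.Icc θ (π / (2 * p))) := by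
    apply antitoneOn_of_deriv_nonpos (convex_Icc _ _)
      (fun t ht => (hd t ht).continuousAt.continuousWithinAt)
      (fun t ht => (hd t (interior_subset ht)).differentiableAt.differentiableWithinAt)
    intro t ht
    rw [(hd t (interior_subset ht)).deriv]
    have c0 := hcos t (interior_subset ht)
    rw [interior_Icc] at ht
    have := cot_rpow_mul_sin_rpow_le hp (h0.trans_lt ht.1) ht.2.le
    exact mul_nonpos_of_nonneg_of_nonpos (by positivity) (by linarith)
  have hend : N (π / (2 * p)) = 0 := by
    have : Real.cot (π / (2 * p)) * (Real.sin (π / (2 * p)) / Real.cos (π / (2 * p))) = 1 := by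
      rw [Real.cot_eq_cos_div_sin]; field_simp
    simp [N, X, this, mul_rieszAngle hp]
  have := hanti ⟨le_rfl, h1⟩ ⟨h1, le_rfl⟩ h1
  rw [hend] at this
  simp only [N, X] at this
  linarith

theorem specU_ge_of_le (hp : 2 < p) {z : ℂ} (h : Real.cot (π / (2 * p)) * |z.re| ≤ |z.im|) :
    |z.im| ^ p - (Real.cot (π / (2 * p)) * |z.re|) ^ p +
      gapCoeff p * |(|z.im| - Real.cot (π / (2 * p)) * |z.re|)| ^ p ≤ specU p z := by
  have hκ := gapCoeff_pos hp
  have hC := cot_rieszAngle_pos hp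
  have h1 := abs_arg_foldPt_le hp h
  have hcos : 0 < Real.cos |Complex.arg (foldPt z)| := Real.cos_pos_of_mem_Ioo
    ⟨by linarith [pi_pos, abs_nonneg (Complex.arg (foldPt z))],
      by linarith [pi_pos, rieszAngle_lt hp]⟩
  have hsin : 0 ≤ Real.sin |Complex.arg (foldPt z)| := Real.sin_nonneg_of_nonneg_of_le_pi
    (abs_nonneg _) (by linarith [pi_pos, rieszAngle_lt hp])
  have h2 := innerCoeff_mul_cos_ge hp (abs_nonneg (Complex.arg (foldPt z))) h1
  rw [specU, coneGlue_of_le h, foldPt_cpow_re, ← Real.cos_abs (p * _), abs_mul,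
    abs_of_pos (by linarith : 0 < p)]
  rcases (norm_nonneg z).eq_or_lt with hz | hz
  · have hz : z = 0 := norm_eq_zero.1 hz.symm
    simp [hz, Real.zero_rpow (by linarith : p ≠ 0)]
  rw [← norm_mul_cos_abs_arg_foldPt, ← norm_mul_sin_abs_arg_foldPt] at h ⊢
  set θ := |Complex.arg (foldPt z)|
  obtain ⟨T, hT⟩ : ∃ T, T = Real.cot (π / (2 * p)) * (Real.sin θ / Real.cos θ) := ⟨_, rfl⟩
  have hT0 : 0 ≤ T := by rw [hT]; positivity
  have hT2 : Real.cot (π / (2 * p)) * (‖z‖ * Real.sin θ) = ‖z‖ * Real.cos θ * T := by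
    rw [hT]; field_simp
  have hT1 : T ≤ 1 := by
    rw [hT2] at h
    exact le_of_mul_le_mul_left (by linarith) (mul_pos hz hcos)
  rw [← hT] at h2
  rw [hT2, show ‖z‖ * Real.cos θ - ‖z‖ * Real.cos θ * T = ‖z‖ * Real.cos θ * (1 - T) by ring,
    abs_of_nonneg (mul_nonneg (by positivity) (by linarith)),
    Real.mul_rpow (y := 1 - T) (by positivity) (by linarith),
    Real.mul_rpow (y := T) (by positivity) hT0, Real.mul_rpow hz.le hcos.le]
  rw [Real.rpow_neg hcos.le] at h2
  have h3 := mul_le_mul_of_nonneg_left (one_sub_rpow_le hT0 hT1 hp.le) hκ.le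
  have hcp : 0 < Real.cos θ ^ p := by positivity
  have hzp : 0 < ‖z‖ ^ p := by positivity
  have h4 := mul_le_mul_of_nonneg_right (h3.trans h2) (mul_pos hzp hcp).le
  have e : (innerCoeff p * (Real.cos (p * θ) * (Real.cos θ ^ p)⁻¹) - 1 + T ^ p) *
      (‖z‖ ^ p * Real.cos θ ^ p) = innerCoeff p * (‖z‖ ^ p * Real.cos (p * θ)) -
        ‖z‖ ^ p * Real.cos θ ^ p + ‖z‖ ^ p * Real.cos θ ^ p * T ^ p := by
    field_simp
  rw [e] at h4
  linarith

theorem specU_ge (hp : 2 < p) (z : ℂ) :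
    |z.im| ^ p - (Real.cot (π / (2 * p)) * |z.re|) ^ p +
      gapCoeff p * |(|z.im| - Real.cot (π / (2 * p)) * |z.re|)| ^ p ≤ specU p z :=
  (le_or_gt (Real.cot (π / (2 * p)) * |z.re|) |z.im|).elim (specU_ge_of_le hp)
    (specU_ge_of_lt hp)

end pointwise

section hardyExt

variable {E : Type*} [NormedAddCommGroup E] [InnerProductSpace ℝ E] {γ : E} {b : E → ℂ}

/-- The kernel of the Poisson-type extension of a frequency-supported function. -/
noncomputable def hardyKernel (γ : E) (s : ℝ) (x ξ : E) : ℂ :=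
  Complex.exp (2 * π * (inner ℝ ξ x * Complex.I - (max s 0 : ℝ) * inner ℝ ξ γ))

/-- The Fourier side of the derivative in the direction `γ`. -/
noncomputable def freqDeriv (γ : E) (b : E → ℂ) (ξ : E) : ℂ :=
  2 * π * Complex.I * inner ℝ ξ γ * b ξ

theorem norm_hardyKernel (γ : E) (s : ℝ) (x ξ : E) :
    ‖hardyKernel γ s x ξ‖ = Real.exp (-(2 * π * (max s 0 * inner ℝ ξ γ))) := by
  rw [hardyKernel, Complex.norm_exp]
  congr 1
  generalize max s 0 = r
  simp

theorem norm_hardyKernel_mul_le (hb : ∀ ξ, inner ℝ ξ γ ≤ 0 → b ξ = 0) (s : ℝ) (x ξ : E) :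
    ‖hardyKernel γ s x ξ * b ξ‖ ≤ ‖b ξ‖ := by
  rcases le_or_gt (inner ℝ ξ γ) 0 with h | h
  · simp [hb ξ h]
  · rw [norm_mul, norm_hardyKernel]
    apply mul_le_of_le_one_left (norm_nonneg _)
    rw [Real.exp_le_one_iff]
    have : 0 ≤ max s 0 := le_max_right _ _
    have := pi_pos
    rw [neg_nonpos]
    positivity

theorem continuous_hardyKernel (γ : E) :
    Continuous fun q : ℝ × E × E => hardyKernel γ q.1 q.2.1 q.2.2 := by
  unfold hardyKernel
  fun_prop

theorem freqDeriv_support (hb : ∀ ξ, inner ℝ ξ γ ≤ 0 → b ξ = 0) :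
    ∀ ξ, inner ℝ ξ γ ≤ 0 → freqDeriv γ b ξ = 0 := fun ξ h => by simp [freqDeriv, hb ξ h]

variable [FiniteDimensional ℝ E] [MeasurableSpace E] [BorelSpace E]

/-- The holomorphic extension in the direction `γ` of the function with Fourier transform `b`. -/
noncomputable def hardyExt (γ : E) (b : E → ℂ) (s : ℝ) (x : E) : ℂ :=
  ∫ ξ, hardyKernel γ s x ξ * b ξ

theorem aestronglyMeasurable_hardyKernel_mul (hbm : AEStronglyMeasurable b) (s : ℝ) (x : E) :
    AEStronglyMeasurable (fun ξ => hardyKernel γ s x ξ * b ξ) :=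
  ((continuous_hardyKernel γ).comp (by fun_prop : Continuous fun ξ : E => (s, x, ξ))
    ).aestronglyMeasurable.mul hbm

theorem integrable_hardyKernel_mul (hb : ∀ ξ, inner ℝ ξ γ ≤ 0 → b ξ = 0) (hi : Integrable b)
    (s : ℝ) (x : E) : Integrable fun ξ => hardyKernel γ s x ξ * b ξ :=
  hi.norm.mono' (aestronglyMeasurable_hardyKernel_mul hi.1 s x)
    (Filter.Eventually.of_forall fun ξ => norm_hardyKernel_mul_le hb s x ξ)

theorem norm_hardyExt_le (hb : ∀ ξ, inner ℝ ξ γ ≤ 0 → b ξ = 0) (hi : Integrable b)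
    (s : ℝ) (x : E) : ‖hardyExt γ b s x‖ ≤ ∫ ξ, ‖b ξ‖ :=
  norm_integral_le_of_norm_le hi.norm
    (Filter.Eventually.of_forall fun ξ => norm_hardyKernel_mul_le hb s x ξ)

theorem continuous_hardyExt (hb : ∀ ξ, inner ℝ ξ γ ≤ 0 → b ξ = 0) (hi : Integrable b) :
    Continuous fun q : ℝ × E => hardyExt γ b q.1 q.2 := by
  refine continuous_of_dominated (fun q => aestronglyMeasurable_hardyKernel_mul hi.1 q.1 q.2)
    (fun q => Filter.Eventually.of_forall fun ξ => norm_hardyKernel_mul_le hb q.1 q.2 ξ)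
    hi.norm (Filter.Eventually.of_forall fun ξ => ?_)
  exact ((continuous_hardyKernel γ).comp
    (by fun_prop : Continuous fun q : ℝ × E => (q.1, q.2, ξ))).mul continuous_const

theorem hardyExt_eq_fourierInv (γ : E) (b : E → ℂ) (s : ℝ) :
    hardyExt γ b s = 𝓕⁻ fun ξ => hardyKernel γ s 0 ξ * b ξ := by
  funext x
  rw [Real.fourierInv_eq']
  unfold hardyExt
  congr 1
  funext ξ
  rw [smul_eq_mul, ← mul_assoc, hardyKernel, hardyKernel, ← Complex.exp_add]
  congr 2
  simp
  ring

theorem hardyExt_zero (γ : E) (b : E → ℂ) : hardyExt γ b 0 = 𝓕⁻ b := by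
  rw [hardyExt_eq_fourierInv]
  simp [hardyKernel]

theorem memLp_two_hardyKernel_mul (hb : ∀ ξ, inner ℝ ξ γ ≤ 0 → b ξ = 0) (h2 : MemLp b 2)
    (s : ℝ) (x : E) : MemLp (fun ξ => hardyKernel γ s x ξ * b ξ) 2 :=
  h2.mono (aestronglyMeasurable_hardyKernel_mul h2.1 s x)
    (Filter.Eventually.of_forall fun ξ => norm_hardyKernel_mul_le hb s x ξ)

theorem memLp_two_hardyExt (hb : ∀ ξ, inner ℝ ξ γ ≤ 0 → b ξ = 0) (hi : Integrable b)
    (h2 : MemLp b 2) (s : ℝ) : MemLp (hardyExt γ b s) 2 := by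
  rw [hardyExt_eq_fourierInv]
  exact memLp_two_fourierInv (integrable_hardyKernel_mul hb hi s 0)
    (memLp_two_hardyKernel_mul hb h2 s 0)

theorem integrable_norm_sq_hardyExt (hb : ∀ ξ, inner ℝ ξ γ ≤ 0 → b ξ = 0) (hi : Integrable b)
    (h2 : MemLp b 2) (s : ℝ) : Integrable fun x => ‖hardyExt γ b s x‖ ^ 2 :=
  (memLp_two_iff_integrable_sq_norm (memLp_two_hardyExt hb hi h2 s).1).1
    (memLp_two_hardyExt hb hi h2 s)

theorem integral_norm_sq_hardyExt (hb : ∀ ξ, inner ℝ ξ γ ≤ 0 → b ξ = 0) (hi : Integrable b)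
    (h2 : MemLp b 2) (s : ℝ) :
    ∫ x, ‖hardyExt γ b s x‖ ^ 2 = ∫ ξ, ‖hardyKernel γ s 0 ξ * b ξ‖ ^ 2 := by
  rw [hardyExt_eq_fourierInv]
  exact integral_norm_sq_fourierInv (integrable_hardyKernel_mul hb hi s 0)
    (memLp_two_hardyKernel_mul hb h2 s 0)

theorem integral_norm_sq_hardyExt_le (hb : ∀ ξ, inner ℝ ξ γ ≤ 0 → b ξ = 0) (hi : Integrable b)
    (h2 : MemLp b 2) (s : ℝ) : ∫ x, ‖hardyExt γ b s x‖ ^ 2 ≤ ∫ ξ, ‖b ξ‖ ^ 2 := by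
  rw [integral_norm_sq_hardyExt hb hi h2]
  refine integral_mono_of_nonneg (Filter.Eventually.of_forall fun ξ => by positivity)
    ((memLp_two_iff_integrable_sq_norm h2.1).1 h2) (Filter.Eventually.of_forall fun ξ => ?_)
  exact pow_le_pow_left₀ (norm_nonneg _) (norm_hardyKernel_mul_le hb s 0 ξ) 2

theorem tendsto_integral_norm_sq_hardyExt (hb : ∀ ξ, inner ℝ ξ γ ≤ 0 → b ξ = 0)
    (hi : Integrable b) (h2 : MemLp b 2) :
    Filter.Tendsto (fun n : ℕ => ∫ x, ‖hardyExt γ b n x‖ ^ 2) Filter.atTop (nhds 0) := by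
  simp_rw [integral_norm_sq_hardyExt hb hi h2]
  rw [← integral_zero E ℝ]
  refine tendsto_integral_of_dominated_convergence (fun ξ => ‖b ξ‖ ^ 2)
    (fun n => ((aestronglyMeasurable_hardyKernel_mul hi.1 n 0).norm.pow 2))
    ((memLp_two_iff_integrable_sq_norm h2.1).1 h2)
    (fun n => Filter.Eventually.of_forall fun ξ => ?_) (Filter.Eventually.of_forall fun ξ => ?_)
  · rw [Real.norm_of_nonneg (by positivity)]
    exact pow_le_pow_left₀ (norm_nonneg _) (norm_hardyKernel_mul_le hb n 0 ξ) 2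
  · rcases le_or_gt (inner ℝ ξ γ) 0 with h | h
    · simp [hb ξ h]
    · have h1 : Filter.Tendsto (fun n : ℕ => -(2 * π * (max (n : ℝ) 0 * inner ℝ ξ γ)))
          Filter.atTop Filter.atBot := by
        have : ∀ n : ℕ, -(2 * π * (max (n : ℝ) 0 * inner ℝ ξ γ)) =
            -((2 * π * inner ℝ ξ γ) * n) := by
          intro n; rw [max_eq_left (Nat.cast_nonneg n)]; ring
        simp_rw [this]
        exact Filter.tendsto_neg_atTop_atBot.comp
          (tendsto_natCast_atTop_atTop.const_mul_atTop (by have := pi_pos; positivity))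
      have h2 := (Real.tendsto_exp_atBot.comp h1).mul_const ‖b ξ‖
      have h3 := h2.pow 2
      simp only [zero_mul, ne_eq, OfNat.ofNat_ne_zero, not_false_eq_true, zero_pow] at h3
      refine h3.congr fun n => ?_
      rw [norm_mul, norm_hardyKernel]
      rfl

theorem hasDerivAt_hardyExt_space (hb : ∀ ξ, inner ℝ ξ γ ≤ 0 → b ξ = 0) (hi : Integrable b)
    (hi1 : Integrable (freqDeriv γ b)) (s : ℝ) (x : E) (t : ℝ) :
    HasDerivAt (fun t : ℝ => hardyExt γ b s (x + t • γ))
      (hardyExt γ (freqDeriv γ b) s (x + t • γ)) t := by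
  have key := (hasDerivAt_integral_of_dominated_loc_of_deriv_le (x₀ := t) (s := Set.univ)
    (μ := (volume : Measure E)) (F := fun (t : ℝ) ξ => hardyKernel γ s (x + t • γ) ξ * b ξ)
    (F' := fun t ξ => hardyKernel γ s (x + t • γ) ξ * freqDeriv γ b ξ)
    (bound := fun ξ => ‖freqDeriv γ b ξ‖)
    Filter.univ_mem (Filter.Eventually.of_forall fun t =>
      aestronglyMeasurable_hardyKernel_mul hi.1 _ _)
    (integrable_hardyKernel_mul hb hi _ _)
    (aestronglyMeasurable_hardyKernel_mul hi1.1 _ _)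
    (Filter.Eventually.of_forall fun ξ t _ =>
      norm_hardyKernel_mul_le (freqDeriv_support hb) _ _ _) hi1.norm
    (Filter.Eventually.of_forall fun ξ t _ => ?_)).2
  · exact key
  have h1 : HasDerivAt (fun t : ℝ => ((inner ℝ ξ (x + t • γ) : ℝ) : ℂ)) (inner ℝ ξ γ : ℝ) t := by
    have : HasDerivAt (fun t : ℝ => (inner ℝ ξ (x + t • γ) : ℝ)) (inner ℝ ξ γ) t := by
      simp only [inner_add_right, inner_smul_right]
      simpa using ((hasDerivAt_id t).mul_const (inner ℝ ξ γ)).const_add (inner ℝ ξ x)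
    exact this.ofReal_comp
  have h2 := ((((h1.mul_const Complex.I).sub_const
    (((max s 0 : ℝ) : ℂ) * (inner ℝ ξ γ : ℝ))).const_mul (2 * π : ℂ)).cexp).mul_const (b ξ)
  refine h2.congr_deriv ?_
  simp only [hardyKernel, freqDeriv]
  ring

theorem hasDerivAt_hardyExt_height (hb : ∀ ξ, inner ℝ ξ γ ≤ 0 → b ξ = 0) (hi : Integrable b)
    (hi1 : Integrable (freqDeriv γ b)) {s : ℝ} (hs : 0 < s) (x : E) :
    HasDerivAt (fun s : ℝ => hardyExt γ b s x)
      (Complex.I * hardyExt γ (freqDeriv γ b) s x) s := by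
  have key := (hasDerivAt_integral_of_dominated_loc_of_deriv_le
    (F := fun s ξ => hardyKernel γ s x ξ * b ξ)
    (F' := fun s ξ => Complex.I * (hardyKernel γ s x ξ * freqDeriv γ b ξ))
    (bound := fun ξ => ‖freqDeriv γ b ξ‖)
    (Ioi_mem_nhds hs) (Filter.Eventually.of_forall fun t =>
      aestronglyMeasurable_hardyKernel_mul hi.1 _ _)
    (integrable_hardyKernel_mul hb hi _ _)
    ((aestronglyMeasurable_hardyKernel_mul hi1.1 _ _).const_mul _)
    (Filter.Eventually.of_forall fun ξ t _ => by
      rw [norm_mul, Complex.norm_I, one_mul]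
      exact norm_hardyKernel_mul_le (freqDeriv_support hb) _ _ _) hi1.norm
    (Filter.Eventually.of_forall fun ξ t ht => ?_)).2
  · rw [integral_const_mul] at key
    exact key
  have h1 : HasDerivAt (fun t : ℝ => (((max t 0 : ℝ)) : ℂ)) 1 t := by
    have : HasDerivAt (fun t : ℝ => max t 0) 1 t :=
      (hasDerivAt_id t).congr_of_eventuallyEq
        (by filter_upwards [Ioi_mem_nhds ht] with r hr; exact max_eq_left (le_of_lt hr))
    simpa using this.ofReal_comp
  have h2 := ((((h1.mul_const ((inner ℝ ξ γ : ℝ) : ℂ)).const_sub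
    ((inner ℝ ξ x : ℝ) * Complex.I)).const_mul (2 * π : ℂ)).cexp).mul_const (b ξ)
  refine h2.congr_deriv ?_
  simp only [hardyKernel, freqDeriv]
  linear_combination (-(Complex.exp (2 * π * (inner ℝ ξ x * Complex.I -
    (max t 0 : ℝ) * inner ℝ ξ γ)) * (2 * π * inner ℝ ξ γ * b ξ))) * Complex.I_sq

end hardyExt

/-- The derivative of `specU p` at `z` in the direction `w`. -/
noncomputable def specD (p : ℝ) (z w : ℂ) : ℝ := specUx p z * w.re + specUy p z * w.im

/-- The second derivative of `specU p` along a curve with position `z`, velocity `w` and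
acceleration `v`. -/
noncomputable def specDD (p : ℝ) (z w v : ℂ) : ℝ :=
  specUxx p z * w.re ^ 2 + 2 * specUxy p z * w.re * w.im + specUyy p z * w.im ^ 2 + specD p z v

theorem hasDerivAt_specU_comp {p : ℝ} (hp : 2 < p) {g : ℝ → ℂ} {w : ℂ} {t : ℝ}
    (hg : HasDerivAt g w t) : HasDerivAt (fun t => specU p (g t)) (specD p (g t) w) t := by
  have := (hasFDerivAt_specU hp (g t)).comp_hasDerivAt t hg
  exact this.congr_deriv (by simp [specD])

theorem hasDerivAt_specD_comp {p : ℝ} (hp : 2 < p) {g h : ℝ → ℂ} {v : ℂ} {t : ℝ}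
    (hg : HasDerivAt g (h t) t) (hh : HasDerivAt h v t) :
    HasDerivAt (fun t => specD p (g t) (h t)) (specDD p (g t) (h t) v) t := by
  have h1 := (hasFDerivAt_specUx hp (g t)).comp_hasDerivAt t hg
  have h2 := (hasFDerivAt_specUy hp (g t)).comp_hasDerivAt t hg
  have h3 : HasDerivAt (fun t => (h t).re) v.re t :=
    Complex.reCLM.hasFDerivAt.comp_hasDerivAt t hh
  have h4 : HasDerivAt (fun t => (h t).im) v.im t :=
    Complex.imCLM.hasFDerivAt.comp_hasDerivAt t hh
  have h5 := (h1.mul h3).add (h2.mul h4)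
  refine h5.congr_deriv ?_
  simp [specDD, specD]
  ring

theorem specDD_add_le {p : ℝ} (hp : 2 < p) (z w v : ℂ) :
    specDD p z (Complex.I * w) (Complex.I * (Complex.I * v)) + specDD p z w v ≤ 0 := by
  have h := specUxx_add_specUyy_nonpos hp z
  have e : specDD p z (Complex.I * w) (Complex.I * (Complex.I * v)) + specDD p z w v =
      (specUxx p z + specUyy p z) * (w.re ^ 2 + w.im ^ 2) := by
    simp [specDD, specD]
    ring
  rw [e]
  exact mul_nonpos_of_nonpos_of_nonneg h (by positivity)

theorem continuous_specD {p : ℝ} (hp : 2 < p) : Continuous fun q : ℂ × ℂ => specD p q.1 q.2 := by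
  have := continuous_specUx hp
  have := continuous_specUy hp
  unfold specD
  fun_prop

theorem measurable_specDD {p : ℝ} (hp : 2 < p) :
    Measurable fun q : ℂ × ℂ × ℂ => specDD p q.1 q.2.1 q.2.2 := by
  have h1 := measurable_specUxx (p := p)
  have h2 := measurable_specUxy (p := p)
  have h3 := measurable_specUyy (p := p)
  have h4 := (continuous_specUx hp).measurable
  have h5 := (continuous_specUy hp).measurable
  unfold specDD specD
  fun_prop

theorem exists_abs_specU_le {p : ℝ} (hp : 2 < p) (K : ℝ) :
    ∃ C, 0 ≤ C ∧ ∀ z, ‖z‖ ≤ K → |specU p z| ≤ C * ‖z‖ ^ 2 := by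
  obtain ⟨M, hM⟩ := powBdd_specU hp
  refine ⟨|M| * |K| ^ (p - 2), by positivity, fun z hz => ?_⟩
  refine (hM z trivial).trans ?_
  have : ‖z‖ ^ p = ‖z‖ ^ (p - 2) * ‖z‖ ^ 2 := by
    rw [← Real.rpow_natCast ‖z‖ 2, ← Real.rpow_add_of_nonneg (norm_nonneg _) (by linarith)
      (by norm_num)]
    norm_num
  rw [this, mul_assoc]
  gcongr
  · exact le_abs_self M
  · exact hz.trans (le_abs_self K)

theorem exists_abs_specD_le {p : ℝ} (hp : 2 < p) (K : ℝ) :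
    ∃ C, 0 ≤ C ∧ ∀ z w, ‖z‖ ≤ K → |specD p z w| ≤ C * (‖z‖ ^ 2 + ‖w‖ ^ 2) := by
  obtain ⟨M, hM⟩ := powBdd_specUx hp
  obtain ⟨N, hN⟩ := powBdd_specUy hp
  refine ⟨(|M| + |N|) * |K| ^ (p - 2), by positivity, fun z w hz => ?_⟩
  have hz1 : ‖z‖ ^ (p - 1) ≤ |K| ^ (p - 2) * ‖z‖ := by
    have : ‖z‖ ^ (p - 1) = ‖z‖ ^ (p - 2) * ‖z‖ := by
      conv_rhs => rw [← Real.rpow_one ‖z‖, Real.rpow_one,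
        ← Real.rpow_add_one' (norm_nonneg _) (by linarith)]
      ring_nf
    rw [this]
    gcongr
    exact hz.trans (le_abs_self K)
  have hx := (hM z trivial).trans (mul_le_mul (le_abs_self M) hz1 (by positivity) (by positivity))
  have hy := (hN z trivial).trans (mul_le_mul (le_abs_self N) hz1 (by positivity) (by positivity))
  have a1 : |specUx p z * w.re| ≤ |M| * (|K| ^ (p - 2) * ‖z‖) * ‖w‖ := by
    rw [abs_mul]
    exact mul_le_mul hx (Complex.abs_re_le_norm w) (abs_nonneg _) (by positivity)
  have a2 : |specUy p z * w.im| ≤ |N| * (|K| ^ (p - 2) * ‖z‖) * ‖w‖ := by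
    rw [abs_mul]
    exact mul_le_mul hy (Complex.abs_im_le_norm w) (abs_nonneg _) (by positivity)
  calc |specD p z w| ≤ _ := (abs_add_le _ _).trans (add_le_add a1 a2)
    _ = (|M| + |N|) * |K| ^ (p - 2) * (‖z‖ * ‖w‖) := by ring
    _ ≤ _ := by
      gcongr
      nlinarith [sq_nonneg (‖z‖ - ‖w‖), sq_nonneg ‖z‖, sq_nonneg ‖w‖]

theorem exists_abs_specDD_le {p : ℝ} (hp : 2 < p) (K : ℝ) :
    ∃ C, 0 ≤ C ∧ ∀ z w v, ‖z‖ ≤ K →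
      |specDD p z w v| ≤ C * (‖z‖ ^ 2 + ‖w‖ ^ 2 + ‖v‖ ^ 2) := by
  obtain ⟨C, hC, hD⟩ := exists_abs_specD_le hp K
  obtain ⟨M, hM⟩ := powBdd_specUxx hp
  obtain ⟨N, hN⟩ := powBdd_specUxy hp
  obtain ⟨P, hP⟩ := powBdd_specUyy hp
  set B := |K| ^ (p - 1 - 1)
  have hB : 0 ≤ B := by positivity
  refine ⟨C + (|M| + 2 * |N| + |P|) * B, by positivity, fun z w v hz => ?_⟩
  have hz1 : ‖z‖ ^ (p - 1 - 1) ≤ B :=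
    Real.rpow_le_rpow (norm_nonneg _) (hz.trans (le_abs_self K)) (by linarith)
  have hx := (hM z trivial).trans (mul_le_mul (le_abs_self M) hz1 (by positivity) (by positivity))
  have hy := (hN z trivial).trans (mul_le_mul (le_abs_self N) hz1 (by positivity) (by positivity))
  have hw := (hP z trivial).trans (mul_le_mul (le_abs_self P) hz1 (by positivity) (by positivity))
  have r1 := Complex.abs_re_le_norm w
  have r2 := Complex.abs_im_le_norm w
  have a1 : |specUxx p z * w.re ^ 2| ≤ |M| * B * ‖w‖ ^ 2 := by
    rw [abs_mul, abs_pow]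
    gcongr
  have a2 : |2 * specUxy p z * w.re * w.im| ≤ 2 * (|N| * B) * ‖w‖ * ‖w‖ := by
    rw [abs_mul, abs_mul, abs_mul, abs_two]
    gcongr
  have a3 : |specUyy p z * w.im ^ 2| ≤ |P| * B * ‖w‖ ^ 2 := by
    rw [abs_mul, abs_pow]
    gcongr
  have a4 := hD z v hz
  calc |specDD p z w v| ≤ |specUxx p z * w.re ^ 2| + |2 * specUxy p z * w.re * w.im| +
        |specUyy p z * w.im ^ 2| + |specD p z v| := by
        unfold specDD
        exact (abs_add_le _ _).trans (add_le_add_left ((abs_add_le _ _).trans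
          (add_le_add_left (abs_add_le _ _) _)) _)
    _ ≤ (|M| * B * ‖w‖ ^ 2 + 2 * (|N| * B) * ‖w‖ * ‖w‖ + |P| * B * ‖w‖ ^ 2) +
        C * (‖z‖ ^ 2 + ‖v‖ ^ 2) := by linarith
    _ ≤ _ := by
      have : 0 ≤ (|M| + 2 * |N| + |P|) * B := by positivity
      nlinarith [mul_nonneg hC (sq_nonneg ‖w‖), mul_nonneg this (sq_nonneg ‖z‖),
        mul_nonneg this (sq_nonneg ‖v‖)]

/-- A sequence with nonpositive second differences tending to zero starts at a nonpositive
value. -/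
theorem nonpos_of_concave_of_tendsto_zero {W : ℕ → ℝ}
    (hW : ∀ n, W (n + 2) + W n - 2 * W (n + 1) ≤ 0)
    (hlim : Filter.Tendsto W Filter.atTop (nhds 0)) : W 0 ≤ 0 := by
  have hanti : Antitone fun n => W (n + 1) - W n :=
    antitone_nat_of_succ_le fun n => by have := hW n; simp only [add_assoc]; norm_num; linarith
  have hd : Filter.Tendsto (fun n => W (n + 1) - W n) Filter.atTop (nhds 0) := by
    simpa using ((Filter.tendsto_add_atTop_iff_nat 1).2 hlim).sub hlim
  have hmono : Monotone W := monotone_nat_of_le_succ fun n => by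
    have := hanti.le_of_tendsto hd n
    linarith
  exact hmono.ge_of_tendsto hlim 0

section hardy

variable {E : Type*} [NormedAddCommGroup E] [InnerProductSpace ℝ E] [FiniteDimensional ℝ E]
  [MeasurableSpace E] [BorelSpace E] {γ : E} {b : E → ℂ}

/-- Integrable and square integrable symbols supported in the half space `⟪ξ, γ⟫ > 0`. -/
structure IsHardySymbol (γ : E) (b : E → ℂ) : Prop where
  support : ∀ ξ, inner ℝ ξ γ ≤ 0 → b ξ = 0
  integrable : Integrable b
  memLp : MemLp b 2

namespace IsHardySymbol

theorem continuous (h : IsHardySymbol γ b) : Continuous fun q : ℝ × E => hardyExt γ b q.1 q.2 :=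
  continuous_hardyExt h.support h.integrable

theorem continuous_right (h : IsHardySymbol γ b) (s : ℝ) : Continuous (hardyExt γ b s) :=
  Continuous.comp (g := fun q : ℝ × E => hardyExt γ b q.1 q.2) (f := fun x : E => (s, x))
    h.continuous (by fun_prop)

theorem norm_le (h : IsHardySymbol γ b) (s : ℝ) (x : E) : ‖hardyExt γ b s x‖ ≤ ∫ ξ, ‖b ξ‖ :=
  norm_hardyExt_le h.support h.integrable s x

theorem integrable_sq (h : IsHardySymbol γ b) (s : ℝ) :
    Integrable fun x => ‖hardyExt γ b s x‖ ^ 2 :=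
  integrable_norm_sq_hardyExt h.support h.integrable h.memLp s

theorem integral_sq_le (h : IsHardySymbol γ b) (s : ℝ) :
    ∫ x, ‖hardyExt γ b s x‖ ^ 2 ≤ ∫ ξ, ‖b ξ‖ ^ 2 :=
  integral_norm_sq_hardyExt_le h.support h.integrable h.memLp s

theorem integrable_prod_sq (h : IsHardySymbol γ b) (u v : ℝ) :
    Integrable (fun q : ℝ × E => ‖hardyExt γ b (u + v * q.1) q.2‖ ^ 2)
      ((volume.restrict (Set.Ioc 0 1)).prod volume) := by
  have hc : Continuous fun q : ℝ × E => ‖hardyExt γ b (u + v * q.1) q.2‖ ^ 2 :=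
    (Continuous.comp (g := fun q : ℝ × E => ‖hardyExt γ b q.1 q.2‖)
      (f := fun q : ℝ × E => (u + v * q.1, q.2)) h.continuous.norm (by fun_prop)).pow 2
  rw [integrable_prod_iff hc.aestronglyMeasurable]
  refine ⟨Filter.Eventually.of_forall fun σ => h.integrable_sq (u + v * σ), ?_⟩
  refine Integrable.mono' (g := fun _ => ∫ ξ, ‖b ξ‖ ^ 2) (integrable_const _)
    hc.norm.aestronglyMeasurable.integral_prod_right' (Filter.Eventually.of_forall fun σ => ?_)
  simp only [norm_pow, norm_norm]
  rw [Real.norm_of_nonneg (by positivity)]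
  exact h.integral_sq_le (u + v * σ)

variable {p : ℝ}

theorem hasDerivAt_specU (hp : 2 < p) (h : IsHardySymbol γ b)
    (h1 : IsHardySymbol γ (freqDeriv γ b)) {s : ℝ} (hs : 0 < s) (x : E) :
    HasDerivAt (fun s => specU p (hardyExt γ b s x))
      (specD p (hardyExt γ b s x) (Complex.I * hardyExt γ (freqDeriv γ b) s x)) s :=
  hasDerivAt_specU_comp hp (hasDerivAt_hardyExt_height h.support h.integrable h1.integrable hs x)

theorem hasDerivAt_specD (hp : 2 < p) (h : IsHardySymbol γ b)
    (h1 : IsHardySymbol γ (freqDeriv γ b)) (h2 : IsHardySymbol γ (freqDeriv γ (freqDeriv γ b)))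
    {s : ℝ} (hs : 0 < s) (x : E) :
    HasDerivAt (fun s => specD p (hardyExt γ b s x) (Complex.I * hardyExt γ (freqDeriv γ b) s x))
      (specDD p (hardyExt γ b s x) (Complex.I * hardyExt γ (freqDeriv γ b) s x)
        (Complex.I * (Complex.I * hardyExt γ (freqDeriv γ (freqDeriv γ b)) s x))) s :=
  hasDerivAt_specD_comp (g := fun s => hardyExt γ b s x)
    (h := fun s => Complex.I * hardyExt γ (freqDeriv γ b) s x) hp
    (hasDerivAt_hardyExt_height h.support h.integrable h1.integrable hs x)
    ((hasDerivAt_hardyExt_height h1.support h1.integrable h2.integrable hs x).const_mul _)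

theorem integrable_specU (hp : 2 < p) (h : IsHardySymbol γ b) (s : ℝ) :
    Integrable fun x => specU p (hardyExt γ b s x) := by
  obtain ⟨C, -, hC⟩ := exists_abs_specU_le hp (∫ ξ, ‖b ξ‖)
  exact ((h.integrable_sq s).const_mul C).mono'
    ((continuous_specU hp).comp (h.continuous_right s)).aestronglyMeasurable
    (Filter.Eventually.of_forall fun x => hC _ (h.norm_le s x))

theorem tendsto_integral_specU (hp : 2 < p) (h : IsHardySymbol γ b) :
    Filter.Tendsto (fun n : ℕ => ∫ x, specU p (hardyExt γ b n x)) Filter.atTop (nhds 0) := by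
  obtain ⟨C, -, hC⟩ := exists_abs_specU_le hp (∫ ξ, ‖b ξ‖)
  have ht := (tendsto_integral_norm_sq_hardyExt h.support h.integrable h.memLp).const_mul C
  rw [mul_zero] at ht
  refine squeeze_zero_norm (fun n => ?_) ht
  rw [← integral_const_mul]
  exact norm_integral_le_of_norm_le ((h.integrable_sq n).const_mul C)
    (Filter.Eventually.of_forall fun x => hC _ (h.norm_le n x))

/-- The second derivative along the boundary direction has zero integral. -/
theorem integral_specDD_space (hp : 2 < p) (h : IsHardySymbol γ b)
    (h1 : IsHardySymbol γ (freqDeriv γ b)) (h2 : IsHardySymbol γ (freqDeriv γ (freqDeriv γ b)))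
    (s : ℝ) :
    Integrable (fun x => specDD p (hardyExt γ b s x) (hardyExt γ (freqDeriv γ b) s x)
      (hardyExt γ (freqDeriv γ (freqDeriv γ b)) s x)) ∧
    ∫ x, specDD p (hardyExt γ b s x) (hardyExt γ (freqDeriv γ b) s x)
      (hardyExt γ (freqDeriv γ (freqDeriv γ b)) s x) = 0 := by
  obtain ⟨C, -, hC⟩ := exists_abs_specD_le hp (∫ ξ, ‖b ξ‖)
  obtain ⟨D, -, hD⟩ := exists_abs_specDD_le hp (∫ ξ, ‖b ξ‖)
  have c0 := h.continuous_right s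
  have c1 := h1.continuous_right s
  have c2 := h2.continuous_right s
  have i1 : Integrable fun x => specD p (hardyExt γ b s x) (hardyExt γ (freqDeriv γ b) s x) :=
    (((h.integrable_sq s).add (h1.integrable_sq s)).const_mul C).mono'
      ((continuous_specD hp).comp (c0.prodMk c1)).aestronglyMeasurable
      (Filter.Eventually.of_forall fun x => hC _ _ (h.norm_le s x))
  have i2 : Integrable fun x => specDD p (hardyExt γ b s x) (hardyExt γ (freqDeriv γ b) s x)
      (hardyExt γ (freqDeriv γ (freqDeriv γ b)) s x) :=
    ((((h.integrable_sq s).add (h1.integrable_sq s)).add (h2.integrable_sq s)).const_mul D).mono'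
      ((measurable_specDD hp).comp
        (c0.measurable.prodMk (c1.measurable.prodMk c2.measurable))).aestronglyMeasurable
      (Filter.Eventually.of_forall fun x => hD _ _ _ (h.norm_le s x))
  refine ⟨i2, ?_⟩
  have key := integral_bilinear_hasLineDerivAt_right_eq_neg_left_of_integrable
    (μ := (volume : Measure E)) (B := ContinuousLinearMap.mul ℝ ℝ) (f := fun _ => (1 : ℝ))
    (f' := fun _ => (0 : ℝ)) (v := γ)
    (g := fun x => specD p (hardyExt γ b s x) (hardyExt γ (freqDeriv γ b) s x))
    (g' := fun x => specDD p (hardyExt γ b s x) (hardyExt γ (freqDeriv γ b) s x)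
      (hardyExt γ (freqDeriv γ (freqDeriv γ b)) s x))
    (by simp) (by simpa using i2) (by simpa using i1)
    (fun x _ => by simpa [HasLineDerivAt] using hasDerivAt_const (0 : ℝ) (1 : ℝ))
    (fun x _ => by
      have e0 := hasDerivAt_hardyExt_space h.support h.integrable h1.integrable s x 0
      have e1 := hasDerivAt_hardyExt_space h1.support h1.integrable h2.integrable s x 0
      have e2 := hasDerivAt_specD_comp (g := fun t : ℝ => hardyExt γ b s (x + t • γ))
        (h := fun t : ℝ => hardyExt γ (freqDeriv γ b) s (x + t • γ)) hp e0 e1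
      simp only [zero_smul, add_zero] at e2
      exact e2)
  simpa using key

/-- The second derivative in the height has nonpositive integral. -/
theorem integral_specDD_height (hp : 2 < p) (h : IsHardySymbol γ b)
    (h1 : IsHardySymbol γ (freqDeriv γ b)) (h2 : IsHardySymbol γ (freqDeriv γ (freqDeriv γ b)))
    (s : ℝ) :
    ∫ x, specDD p (hardyExt γ b s x) (Complex.I * hardyExt γ (freqDeriv γ b) s x)
      (Complex.I * (Complex.I * hardyExt γ (freqDeriv γ (freqDeriv γ b)) s x)) ≤ 0 := by
  obtain ⟨hi, h0⟩ := integral_specDD_space hp h h1 h2 s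
  by_cases hint : Integrable fun x => specDD p (hardyExt γ b s x)
      (Complex.I * hardyExt γ (freqDeriv γ b) s x)
      (Complex.I * (Complex.I * hardyExt γ (freqDeriv γ (freqDeriv γ b)) s x))
  · have : ∫ x, specDD p (hardyExt γ b s x) (Complex.I * hardyExt γ (freqDeriv γ b) s x)
        (Complex.I * (Complex.I * hardyExt γ (freqDeriv γ (freqDeriv γ b)) s x)) +
        specDD p (hardyExt γ b s x) (hardyExt γ (freqDeriv γ b) s x)
        (hardyExt γ (freqDeriv γ (freqDeriv γ b)) s x) ≤ 0 :=
      integral_nonpos fun x => specDD_add_le hp _ _ _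
    rw [integral_add hint hi, h0, add_zero] at this
    exact this
  · rw [integral_undef hint]

theorem integrable_prod_specDD (hp : 2 < p) (h : IsHardySymbol γ b)
    (h1 : IsHardySymbol γ (freqDeriv γ b)) (h2 : IsHardySymbol γ (freqDeriv γ (freqDeriv γ b)))
    (u v : ℝ) :
    Integrable (fun q : ℝ × E => (1 - q.1) * specDD p (hardyExt γ b (u + v * q.1) q.2)
      (Complex.I * hardyExt γ (freqDeriv γ b) (u + v * q.1) q.2)
      (Complex.I * (Complex.I * hardyExt γ (freqDeriv γ (freqDeriv γ b)) (u + v * q.1) q.2)))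
      ((volume.restrict (Set.Ioc 0 1)).prod volume) := by
  obtain ⟨D, hD0, hD⟩ := exists_abs_specDD_le hp (∫ ξ, ‖b ξ‖)
  have hc : Continuous fun q : ℝ × E => (u + v * q.1, q.2) := by fun_prop
  have c0 := (h.continuous.comp hc).measurable
  have c1 := ((h1.continuous.comp hc).const_smul Complex.I).measurable
  have c2 := (((h2.continuous.comp hc).const_smul Complex.I).const_smul Complex.I).measurable
  refine ((((h.integrable_prod_sq u v).add (h1.integrable_prod_sq u v)).add
    (h2.integrable_prod_sq u v)).const_mul D).mono'
    ((measurable_const.sub measurable_fst).mul ((measurable_specDD hp).comp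
        (c0.prodMk (c1.prodMk c2)))).aestronglyMeasurable ?_
  have hs : ∀ᵐ q ∂((volume.restrict (Set.Ioc (0 : ℝ) 1)).prod (volume : Measure E)),
      q.1 ∈ Set.Ioc (0 : ℝ) 1 :=
    Measure.quasiMeasurePreserving_fst.ae (ae_restrict_mem measurableSet_Ioc)
  filter_upwards [hs] with q hq
  have h3 := hD _ (Complex.I * hardyExt γ (freqDeriv γ b) (u + v * q.1) q.2)
    (Complex.I * (Complex.I * hardyExt γ (freqDeriv γ (freqDeriv γ b)) (u + v * q.1) q.2))
    (h.norm_le (u + v * q.1) q.2)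
  simp only [norm_mul, Complex.norm_I, one_mul] at h3
  rw [norm_mul]
  refine (mul_le_of_le_one_left (norm_nonneg _) ?_).trans h3
  rw [Real.norm_eq_abs, abs_le]
  constructor <;> linarith [hq.1, hq.2]

/-- The integral of `specU p` along the extension has nonpositive second differences. -/
theorem integral_specU_concave (hp : 2 < p) (h : IsHardySymbol γ b)
    (h1 : IsHardySymbol γ (freqDeriv γ b)) (h2 : IsHardySymbol γ (freqDeriv γ (freqDeriv γ b)))
    {u : ℝ} (hu : 1 ≤ u) :
    (∫ x, specU p (hardyExt γ b (u + 1) x)) + (∫ x, specU p (hardyExt γ b (u - 1) x)) -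
      2 * ∫ x, specU p (hardyExt γ b u x) ≤ 0 := by
  set g := fun (s : ℝ) (x : E) => specU p (hardyExt γ b s x)
  set g' := fun (s : ℝ) (x : E) =>
    specD p (hardyExt γ b s x) (Complex.I * hardyExt γ (freqDeriv γ b) s x)
  set g'' := fun (s : ℝ) (x : E) => specDD p (hardyExt γ b s x)
    (Complex.I * hardyExt γ (freqDeriv γ b) s x)
    (Complex.I * (Complex.I * hardyExt γ (freqDeriv γ (freqDeriv γ b)) s x))
  have hg : ∀ {s : ℝ}, 0 < s → ∀ x, HasDerivAt (fun s => g s x) (g' s x) s :=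
    fun hs x => h.hasDerivAt_specU hp h1 hs x
  have hg' : ∀ {s : ℝ}, 0 < s → ∀ x, HasDerivAt (fun s => g' s x) (g'' s x) s :=
    fun hs x => h.hasDerivAt_specD hp h1 h2 hs x
  have cs : ∀ {a : E → ℂ}, IsHardySymbol γ a → ∀ x, Continuous fun s => hardyExt γ a s x :=
    fun {a} ha x => Continuous.comp (g := fun q : ℝ × E => hardyExt γ a q.1 q.2)
      (f := fun s : ℝ => (s, x)) ha.continuous (by fun_prop)
  have cg : ∀ x, Continuous fun s => g s x := fun x => (continuous_specU hp).comp (cs h x)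
  have cg' : ∀ x, Continuous fun s => g' s x := fun x =>
    (continuous_specD hp).comp ((cs h x).prodMk ((cs h1 x).const_smul Complex.I))
  have i1 := h.integrable_prod_specDD hp h1 h2 u 1
  have i2 := h.integrable_prod_specDD hp h1 h2 u (-1)
  have hF : Integrable (fun q : ℝ × E => (1 - q.1) * g'' (u + 1 * q.1) q.2 +
      (1 - q.1) * g'' (u + (-1) * q.1) q.2) ((volume.restrict (Set.Ioc 0 1)).prod volume) :=
    i1.add i2
  have hslice : ∀ᵐ x : E, ∫ σ in Set.Ioc (0 : ℝ) 1, ((1 - σ) * g'' (u + 1 * σ) x +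
      (1 - σ) * g'' (u + (-1) * σ) x) = g (u + 1) x + g (u - 1) x - 2 * g u x := by
    filter_upwards [hF.prod_left_ae] with x hx
    rw [← intervalIntegral.integral_of_le zero_le_one]
    have := intervalIntegral.integral_eq_sub_of_hasDerivAt_of_le (a := 0) (b := 1)
      (f := fun σ => (1 - σ) * (g' (u + 1 * σ) x - g' (u + (-1) * σ) x) +
        (g (u + 1 * σ) x + g (u + (-1) * σ) x))
      (f' := fun σ => (1 - σ) * g'' (u + 1 * σ) x + (1 - σ) * g'' (u + (-1) * σ) x)
      zero_le_one ?_ ?_ ((intervalIntegrable_iff_integrableOn_Ioc_of_le zero_le_one).2 hx)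
    · rw [this]
      simp only [mul_one, mul_zero, add_zero, ← sub_eq_add_neg]
      ring
    · have := cg x
      have := cg' x
      fun_prop
    · intro σ hσ
      have l1 : HasDerivAt (fun σ : ℝ => u + 1 * σ) 1 σ := by
        simpa using ((hasDerivAt_id σ).const_mul (1 : ℝ)).const_add u
      have l2 : HasDerivAt (fun σ : ℝ => u + (-1) * σ) (-1) σ := by
        simpa using ((hasDerivAt_id σ).const_mul (-1 : ℝ)).const_add u
      have p1 : 0 < u + 1 * σ := by linarith [hσ.1]
      have p2 : 0 < u + (-1) * σ := by linarith [hσ.2]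
      have a1 := (hg p1 x).comp σ l1
      have a2 := (hg p2 x).comp σ l2
      have b1 := (hg' p1 x).comp σ l1
      have b2 := (hg' p2 x).comp σ l2
      refine ((((hasDerivAt_id σ).const_sub 1).mul (b1.sub b2)).add (a1.add a2)).congr_deriv ?_
      simp
      ring
  have hswap := integral_integral_swap (f := fun (σ : ℝ) (x : E) =>
    (1 - σ) * g'' (u + 1 * σ) x + (1 - σ) * g'' (u + (-1) * σ) x) hF
  rw [integral_congr_ae hslice] at hswap
  have e : ∫ x, (g (u + 1) x + g (u - 1) x - 2 * g u x) =
      (∫ x, g (u + 1) x) + (∫ x, g (u - 1) x) - 2 * ∫ x, g u x := by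
    rw [integral_sub, integral_add, integral_const_mul]
    · exact h.integrable_specU hp _
    · exact h.integrable_specU hp _
    · exact (h.integrable_specU hp _).add (h.integrable_specU hp _)
    · exact (h.integrable_specU hp _).const_mul 2
  rw [← e, ← hswap]
  refine integral_nonpos_of_ae ?_
  filter_upwards [i1.prod_right_ae, i2.prod_right_ae, ae_restrict_mem measurableSet_Ioc]
    with σ h1σ h2σ hσ
  rw [integral_add h1σ h2σ, integral_const_mul, integral_const_mul, ← mul_add]
  exact mul_nonpos_of_nonneg_of_nonpos (by linarith [hσ.2])
    (add_nonpos (h.integral_specDD_height hp h1 h2 _) (h.integral_specDD_height hp h1 h2 _))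

/-- Functions in a Hardy class have nonpositive `specU p`-energy. -/
theorem integral_specU_nonpos (hp : 2 < p) (h : IsHardySymbol γ b)
    (h1 : IsHardySymbol γ (freqDeriv γ b)) (h2 : IsHardySymbol γ (freqDeriv γ (freqDeriv γ b))) :
    ∫ x, specU p (𝓕⁻ b x) ≤ 0 := by
  have key := nonpos_of_concave_of_tendsto_zero
    (W := fun n : ℕ => ∫ x, specU p (hardyExt γ b n x)) (fun n => ?_)
    (tendsto_integral_specU hp h)
  · simpa [hardyExt_zero] using key
  · have := integral_specU_concave hp h h1 h2 (u := n + 1) (by simp)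
    push_cast
    rw [show (n : ℝ) + 2 = n + 1 + 1 by ring]
    rwa [add_sub_cancel_right] at this

end IsHardySymbol

end hardy

section directional

variable {E : Type*} [NormedAddCommGroup E] [InnerProductSpace ℝ E]

/-- The symbol of the analytic completion, in the direction `γ`, of the real part of the function
with Fourier transform `g`. -/
noncomputable def hardySymbol (γ : E) (g : E → ℂ) (ξ : E) : ℂ :=
  if 0 < inner ℝ ξ γ then g ξ + (starRingEnd ℂ) (g (-ξ)) else 0

/-- The symbol of the directional Hilbert transform applied to a function with Fourier
transform `g`. -/
noncomputable def hilbertSymbol (γ : E) (g : E → ℂ) (ξ : E) : ℂ :=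
  -Complex.I * ((SignType.sign (inner ℝ ξ γ) : ℝ) : ℂ) * g ξ

theorem norm_hilbertSymbol_le (γ : E) (g : E → ℂ) (ξ : E) : ‖hilbertSymbol γ g ξ‖ ≤ ‖g ξ‖ := by
  unfold hilbertSymbol
  rcases lt_trichotomy (inner ℝ ξ γ) 0 with h | h | h <;> simp [h]

theorem freqDeriv_hardySymbol (γ : E) (g : E → ℂ) :
    freqDeriv γ (hardySymbol γ g) = hardySymbol γ (freqDeriv γ g) := by
  funext ξ
  unfold freqDeriv hardySymbol
  split_ifs
  · simp [inner_neg_left, Complex.conj_ofNat]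
    ring
  · simp

theorem exists_schwartz_freqDeriv (γ : E) (g : SchwartzMap E ℂ) :
    ∃ g' : SchwartzMap E ℂ, (g' : E → ℂ) = freqDeriv γ g := by
  refine ⟨SchwartzMap.smulLeftCLM ℂ (fun ξ : E => (2 * π * Complex.I * (inner ℝ ξ γ : ℝ) : ℂ)) g, ?_⟩
  funext ξ
  rw [SchwartzMap.smulLeftCLM_apply_apply (by fun_prop), smul_eq_mul, freqDeriv]

variable [FiniteDimensional ℝ E] [MeasurableSpace E] [BorelSpace E]

theorem memLp_conj_comp_neg {g : E → ℂ} {q : ENNReal} (hg : MemLp g q) :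
    MemLp (fun ξ => (starRingEnd ℂ) (g (-ξ))) q := by
  have := (hg.comp_measurePreserving (Measure.measurePreserving_neg (volume : Measure E)))
  exact this.star

theorem isHardySymbol_hardySymbol (γ : E) {g : E → ℂ} (hi : Integrable g) (h2 : MemLp g 2) :
    IsHardySymbol γ (hardySymbol γ g) := by
  have hs : MeasurableSet {ξ : E | 0 < inner ℝ ξ γ} :=
    measurableSet_lt measurable_const (by fun_prop)
  have e : hardySymbol γ g = Set.indicator {ξ : E | 0 < inner ℝ ξ γ}
      (fun ξ => g ξ + (starRingEnd ℂ) (g (-ξ))) := by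
    funext ξ
    simp only [hardySymbol, Set.indicator_apply, Set.mem_ofPred_eq]
  refine ⟨fun ξ h => if_neg h.not_gt, ?_, ?_⟩
  · rw [e, ← memLp_one_iff_integrable]
    rw [← memLp_one_iff_integrable] at hi
    exact (hi.add (memLp_conj_comp_neg hi)).indicator hs
  · rw [e]
    exact (h2.add (memLp_conj_comp_neg h2)).indicator hs

theorem ae_inner_ne_zero {γ : E} (hγ : γ ≠ 0) : ∀ᵐ ξ : E, inner ℝ ξ γ ≠ 0 := by
  have h := Measure.addHaar_submodule (volume : Measure E) (ℝ ∙ γ)ᗮ (by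
    intro h
    rw [Submodule.orthogonal_eq_top_iff, Submodule.span_singleton_eq_bot] at h
    exact hγ h)
  rw [← compl_mem_ae_iff] at h
  filter_upwards [h] with ξ hξ h0
  exact hξ (Submodule.mem_orthogonal_singleton_iff_inner_left.2 h0)

theorem fourierInv_conj_comp_neg (g : E → ℂ) (x : E) :
    𝓕⁻ (fun ξ => (starRingEnd ℂ) (g (-ξ))) x = (starRingEnd ℂ) (𝓕⁻ g x) := by
  rw [Real.fourierInv_eq', Real.fourierInv_eq', ← integral_conj,
    ← integral_neg_eq_self (μ := (volume : Measure E))]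
  congr 1
  funext ξ
  simp only [smul_eq_mul, map_mul, neg_neg, ← Complex.exp_conj]
  congr 2
  simp [Complex.conj_ofNat]

theorem integrable_fourierChar_inner_smul {g : E → ℂ} (hg : Integrable g) (x : E) :
    Integrable fun ξ => 𝐞 (inner ℝ ξ x) • g ξ := by
  refine hg.mono (Continuous.aestronglyMeasurable ?_ |>.smul hg.1)
    (Filter.Eventually.of_forall fun ξ => (Circle.norm_smul _ _).le)
  exact continuous_induced_dom.comp
    (Continuous.comp (f := fun ξ : E => inner ℝ ξ x) Real.continuous_fourierChar (by fun_prop))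

theorem fourierInv_hardySymbol {γ : E} (hγ : γ ≠ 0) {g : E → ℂ} (hi : Integrable g) (x : E) :
    𝓕⁻ (hardySymbol γ g) x = ⟨(𝓕⁻ g x).re, (𝓕⁻ (hilbertSymbol γ g) x).re⟩ := by
  have hs : MeasurableSet {ξ : E | 0 < inner ℝ ξ γ} :=
    measurableSet_lt measurable_const (by fun_prop)
  have ht : MeasurableSet {ξ : E | inner ℝ ξ γ < 0} :=
    measurableSet_lt (by fun_prop) measurable_const
  set u := Set.indicator {ξ : E | 0 < inner ℝ ξ γ} g with hu
  set v := Set.indicator {ξ : E | inner ℝ ξ γ < 0} g with hv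
  have iu : Integrable u := hi.indicator hs
  have iv : Integrable v := hi.indicator ht
  have e1 : hardySymbol γ g = u + fun ξ => (starRingEnd ℂ) (v (-ξ)) := by
    funext ξ
    simp only [hardySymbol, hu, hv, Pi.add_apply, Set.indicator_apply, Set.mem_ofPred_eq,
      inner_neg_left, Left.neg_neg_iff]
    split_ifs <;> simp
  have iv' : Integrable fun ξ => (starRingEnd ℂ) (v (-ξ)) := by
    rw [← memLp_one_iff_integrable] at iv ⊢
    exact memLp_conj_comp_neg iv
  have hadd : ∀ {a b : E → ℂ}, Integrable a → Integrable b →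
      𝓕⁻ (a + b) x = 𝓕⁻ a x + 𝓕⁻ b x := by
    intro a b ha hb
    simp only [Real.fourierInv_eq, Pi.add_apply, smul_add]
    exact integral_add (integrable_fourierChar_inner_smul ha x)
      (integrable_fourierChar_inner_smul hb x)
  have e2 : 𝓕⁻ g x = 𝓕⁻ (u + v) x := by
    rw [Real.fourierInv_eq', Real.fourierInv_eq']
    refine integral_congr_ae ?_
    filter_upwards [ae_inner_ne_zero hγ] with ξ hξ
    congr 1
    simp only [hu, hv, Pi.add_apply, Set.indicator_apply, Set.mem_ofPred_eq]
    rcases hξ.lt_or_gt with h | h <;> simp [h, h.not_gt]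
  have e3 : 𝓕⁻ (hilbertSymbol γ g) x = 𝓕⁻ ((-Complex.I) • u + Complex.I • v) x := by
    refine congrArg (fun a : E → ℂ => 𝓕⁻ a x) (funext fun ξ => ?_)
    simp only [hilbertSymbol, hu, hv, Pi.add_apply, Pi.smul_apply, Set.indicator_apply,
      Set.mem_ofPred_eq]
    rcases lt_trichotomy (inner ℝ ξ γ) 0 with h | h | h <;> simp [h, h.not_gt]
  have hsm : ∀ (c : ℂ) (a : E → ℂ), 𝓕⁻ (c • a) x = c * 𝓕⁻ a x := by
    intro c a
    simp only [Real.fourierInv_eq, Pi.smul_apply, smul_comm _ c]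
    exact integral_const_mul c _
  rw [e1, hadd iu iv', fourierInv_conj_comp_neg, e2, hadd iu iv, e3,
    hadd (iu.smul _) (iv.smul _), hsm, hsm]
  apply Complex.ext <;> simp

theorem integral_specU_directional_nonpos {p : ℝ} (hp : 2 < p) {γ : E} (hγ : γ ≠ 0)
    (h : SchwartzMap E ℂ) :
    ∫ x, specU p ⟨(h x).re, (𝓕⁻ (hilbertSymbol γ (𝓕 (h : E → ℂ))) x).re⟩ ≤ 0 := by
  obtain ⟨g1, hg1⟩ := exists_schwartz_freqDeriv γ (𝓕 h)
  obtain ⟨g2, hg2⟩ := exists_schwartz_freqDeriv γ g1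
  have s0 := isHardySymbol_hardySymbol γ (𝓕 h).integrable ((𝓕 h).memLp 2)
  have s1 := isHardySymbol_hardySymbol γ g1.integrable (g1.memLp 2)
  have s2 := isHardySymbol_hardySymbol γ g2.integrable (g2.memLp 2)
  rw [hg2, ← freqDeriv_hardySymbol, hg1, ← freqDeriv_hardySymbol] at s2
  rw [hg1, ← freqDeriv_hardySymbol] at s1
  have key := s0.integral_specU_nonpos hp s1 s2
  simp_rw [fourierInv_hardySymbol hγ (𝓕 h).integrable] at key
  have : ∀ x, 𝓕⁻ ((𝓕 h : SchwartzMap E ℂ) : E → ℂ) x = h x := fun x => by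
    rw [← SchwartzMap.fourierInv_coe, FourierTransform.fourierInv_fourier_eq]
  simp_rw [this, SchwartzMap.fourier_coe] at key
  exact key

end directional

theorem abs_coe_sign_le (r : ℝ) : |(SignType.sign r : ℝ)| ≤ 1 := by
  rcases lt_trichotomy r 0 with h | h | h <;> simp [h]

theorem abs_inner_le_of_mem_ball {E : Type*} [NormedAddCommGroup E] [InnerProductSpace ℝ E]
    {e γ : E} (he : ‖e‖ = 1) (hγ : γ ∈ Metric.ball (0 : E) 1) : |inner ℝ γ e| ≤ 1 := by
  refine (abs_real_inner_le_norm γ e).trans ?_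
  rw [he, mul_one]
  exact (mem_ball_zero_iff.1 hγ).le

section rotations

variable {E : Type*} [NormedAddCommGroup E] [InnerProductSpace ℝ E] [FiniteDimensional ℝ E]
  [MeasurableSpace E] [BorelSpace E]

theorem setIntegral_ball_comp_isometry (L : E ≃ₗᵢ[ℝ] E) (f : E → ℝ) :
    ∫ γ in Metric.ball (0 : E) 1, f (L γ) = ∫ γ in Metric.ball (0 : E) 1, f γ := by
  have h := L.measurePreserving.setIntegral_preimage_emb
    L.toHomeomorph.measurableEmbedding f (Metric.ball 0 1)
  rw [LinearIsometryEquiv.preimage_ball, map_zero] at h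
  exact h

theorem integrableOn_ball_of_bound {f : E → ℝ} (hf : Measurable f) {C : ℝ}
    (hC : ∀ γ ∈ Metric.ball (0 : E) 1, |f γ| ≤ C) : IntegrableOn f (Metric.ball (0 : E) 1) :=
  Measure.integrableOn_of_bounded (M := C) measure_ball_lt_top.ne hf.aestronglyMeasurable
    ((ae_restrict_iff' measurableSet_ball).2 (Filter.Eventually.of_forall hC))

theorem setIntegral_abs_inner_eq {u e : E} (hue : ‖u‖ = ‖e‖) :
    ∫ γ in Metric.ball (0 : E) 1, |inner ℝ γ u| = ∫ γ in Metric.ball (0 : E) 1, |inner ℝ γ e| := by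
  have h := Submodule.reflection_sub hue
  rw [← setIntegral_ball_comp_isometry (Submodule.reflection (ℝ ∙ (u - e))ᗮ)
    (fun γ => |inner ℝ γ e|)]
  congr 1
  funext γ
  rw [← LinearIsometryEquiv.inner_map_map (Submodule.reflection (ℝ ∙ (u - e))ᗮ), h]

theorem setIntegral_inner_mul_sign {u e : E} (hu : ‖u‖ = 1) (he : ‖e‖ = 1) :
    ∫ γ in Metric.ball (0 : E) 1, inner ℝ γ e * (SignType.sign (inner ℝ u γ) : ℝ) =
      inner ℝ u e * ∫ γ in Metric.ball (0 : E) 1, |inner ℝ γ u| := by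
  set L := Submodule.reflection (ℝ ∙ u) with hL
  have hLf : ∀ γ, L γ = (2 * inner ℝ u γ) • u - γ := fun γ => by
    rw [hL, Submodule.reflection_apply, Submodule.starProjection_unit_singleton ℝ hu]
    module
  have hint : ∀ f : E → ℝ, Measurable f → (∀ γ ∈ Metric.ball (0 : E) 1, |f γ| ≤ 1) →
      IntegrableOn (fun γ => f γ * (SignType.sign (inner ℝ u γ) : ℝ)) (Metric.ball (0 : E) 1) := by
    intro f hf hb
    refine integrableOn_ball_of_bound (C := 1)
      (hf.mul (measurable_coe_sign.comp (by fun_prop))) fun γ hγ => ?_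
    rw [abs_mul]
    exact mul_le_one₀ (hb γ hγ) (abs_nonneg _) (abs_coe_sign_le _)
  have h1 := setIntegral_ball_comp_isometry L
    (fun γ => inner ℝ γ e * (SignType.sign (inner ℝ u γ) : ℝ))
  have hLu : ∀ γ, inner ℝ u (L γ) = inner ℝ u γ := fun γ => by
    rw [hLf, inner_sub_right, inner_smul_right, real_inner_self_eq_norm_sq, hu]
    ring
  simp only [hLu] at h1
  have i0 := hint (fun γ => inner ℝ γ e) (by fun_prop) fun γ hγ => abs_inner_le_of_mem_ball he hγ
  have i1 := hint (fun γ => inner ℝ (L γ) e) (by fun_prop) fun γ hγ =>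
    abs_inner_le_of_mem_ball he (by simpa using hγ)
  have h2 := integral_add i0 i1
  have h3 : ∀ γ, inner ℝ γ e * (SignType.sign (inner ℝ u γ) : ℝ) +
      inner ℝ (L γ) e * (SignType.sign (inner ℝ u γ) : ℝ) =
      2 * (inner ℝ u e * |inner ℝ γ u|) := fun γ => by
    rw [hLf, inner_sub_left, inner_smul_left, real_inner_comm u γ, ← self_mul_sign (inner ℝ u γ)]
    simp only [conj_trivial]
    ring
  simp_rw [h3] at h2
  rw [integral_const_mul, integral_const_mul] at h2
  linarith

theorem setIntegral_abs_inner_mul_sign (u e : E) :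
    ∫ γ in Metric.ball (0 : E) 1, |inner ℝ γ e| * (SignType.sign (inner ℝ u γ) : ℝ) = 0 := by
  have h := setIntegral_ball_comp_isometry (LinearIsometryEquiv.neg ℝ)
    (fun γ : E => |inner ℝ γ e| * (SignType.sign (inner ℝ u γ) : ℝ))
  simp only [LinearIsometryEquiv.coe_neg, inner_neg_left, inner_neg_right, abs_neg,
    Left.sign_neg, SignType.coe_neg, mul_neg, integral_neg] at h
  linarith

/-- The sign symbols average to the symbol of the Riesz transform in the direction `e`. -/
theorem setIntegral_max_inner_mul_sign {e : E} (he : ‖e‖ = 1) (ξ : E) :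
    ∫ γ in Metric.ball (0 : E) 1, max (inner ℝ γ e) 0 * (SignType.sign (inner ℝ ξ γ) : ℝ) =
      (∫ γ in Metric.ball (0 : E) 1, max (inner ℝ γ e) 0) * (inner ℝ ξ e / ‖ξ‖) := by
  have hmax : ∀ γ : E, max (inner ℝ γ e) 0 = (inner ℝ γ e + |inner ℝ γ e|) / 2 := fun γ => by
    rcases le_total (inner ℝ γ e) 0 with h | h
    · rw [max_eq_right h, abs_of_nonpos h]; ring
    · rw [max_eq_left h, abs_of_nonneg h]; ring
  have hodd : ∫ γ in Metric.ball (0 : E) 1, inner ℝ γ e = 0 := by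
    have h := setIntegral_ball_comp_isometry (LinearIsometryEquiv.neg ℝ)
      (fun γ : E => inner ℝ γ e)
    simp only [LinearIsometryEquiv.coe_neg, inner_neg_left, integral_neg] at h
    linarith
  have hb : ∀ γ ∈ Metric.ball (0 : E) 1, |inner ℝ γ e| ≤ 1 :=
    fun γ hγ => abs_inner_le_of_mem_ball he hγ
  have j0 : IntegrableOn (fun γ : E => inner ℝ γ e) (Metric.ball (0 : E) 1) :=
    integrableOn_ball_of_bound (by fun_prop) hb
  rcases eq_or_ne ξ 0 with rfl | hξ
  · simp
  set u := ‖ξ‖⁻¹ • ξ with hu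
  have hn : 0 < ‖ξ‖ := norm_pos_iff.2 hξ
  have hu1 : ‖u‖ = 1 := by rw [hu, norm_smul, norm_inv, norm_norm, inv_mul_cancel₀ hn.ne']
  have hsign : ∀ γ, SignType.sign (inner ℝ ξ γ) = SignType.sign (inner ℝ u γ) := fun γ => by
    rw [hu, inner_smul_left]
    simp [sign_mul, sign_pos (inv_pos.2 hn)]
  have i0 : IntegrableOn (fun γ => inner ℝ γ e * (SignType.sign (inner ℝ u γ) : ℝ))
      (Metric.ball (0 : E) 1) :=
    j0.mul_bdd (c := 1) (measurable_coe_sign.comp (by fun_prop)).aestronglyMeasurable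
      (Filter.Eventually.of_forall fun γ => abs_coe_sign_le _)
  have i1 : IntegrableOn (fun γ => |inner ℝ γ e| * (SignType.sign (inner ℝ u γ) : ℝ))
      (Metric.ball (0 : E) 1) :=
    j0.abs.mul_bdd (c := 1) (measurable_coe_sign.comp (by fun_prop)).aestronglyMeasurable
      (Filter.Eventually.of_forall fun γ => abs_coe_sign_le _)
  have hue : inner ℝ ξ e / ‖ξ‖ = inner ℝ u e := by
    rw [hu, inner_smul_left]
    simp
    ring
  simp_rw [hmax, hsign, div_mul_eq_mul_div, add_mul, integral_div]
  rw [integral_add i0 i1, integral_add j0 j0.abs, setIntegral_inner_mul_sign hu1 he,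
    setIntegral_abs_inner_mul_sign, hodd, setIntegral_abs_inner_eq (hu1.trans he.symm), hue]
  ring

theorem setIntegral_max_inner_pos {e : E} (he : ‖e‖ = 1) :
    0 < ∫ γ in Metric.ball (0 : E) 1, max (inner ℝ γ e) 0 := by
  rw [setIntegral_pos_iff_support_of_nonneg_ae]
  · have ho : IsOpen (Function.support (fun γ : E => max (inner ℝ γ e) 0) ∩ Metric.ball 0 1) :=
      ((by fun_prop : Continuous fun γ : E => max (inner ℝ γ e) 0).isOpen_support).inter
        Metric.isOpen_ball
    refine ho.measure_pos _ ⟨(1 / 2 : ℝ) • e, ?_, ?_⟩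
    · simp [inner_smul_left, he]
    · simp [norm_smul, he]
      norm_num
  · exact Filter.Eventually.of_forall fun γ => le_max_right _ _
  · refine integrableOn_ball_of_bound (C := 1) (by fun_prop) fun γ hγ => ?_
    rw [abs_of_nonneg (le_max_right _ _)]
    exact max_le ((le_abs_self _).trans (abs_inner_le_of_mem_ball he hγ)) zero_le_one

end rotations

theorem specU_tangent_le {p : ℝ} (hp : 2 < p) (x y y' : ℝ) :
    specU p ⟨x, y⟩ + specUy p ⟨x, y⟩ * (y' - y) ≤ specU p ⟨x, y'⟩ := by
  have hd : HasDerivAt (fun y => specU p ⟨x, y⟩) (specUy p ⟨x, y⟩) y := by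
    have hl : HasDerivAt (fun y : ℝ => (⟨x, y⟩ : ℂ)) Complex.I y := by
      have : (fun y : ℝ => (⟨x, y⟩ : ℂ)) = fun y : ℝ => (x : ℂ) + (y : ℂ) * Complex.I := by
        funext y
        exact Complex.mk_eq_add_mul_I x y
      rw [this]
      simpa using ((hasDerivAt_id y).ofReal_comp.mul_const Complex.I).const_add (x : ℂ)
    exact (hasDerivAt_specU_comp hp hl).congr_deriv (by simp [specD])
  have hc := convexOn_specU_im hp x
  rcases lt_trichotomy y y' with h | rfl | h
  · have := hc.le_slope_of_hasDerivAt trivial trivial h hd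
    rw [slope_def_field, le_div_iff₀ (by linarith)] at this
    linarith
  · simp
  · have := hc.slope_le_of_hasDerivAt trivial trivial h hd
    rw [slope_def_field, div_le_iff₀ (by linarith)] at this
    linarith

theorem exists_abs_specU_re_le {p : ℝ} (hp : 2 < p) (K : ℝ) :
    ∃ C, 0 ≤ C ∧ ∀ a b : ℂ, ‖a‖ ≤ K → ‖b‖ ≤ K →
      |specU p ⟨a.re, b.re⟩| ≤ C * (‖a‖ ^ 2 + ‖b‖ ^ 2) := by
  obtain ⟨C, hC, h⟩ := exists_abs_specU_le hp (2 * K)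
  refine ⟨C, hC, fun a b ha hb => ?_⟩
  have h1 := Complex.abs_re_le_norm a
  have h2 := Complex.abs_re_le_norm b
  refine (h _ ((Complex.norm_le_abs_re_add_abs_im _).trans ?_)).trans ?_
  · simp only
    linarith
  · gcongr
    rw [Complex.sq_norm, Complex.normSq_mk, ← sq, ← sq, ← sq_abs a.re, ← sq_abs b.re]
    gcongr

section

variable {E : Type*} [NormedAddCommGroup E] [InnerProductSpace ℝ E] {g a : E → ℂ}

/-- The symbol of the Riesz transform in the direction `e` applied to a function with Fourier
transform `g`. -/
noncomputable def rieszSymbol (e : E) (g : E → ℂ) (ξ : E) : ℂ :=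
  -Complex.I * ((inner ℝ ξ e / ‖ξ‖ : ℝ) : ℂ) * g ξ

theorem norm_rieszSymbol_le {e : E} (he : ‖e‖ = 1) (g : E → ℂ) (ξ : E) :
    ‖rieszSymbol e g ξ‖ ≤ ‖g ξ‖ := by
  rw [rieszSymbol, norm_mul, norm_mul, norm_neg, Complex.norm_I, one_mul, Complex.norm_real]
  refine mul_le_of_le_one_left (norm_nonneg _) ?_
  have := abs_real_inner_div_norm_mul_norm_le_one ξ e
  rwa [he, mul_one] at this

variable [FiniteDimensional ℝ E] [MeasurableSpace E] [BorelSpace E]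

theorem continuous_fourierInv (ha : Integrable a) : Continuous (𝓕⁻ a) := by
  rw [Real.fourierInv_eq_fourier_comp_neg]
  exact VectorFourier.fourierIntegral_continuous Real.continuous_fourierChar
    (L := innerₗ E) continuous_inner ha.comp_neg

theorem norm_fourierInv_le (a : E → ℂ) (x : E) : ‖𝓕⁻ a x‖ ≤ ∫ ξ, ‖a ξ‖ := by
  rw [Real.fourierInv_eq]
  refine (norm_integral_le_integral_norm _).trans (le_of_eq ?_)
  simp [Circle.norm_smul]

theorem integrable_specU_fourierInv {p : ℝ} (hp : 2 < p) {a b : E → ℂ} (ha : Integrable a)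
    (ha2 : MemLp a 2) (hb : Integrable b) (hb2 : MemLp b 2) :
    Integrable fun x => specU p ⟨(𝓕⁻ a x).re, (𝓕⁻ b x).re⟩ := by
  obtain ⟨C, -, hC⟩ := exists_abs_specU_re_le hp (max (∫ ξ, ‖a ξ‖) (∫ ξ, ‖b ξ‖))
  have sq : ∀ {c : E → ℂ}, Integrable c → MemLp c 2 → Integrable fun x => ‖𝓕⁻ c x‖ ^ 2 :=
    fun hc hc2 => (memLp_two_iff_integrable_sq_norm
      (continuous_fourierInv hc).aestronglyMeasurable).1 (memLp_two_fourierInv hc hc2)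
  have ca := continuous_fourierInv ha
  have cb := continuous_fourierInv hb
  refine (((sq ha ha2).add (sq hb hb2)).const_mul C).mono' ?_
    (Filter.Eventually.of_forall fun x =>
      hC _ _ ((norm_fourierInv_le a x).trans (le_max_left _ _))
        ((norm_fourierInv_le b x).trans (le_max_right _ _)))
  refine ((continuous_specU hp).comp (f := fun x => (⟨(𝓕⁻ a x).re, (𝓕⁻ b x).re⟩ : ℂ))
    ?_).aestronglyMeasurable
  simp_rw [Complex.mk_eq_add_mul_I]
  fun_prop

theorem aestronglyMeasurable_rieszSymbol (e : E) (hg : AEStronglyMeasurable g) :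
    AEStronglyMeasurable (rieszSymbol e g) := by
  refine AEStronglyMeasurable.mul (Measurable.aestronglyMeasurable ?_) hg
  fun_prop

theorem measurable_hilbertSymbol (hg : Measurable g) :
    Measurable fun q : E × E => hilbertSymbol q.1 g q.2 := by
  unfold hilbertSymbol
  have h1 : Measurable fun q : E × E => (SignType.sign (inner ℝ q.2 q.1 : ℝ) : ℝ) :=
    measurable_coe_sign.comp (by fun_prop)
  fun_prop

/-- The Riesz transform is an average of directional Hilbert transforms. -/
theorem fourierInv_rieszSymbol {e : E} (he : ‖e‖ = 1) (hg : Integrable g) (hm : Measurable g)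
    (x : E) :
    Integrable (fun γ => ((max (inner ℝ γ e) 0 : ℝ) : ℂ) * 𝓕⁻ (hilbertSymbol γ g) x)
      (volume.restrict (Metric.ball 0 1)) ∧
    ∫ γ in Metric.ball (0 : E) 1, ((max (inner ℝ γ e) 0 : ℝ) : ℂ) * 𝓕⁻ (hilbertSymbol γ g) x =
      ((∫ γ in Metric.ball (0 : E) 1, max (inner ℝ γ e) 0 : ℝ) : ℂ) *
        𝓕⁻ (rieszSymbol e g) x := by
  set F : E → E → ℂ := fun γ ξ => ((max (inner ℝ γ e) 0 : ℝ) : ℂ) *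
    (𝐞 (inner ℝ ξ x) • hilbertSymbol γ g ξ) with hF
  have : IsFiniteMeasure (volume.restrict (Metric.ball (0 : E) 1)) :=
    ⟨by simpa using measure_ball_lt_top⟩
  have hFm : Measurable (Function.uncurry F) := by
    have h1 := measurable_hilbertSymbol hm
    have h2 : Measurable fun q : E × E => (𝐞 (inner ℝ q.2 x) : ℂ) :=
      (continuous_induced_dom.comp (Continuous.comp (f := fun q : E × E => inner ℝ q.2 x)
        Real.continuous_fourierChar (by fun_prop))).measurable
    have h3 : Measurable fun q : E × E => ((max (inner ℝ q.1 e) 0 : ℝ) : ℂ) :=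
      Complex.measurable_ofReal.comp (by fun_prop)
    exact h3.mul (h2.mul h1)
  have hFi : Integrable (Function.uncurry F)
      ((volume.restrict (Metric.ball (0 : E) 1)).prod volume) := by
    have hbound : Integrable (fun q : E × E => ‖g q.2‖)
        ((volume.restrict (Metric.ball (0 : E) 1)).prod volume) := hg.norm.comp_snd _
    refine hbound.mono' hFm.aestronglyMeasurable ?_
    have hs : ∀ᵐ q ∂((volume.restrict (Metric.ball (0 : E) 1)).prod (volume : Measure E)),
        q.1 ∈ Metric.ball (0 : E) 1 :=
      Measure.quasiMeasurePreserving_fst.ae (ae_restrict_mem measurableSet_ball)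
    filter_upwards [hs] with q hq
    simp only [Function.uncurry, hF]
    rw [norm_mul, Circle.norm_smul, Complex.norm_real]
    refine (mul_le_of_le_one_left (norm_nonneg _) ?_).trans (norm_hilbertSymbol_le _ _ _)
    rw [Real.norm_of_nonneg (le_max_right _ _)]
    exact max_le ((le_abs_self _).trans (abs_inner_le_of_mem_ball he hq)) zero_le_one
  have hinner : ∀ γ, ∫ ξ, F γ ξ =
      ((max (inner ℝ γ e) 0 : ℝ) : ℂ) * 𝓕⁻ (hilbertSymbol γ g) x := fun γ => by
    rw [Real.fourierInv_eq, ← integral_const_mul]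
  constructor
  · simpa only [hinner, Function.uncurry] using hFi.integral_prod_left
  · simp_rw [← hinner]
    rw [integral_integral_swap hFi, Real.fourierInv_eq, ← integral_const_mul]
    congr 1
    funext ξ
    have e1 : ∀ γ, F γ ξ = (𝐞 (inner ℝ ξ x) : ℂ) * (-Complex.I) * g ξ *
        ((max (inner ℝ γ e) 0 * (SignType.sign (inner ℝ ξ γ) : ℝ) : ℝ) : ℂ) := fun γ => by
      simp only [hF, hilbertSymbol, Circle.smul_def, smul_eq_mul, Complex.ofReal_mul]
      ring
    simp_rw [e1]
    rw [integral_const_mul, integral_complex_ofReal, setIntegral_max_inner_mul_sign he]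
    simp only [rieszSymbol, Circle.smul_def, smul_eq_mul, Complex.ofReal_mul]
    ring

end

section

variable {E : Type*} [NormedAddCommGroup E] [InnerProductSpace ℝ E] [FiniteDimensional ℝ E]
  [MeasurableSpace E] [BorelSpace E]

theorem stronglyMeasurable_fourierInv_hilbertSymbol {g : E → ℂ} (hm : Measurable g) :
    StronglyMeasurable fun q : E × E => 𝓕⁻ (hilbertSymbol q.1 g) q.2 := by
  simp_rw [Real.fourierInv_eq]
  refine StronglyMeasurable.integral_prod_right
    (f := fun (q : E × E) ξ => 𝐞 (inner ℝ ξ q.2) • hilbertSymbol q.1 g ξ) ?_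
  have h1 : Measurable fun r : (E × E) × E => hilbertSymbol r.1.1 g r.2 :=
    Measurable.comp (g := fun q : E × E => hilbertSymbol q.1 g q.2)
      (f := fun r : (E × E) × E => (r.1.1, r.2)) (measurable_hilbertSymbol hm) (by fun_prop)
  have h2 : Measurable fun r : (E × E) × E => (𝐞 (inner ℝ r.2 r.1.2) : ℂ) :=
    (continuous_induced_dom.comp (Continuous.comp (f := fun r : (E × E) × E => inner ℝ r.2 r.1.2)
      Real.continuous_fourierChar (by fun_prop))).measurable
  exact (h2.mul h1).stronglyMeasurable

theorem rieszSymbol_integrable {e : E} (he : ‖e‖ = 1) {g : E → ℂ} (hg : Integrable g) :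
    Integrable (rieszSymbol e g) :=
  hg.mono (aestronglyMeasurable_rieszSymbol e hg.1)
    (Filter.Eventually.of_forall (norm_rieszSymbol_le he g))

theorem rieszSymbol_memLp {e : E} (he : ‖e‖ = 1) {g : E → ℂ} {q : ENNReal} (hg : MemLp g q) :
    MemLp (rieszSymbol e g) q :=
  hg.mono (aestronglyMeasurable_rieszSymbol e hg.1)
    (Filter.Eventually.of_forall (norm_rieszSymbol_le he g))

theorem fourierInv_fourier_schwartz (h : SchwartzMap E ℂ) :
    𝓕⁻ ((𝓕 h : SchwartzMap E ℂ) : E → ℂ) = h := by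
  rw [← SchwartzMap.fourierInv_coe, FourierTransform.fourierInv_fourier_eq]

theorem integrable_specU_riesz {p : ℝ} (hp : 2 < p) {e : E} (he : ‖e‖ = 1)
    (h : SchwartzMap E ℂ) :
    Integrable fun x => specU p ⟨(h x).re, (𝓕⁻ (rieszSymbol e (𝓕 (h : E → ℂ))) x).re⟩ := by
  have := integrable_specU_fourierInv hp (𝓕 h).integrable ((𝓕 h).memLp 2)
    (rieszSymbol_integrable he (𝓕 h).integrable) (rieszSymbol_memLp he ((𝓕 h).memLp 2))
  rwa [fourierInv_fourier_schwartz, SchwartzMap.fourier_coe] at this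

theorem integral_specU_riesz_nonpos {p : ℝ} (hp : 2 < p) {e : E} (he : ‖e‖ = 1)
    (h : SchwartzMap E ℂ) :
    ∫ x, specU p ⟨(h x).re, (𝓕⁻ (rieszSymbol e (𝓕 (h : E → ℂ))) x).re⟩ ≤ 0 := by
  have hfour : ((𝓕 h : SchwartzMap E ℂ) : E → ℂ) = 𝓕 (h : E → ℂ) := SchwartzMap.fourier_coe h
  set g : E → ℂ := 𝓕 (h : E → ℂ) with hg
  have gi : Integrable g := hfour ▸ (𝓕 h).integrable
  have g2 : MemLp g 2 := hfour ▸ (𝓕 h).memLp 2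
  have gm : Measurable g := hfour ▸ (𝓕 h).continuous.measurable
  have hinv : 𝓕⁻ g = h := by rw [← hfour]; exact fourierInv_fourier_schwartz h
  have hsi : ∀ γ, Integrable (hilbertSymbol γ g) := fun γ =>
    gi.mono ((measurable_hilbertSymbol gm).comp measurable_prodMk_left).aestronglyMeasurable
      (Filter.Eventually.of_forall (norm_hilbertSymbol_le γ g))
  have hs2 : ∀ γ, MemLp (hilbertSymbol γ g) 2 := fun γ =>
    g2.mono ((measurable_hilbertSymbol gm).comp measurable_prodMk_left).aestronglyMeasurable
      (Filter.Eventually.of_forall (norm_hilbertSymbol_le γ g))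
  have hfin : IsFiniteMeasure (volume.restrict (Metric.ball (0 : E) 1)) :=
    ⟨by simpa using measure_ball_lt_top⟩
  set w : E → ℝ := fun γ => max (inner ℝ γ e) 0 with hw
  have w0 : ∀ γ, 0 ≤ w γ := fun γ => le_max_right _ _
  have w1 : ∀ γ ∈ Metric.ball (0 : E) 1, w γ ≤ 1 := fun γ hγ =>
    max_le ((le_abs_self _).trans (abs_inner_le_of_mem_ball he hγ)) zero_le_one
  have wi : IntegrableOn w (Metric.ball (0 : E) 1) :=
    integrableOn_ball_of_bound (C := 1) (by fun_prop) fun γ hγ => by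
      rw [abs_of_nonneg (w0 γ)]; exact w1 γ hγ
  set T : E → E → ℂ := fun γ x => 𝓕⁻ (hilbertSymbol γ g) x with hT
  set R : E → ℂ := 𝓕⁻ (rieszSymbol e g) with hR
  set Z := ∫ γ in Metric.ball (0 : E) 1, w γ with hZ
  have Zpos : 0 < Z := setIntegral_max_inner_pos he
  set K := ∫ ξ, ‖g ξ‖ with hK
  have hh : ∀ x, ‖h x‖ ≤ K := fun x => by rw [← hinv]; exact norm_fourierInv_le g x
  have hTK : ∀ γ x, ‖T γ x‖ ≤ K := fun γ x => (norm_fourierInv_le _ x).trans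
    (integral_mono (hsi γ).norm gi.norm (norm_hilbertSymbol_le γ g))
  obtain ⟨C, hC0, hC⟩ := exists_abs_specU_re_le hp K
  have hTsm : StronglyMeasurable fun q : E × E => T q.1 q.2 :=
    stronglyMeasurable_fourierInv_hilbertSymbol gm
  set B : E → E → ℝ := fun γ x => w γ * specU p ⟨(h x).re, (T γ x).re⟩ with hB
  have hBm : Measurable fun q : E × E => B q.1 q.2 := by
    have h1 : Measurable fun q : E × E => (⟨(h q.2).re, (T q.1 q.2).re⟩ : ℂ) := by
      simp_rw [Complex.mk_eq_add_mul_I]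
      have := hTsm.measurable
      have := h.continuous.measurable
      fun_prop
    have h2 : Measurable fun q : E × E => w q.1 := by fun_prop
    exact h2.mul ((continuous_specU hp).measurable.comp h1)
  have hsq : ∀ γ, ∫ x, ‖T γ x‖ ^ 2 ≤ ∫ ξ, ‖g ξ‖ ^ 2 := fun γ => by
    rw [hT, integral_norm_sq_fourierInv (hsi γ) (hs2 γ)]
    exact integral_mono
      ((memLp_two_iff_integrable_sq_norm (hs2 γ).1).1 (hs2 γ))
      ((memLp_two_iff_integrable_sq_norm g2.1).1 g2)
      fun ξ => pow_le_pow_left₀ (norm_nonneg _) (norm_hilbertSymbol_le γ g ξ) 2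
  have hTi : ∀ γ, Integrable fun x => ‖T γ x‖ ^ 2 := fun γ =>
    (memLp_two_iff_integrable_sq_norm
      (continuous_fourierInv (hsi γ)).aestronglyMeasurable).1 (memLp_two_fourierInv (hsi γ) (hs2 γ))
  have hhi : Integrable fun x => ‖h x‖ ^ 2 :=
    (memLp_two_iff_integrable_sq_norm h.continuous.aestronglyMeasurable).1 (h.memLp 2)
  have hprod : Integrable (fun q : E × E => C * (‖h q.2‖ ^ 2 + ‖T q.1 q.2‖ ^ 2))
      ((volume.restrict (Metric.ball (0 : E) 1)).prod volume) := by
    refine Integrable.const_mul (Integrable.add ?_ ?_) C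
    · exact Integrable.comp_snd hhi _
    · have hm : StronglyMeasurable fun q : E × E => ‖T q.1 q.2‖ ^ 2 := hTsm.norm.pow 2
      rw [integrable_prod_iff hm.aestronglyMeasurable]
      refine ⟨Filter.Eventually.of_forall hTi, ?_⟩
      refine Integrable.mono' (integrable_const (∫ ξ, ‖g ξ‖ ^ 2))
        hm.norm.integral_prod_right'.aestronglyMeasurable
        (Filter.Eventually.of_forall fun γ => ?_)
      simp only [norm_pow, norm_norm]
      rw [Real.norm_of_nonneg (by positivity)]
      exact hsq γ
  have hBi : Integrable (fun q : E × E => B q.1 q.2)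
      ((volume.restrict (Metric.ball (0 : E) 1)).prod volume) := by
    refine hprod.mono' hBm.aestronglyMeasurable ?_
    have hs : ∀ᵐ q ∂((volume.restrict (Metric.ball (0 : E) 1)).prod (volume : Measure E)),
        q.1 ∈ Metric.ball (0 : E) 1 :=
      Measure.quasiMeasurePreserving_fst.ae (ae_restrict_mem measurableSet_ball)
    filter_upwards [hs] with q hq
    rw [hB, norm_mul, Real.norm_of_nonneg (w0 _)]
    exact (mul_le_of_le_one_left (norm_nonneg _) (w1 _ hq)).trans (hC _ _ (hh _) (hTK _ _))
  have hjensen : ∀ᵐ x : E, Z * specU p ⟨(h x).re, (R x).re⟩ ≤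
      ∫ γ in Metric.ball (0 : E) 1, B γ x := by
    filter_upwards [hBi.prod_left_ae] with x hx
    obtain ⟨hi, hav⟩ := fourierInv_rieszSymbol he gi gm x
    have hre : ∫ γ in Metric.ball (0 : E) 1, w γ * (T γ x).re = Z * (R x).re := by
      have := congrArg Complex.re hav
      rw [← RCLike.re_eq_complex_re, ← integral_re hi] at this
      simpa using this
    have hir : IntegrableOn (fun γ => w γ * (T γ x).re) (Metric.ball (0 : E) 1) := by
      have := hi.re
      simp only [RCLike.re_eq_complex_re, Complex.re_ofReal_mul] at this
      exact this
    set s := specUy p ⟨(h x).re, (R x).re⟩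
    have hlin : ∫ γ in Metric.ball (0 : E) 1,
        ((specU p ⟨(h x).re, (R x).re⟩ - s * (R x).re) * w γ + s * (w γ * (T γ x).re)) =
        Z * specU p ⟨(h x).re, (R x).re⟩ := by
      rw [integral_add (wi.const_mul _) (hir.const_mul _), integral_const_mul,
        integral_const_mul, hre]
      ring
    rw [← hlin]
    refine integral_mono ((wi.const_mul _).add (hir.const_mul _)) hx fun γ => ?_
    have := mul_le_mul_of_nonneg_left
      (specU_tangent_le hp (h x).re (R x).re (T γ x).re) (w0 γ)
    simp only [hB]
    linarith
  have hU := integrable_specU_riesz hp he h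
  have hfinal : Z * ∫ x, specU p ⟨(h x).re, (R x).re⟩ ≤ 0 := by
    rw [← integral_const_mul]
    refine (integral_mono_ae (hU.const_mul Z) hBi.integral_prod_right hjensen).trans ?_
    rw [← integral_integral_swap hBi]
    refine integral_nonpos fun γ => ?_
    simp only [hB]
    rw [integral_const_mul]
    rcases eq_or_ne γ 0 with rfl | hγ
    · simp [hw]
    · exact mul_nonpos_of_nonneg_of_nonpos (w0 γ) (integral_specU_directional_nonpos hp hγ h)
  exact nonpos_of_mul_nonpos_right hfinal Zpos

end

/-- The real part of `z` rotated clockwise by the angle `α`. -/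
noncomputable def rePhase (α : ℝ) (z : ℂ) : ℝ := (Complex.exp (-(α * Complex.I)) * z).re

theorem rePhase_eq (α : ℝ) (z : ℂ) : rePhase α z = ‖z‖ * Real.cos (α - Complex.arg z) := by
  rw [rePhase]
  conv_lhs => rw [← Complex.norm_mul_exp_arg_mul_I z]
  rw [mul_left_comm, ← Complex.exp_add, Complex.re_ofReal_mul,
    show -((α : ℂ) * Complex.I) + (Complex.arg z) * Complex.I =
      ((-(α - Complex.arg z) : ℝ) : ℂ) * Complex.I by push_cast; ring,
    Complex.exp_ofReal_mul_I_re, Real.cos_neg]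

theorem continuous_rePhase : Continuous fun q : ℝ × ℂ => rePhase q.1 q.2 := by
  unfold rePhase
  fun_prop

theorem abs_rePhase_le (α : ℝ) (z : ℂ) : |rePhase α z| ≤ ‖z‖ := by
  rw [rePhase_eq, abs_mul, abs_norm]
  exact mul_le_of_le_one_right (norm_nonneg _) (Real.abs_cos_le_one _)

/-- The `p`-th moment of the cosine over a period. -/
noncomputable def cosMoment (p : ℝ) : ℝ := ∫ α in (0 : ℝ)..(2 * π), |Real.cos α| ^ p

section

variable {p : ℝ}

theorem cosMoment_pos (hp : 0 ≤ p) : 0 < cosMoment p := by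
  have hc : Continuous fun α : ℝ => |Real.cos α| ^ p :=
    Real.continuous_cos.abs.rpow_const fun _ => Or.inr hp
  refine intervalIntegral.integral_pos (by positivity) hc.continuousOn
    (fun _ _ => by positivity) ⟨0, ⟨le_rfl, by positivity⟩, by simp⟩

theorem integral_abs_rePhase_rpow (z : ℂ) :
    ∫ α in (0 : ℝ)..(2 * π), |rePhase α z| ^ p = cosMoment p * ‖z‖ ^ p := by
  have hper : Function.Periodic (fun α : ℝ => |Real.cos α| ^ p) (2 * π) := fun α => by
    simp only [Real.cos_add_two_pi]
  simp_rw [rePhase_eq, abs_mul, abs_norm, Real.mul_rpow (norm_nonneg _) (abs_nonneg _)]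
  rw [intervalIntegral.integral_const_mul,
    intervalIntegral.integral_comp_sub_right (fun α => |Real.cos α| ^ p)]
  have := hper.intervalIntegral_add_eq (0 - Complex.arg z) 0
  rw [show (0 - Complex.arg z) + 2 * π = 2 * π - Complex.arg z by ring, zero_add] at this
  rw [this, cosMoment, mul_comm]

theorem cosMoment_mul_abs_sub_rpow_le (hp : 1 ≤ p) {C : ℝ} (hC : 0 ≤ C) (w z : ℂ) :
    cosMoment p * |(‖w‖ - C * ‖z‖)| ^ p ≤
      ∫ α in (0 : ℝ)..(2 * π), |(|rePhase α w| - C * |rePhase α z|)| ^ p := by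
  have h2 : (0 : ℝ) ≤ 2 * π := by positivity
  have p0 : 0 < p := by linarith
  have m0 := (cosMoment_pos p0.le).le
  set μ := volume.restrict (Set.Ioc (0 : ℝ) (2 * π))
  set q := ENNReal.ofReal p
  have hq0 : q ≠ 0 := by simpa [q] using p0
  have hqt : q ≠ ⊤ := ENNReal.ofReal_ne_top
  have hq1 : 1 ≤ q := ENNReal.one_le_ofReal.2 hp
  have hqr : q.toReal = p := ENNReal.toReal_ofReal p0.le
  have hcz (z : ℂ) : Continuous fun α => rePhase α z :=
    continuous_rePhase.comp (f := fun α => (α, z)) (by fun_prop)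
  have hmem (z : ℂ) : MemLp (fun α => |rePhase α z|) q μ :=
    MemLp.of_bound (hcz z).abs.aestronglyMeasurable ‖z‖
      (Filter.Eventually.of_forall fun α => by simpa using abs_rePhase_le α z)
  have hnorm (z : ℂ) : lpNorm (fun α => |rePhase α z|) q μ = cosMoment p ^ p⁻¹ * ‖z‖ := by
    rw [lpNorm_eq_integral_norm_rpow_toReal hq0 hqt (hmem z).1, hqr]
    simp only [Real.norm_eq_abs, abs_abs]
    rw [← intervalIntegral.integral_of_le h2, integral_abs_rePhase_rpow,
      Real.mul_rpow m0 (by positivity), Real.rpow_rpow_inv (norm_nonneg _) p0.ne']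
  have hnormC : lpNorm (fun α => C * |rePhase α z|) q μ = cosMoment p ^ p⁻¹ * (C * ‖z‖) := by
    have : (fun α => C * |rePhase α z|) = C • fun α => |rePhase α z| := rfl
    rw [this, lpNorm_const_smul, hnorm, coe_nnnorm, Real.norm_of_nonneg hC]
    ring
  have hmC : MemLp (fun α => C * |rePhase α z|) q μ := (hmem z).const_mul C
  have hd1 := lpNorm_le_lpNorm_add_lpNorm_sub (f := fun α => |rePhase α w|) hmC hq1
  have hd2 := lpNorm_le_lpNorm_add_lpNorm_sub (f := fun α => C * |rePhase α z|) (hmem w) hq1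
  rw [lpNorm_sub_comm] at hd1
  rw [hnorm, hnormC] at hd1 hd2
  set D := lpNorm ((fun α => |rePhase α w|) - fun α => C * |rePhase α z|) q μ with hD
  have hle : cosMoment p ^ p⁻¹ * |(‖w‖ - C * ‖z‖)| ≤ D := by
    rw [← abs_of_nonneg (Real.rpow_nonneg m0 p⁻¹), ← abs_mul, abs_le]
    constructor <;> linarith
  have := Real.rpow_le_rpow (by positivity) hle p0.le
  rw [Real.mul_rpow (by positivity) (abs_nonneg _), Real.rpow_inv_rpow m0 p0.ne'] at this
  refine this.trans (le_of_eq ?_)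
  rw [hD, lpNorm_eq_integral_norm_rpow_toReal hq0 hqt ((hmem w).sub hmC).1, hqr,
    Real.rpow_inv_rpow (integral_nonneg fun _ => by positivity) p0.ne',
    intervalIntegral.integral_of_le h2]
  rfl

theorem abs_sub_rpow_le (hp : 0 ≤ p) {a b : ℝ} (ha : 0 ≤ a) (hb : 0 ≤ b) :
    |a - b| ^ p ≤ a ^ p + b ^ p := by
  have h1 := Real.rpow_nonneg ha p
  have h2 := Real.rpow_nonneg hb p
  rcases le_total a b with h | h
  · have := Real.rpow_le_rpow (abs_nonneg (a - b)) (abs_le.2 ⟨by linarith, by linarith⟩ :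
      |a - b| ≤ b) hp
    linarith
  · have := Real.rpow_le_rpow (abs_nonneg (a - b)) (abs_le.2 ⟨by linarith, by linarith⟩ :
      |a - b| ≤ a) hp
    linarith

/-- The size of `w` against `C` times that of `z`, with a penalty for their discrepancy. -/
noncomputable def gapForm (p C κ w z : ℝ) : ℝ :=
  |w| ^ p - (C * |z|) ^ p + κ * |(|w| - C * |z|)| ^ p

theorem continuous_gapForm (hp : 0 ≤ p) (C κ : ℝ) :
    Continuous fun q : ℝ × ℝ => gapForm p C κ q.1 q.2 :=
  ((continuous_fst.abs.rpow_const fun _ => Or.inr hp).sub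
    ((continuous_snd.abs.const_mul C).rpow_const fun _ => Or.inr hp)).add
    (((continuous_fst.abs.sub (continuous_snd.abs.const_mul C)).abs.rpow_const
      fun _ => Or.inr hp).const_mul κ)

theorem abs_gapForm_le (hp : 0 ≤ p) {C κ : ℝ} (hC : 0 ≤ C) (hκ : 0 ≤ κ) {w z a b : ℝ}
    (hw : |w| ≤ a) (hz : |z| ≤ b) :
    |gapForm p C κ w z| ≤ (1 + κ) * (a ^ p + C ^ p * b ^ p) := by
  have hb : 0 ≤ b := (abs_nonneg z).trans hz
  have h1 := Real.rpow_le_rpow (abs_nonneg w) hw hp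
  have h2 := Real.rpow_le_rpow (mul_nonneg hC (abs_nonneg z)) (mul_le_mul_of_nonneg_left hz hC) hp
  have h3 := abs_sub_rpow_le hp (abs_nonneg w) (mul_nonneg hC (abs_nonneg z))
  rw [Real.mul_rpow hC hb] at h2
  have h4 : 0 ≤ |w| ^ p := by positivity
  have h5 : 0 ≤ (C * |z|) ^ p := by positivity
  have h6 : 0 ≤ |(|w| - C * |z|)| ^ p := by positivity
  have h7 : κ * |(|w| - C * |z|)| ^ p ≤ κ * (a ^ p + C ^ p * b ^ p) :=
    mul_le_mul_of_nonneg_left (by linarith) hκ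
  have h8 : 0 ≤ κ * |(|w| - C * |z|)| ^ p := by positivity
  rw [gapForm, abs_le]
  constructor <;> linarith

theorem cosMoment_mul_gapForm_le (hp : 1 ≤ p) {C κ : ℝ} (hC : 0 ≤ C) (hκ : 0 ≤ κ) (w z : ℂ) :
    cosMoment p * gapForm p C κ ‖w‖ ‖z‖ ≤
      ∫ α in (0 : ℝ)..(2 * π), gapForm p C κ (rePhase α w) (rePhase α z) := by
  have p0 : 0 ≤ p := by linarith
  have hcz (z : ℂ) : Continuous fun α => rePhase α z :=
    continuous_rePhase.comp (f := fun α => (α, z)) (by fun_prop)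
  have c1 : Continuous fun α => |rePhase α w| ^ p :=
    (hcz w).abs.rpow_const fun _ => Or.inr p0
  have c2 : Continuous fun α => (C * |rePhase α z|) ^ p :=
    ((hcz z).abs.const_mul C).rpow_const fun _ => Or.inr p0
  have c12 : Continuous fun α => |rePhase α w| ^ p - (C * |rePhase α z|) ^ p := c1.sub c2
  have c3 : Continuous fun α => κ * |(|rePhase α w| - C * |rePhase α z|)| ^ p :=
    (((hcz w).abs.sub ((hcz z).abs.const_mul C)).abs.rpow_const fun _ => Or.inr p0).const_mul κ
  have e2 : ∫ α in (0 : ℝ)..(2 * π), (C * |rePhase α z|) ^ p = C ^ p * (cosMoment p * ‖z‖ ^ p) := by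
    simp_rw [Real.mul_rpow hC (abs_nonneg _)]
    rw [intervalIntegral.integral_const_mul, integral_abs_rePhase_rpow]
  have := mul_le_mul_of_nonneg_left (cosMoment_mul_abs_sub_rpow_le hp hC w z) hκ
  simp only [gapForm, abs_norm]
  rw [intervalIntegral.integral_add (c12.intervalIntegrable _ _)
      (c3.intervalIntegrable _ _),
    intervalIntegral.integral_sub (c1.intervalIntegrable _ _) (c2.intervalIntegrable _ _),
    integral_abs_rePhase_rpow, e2, intervalIntegral.integral_const_mul,
    Real.mul_rpow hC (norm_nonneg _)]
  linarith

section

variable {X : Type*} [MeasurableSpace X] {μ : Measure X} {C κ : ℝ}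

theorem integrable_gapForm (hp : 0 ≤ p) (hC : 0 ≤ C) (hκ : 0 ≤ κ) {F R : X → ℂ}
    {u v : X → ℝ} (hu : AEStronglyMeasurable u μ) (hv : AEStronglyMeasurable v μ)
    (huR : ∀ x, |u x| ≤ ‖R x‖) (hvF : ∀ x, |v x| ≤ ‖F x‖)
    (hFi : Integrable (fun x => ‖F x‖ ^ p) μ) (hRi : Integrable (fun x => ‖R x‖ ^ p) μ) :
    Integrable (fun x => gapForm p C κ (u x) (v x)) μ :=
  ((hRi.add (hFi.const_mul (C ^ p))).const_mul (1 + κ)).mono'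
    ((continuous_gapForm hp C κ).comp_aestronglyMeasurable (f := fun x => (u x, v x))
      (hu.prodMk hv))
    (Filter.Eventually.of_forall fun x => abs_gapForm_le hp hC hκ (huR x) (hvF x))

/-- Averaging over rotations passes from an inequality between real parts to one between moduli. -/
theorem integral_gapForm_norm_nonpos [SFinite μ] (hp : 1 ≤ p) (hC : 0 ≤ C) (hκ : 0 ≤ κ)
    {F R : X → ℂ} (hF : AEStronglyMeasurable F μ) (hR : AEStronglyMeasurable R μ)
    (hFi : Integrable (fun x => ‖F x‖ ^ p) μ) (hRi : Integrable (fun x => ‖R x‖ ^ p) μ)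
    (h : ∀ α, ∫ x, gapForm p C κ (rePhase α (R x)) (rePhase α (F x)) ∂μ ≤ 0) :
    ∫ x, gapForm p C κ ‖R x‖ ‖F x‖ ∂μ ≤ 0 := by
  have h2 : (0 : ℝ) ≤ 2 * π := by positivity
  have p0 : 0 ≤ p := by linarith
  set ν : Measure ℝ := volume.restrict (Set.Ioc (0 : ℝ) (2 * π)) with hν
  have hm {G : X → ℂ} (hG : AEStronglyMeasurable G μ) :
      AEStronglyMeasurable (fun q : ℝ × X => rePhase q.1 (G q.2)) (ν.prod μ) :=
    continuous_rePhase.comp_aestronglyMeasurable (f := fun q : ℝ × X => (q.1, G q.2))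
      (measurable_fst.aestronglyMeasurable.prodMk hG.comp_snd)
  have hQi : Integrable
      (fun q : ℝ × X => gapForm p C κ (rePhase q.1 (R q.2)) (rePhase q.1 (F q.2))) (ν.prod μ) :=
    integrable_gapForm p0 hC hκ (F := fun q : ℝ × X => F q.2) (R := fun q : ℝ × X => R q.2)
      (hm hR) (hm hF) (fun _ => abs_rePhase_le _ _) (fun _ => abs_rePhase_le _ _)
      (hFi.comp_snd ν) (hRi.comp_snd ν)
  have hi := integrable_gapForm p0 hC hκ (C := C) (κ := κ) hR.norm hF.norm
    (fun x => (abs_norm (R x)).le) (fun x => (abs_norm (F x)).le) hFi hRi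
  have key : cosMoment p * ∫ x, gapForm p C κ ‖R x‖ ‖F x‖ ∂μ ≤ 0 := by
    rw [← integral_const_mul]
    refine (integral_mono (hi.const_mul _) hQi.integral_prod_right fun x => ?_).trans ?_
    · have := cosMoment_mul_gapForm_le hp hC hκ (R x) (F x)
      rwa [intervalIntegral.integral_of_le h2] at this
    · rw [← integral_integral_swap hQi]
      exact integral_nonpos h
  exact nonpos_of_mul_nonpos_right key (cosMoment_pos p0)

end

end

section

variable {E : Type*} [NormedAddCommGroup E] [InnerProductSpace ℝ E]

theorem rieszSymbol_smul (e : E) (c : ℂ) (g : E → ℂ) :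
    rieszSymbol e (c • g) = c • rieszSymbol e g := by
  funext ξ
  simp only [rieszSymbol, Pi.smul_apply, smul_eq_mul]
  ring

variable [FiniteDimensional ℝ E] [MeasurableSpace E] [BorelSpace E]

theorem fourierInv_const_smul (c : ℂ) (g : E → ℂ) : 𝓕⁻ (c • g) = c • 𝓕⁻ g := by
  funext x
  simp only [Real.fourierInv_eq, Pi.smul_apply, smul_comm _ c]
  exact integral_const_mul c _

theorem fourierInv_rieszSymbol_smul (e : E) (c : ℂ) (f : SchwartzMap E ℂ) :
    𝓕⁻ (rieszSymbol e (𝓕 ((c • f : SchwartzMap E ℂ) : E → ℂ))) =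
      c • 𝓕⁻ (rieszSymbol e (𝓕 (f : E → ℂ))) := by
  rw [← fourierInv_const_smul, ← rieszSymbol_smul]
  congr 2
  rw [← SchwartzMap.fourier_coe, ← SchwartzMap.fourier_coe, FourierTransform.fourier_smul]
  rfl

theorem integrable_norm_rpow_of_memLp_two {p : ℝ} (hp : 2 ≤ p) {R : E → ℂ} {K : ℝ}
    (hR : MemLp R 2) (hK : ∀ x, ‖R x‖ ≤ K) : Integrable fun x => ‖R x‖ ^ p := by
  have hR2 : Integrable fun x => ‖R x‖ ^ 2 := by
    simpa using hR.integrable_norm_pow (by norm_num)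
  refine (hR2.const_mul (K ^ (p - 2))).mono'
    ((Real.continuous_rpow_const (by linarith)).comp_aestronglyMeasurable hR.1.norm)
    (Filter.Eventually.of_forall fun x => ?_)
  rw [Real.norm_of_nonneg (by positivity)]
  calc ‖R x‖ ^ p = ‖R x‖ ^ (p - 2) * ‖R x‖ ^ 2 := by
        rw [← Real.rpow_natCast, ← Real.rpow_add' (norm_nonneg _) (by norm_num; linarith)]
        norm_num
    _ ≤ K ^ (p - 2) * ‖R x‖ ^ 2 := by
        gcongr
        exact hK x

theorem memLp_fourierInv_rieszSymbol {p : ℝ} (hp : 2 ≤ p) {e : E} (he : ‖e‖ = 1)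
    (f : SchwartzMap E ℂ) :
    MemLp (𝓕⁻ (rieszSymbol e (𝓕 (f : E → ℂ)))) (ENNReal.ofReal p) := by
  have hi := rieszSymbol_integrable he (𝓕 f).integrable
  have h := integrable_norm_rpow_of_memLp_two hp
    (memLp_two_fourierInv hi (rieszSymbol_memLp he ((𝓕 f).memLp 2))) (norm_fourierInv_le _)
  rw [SchwartzMap.fourier_coe] at h hi
  have hm := (continuous_fourierInv hi).aestronglyMeasurable (μ := volume)
  rw [← integrable_norm_rpow_iff hm (by simp; linarith) ENNReal.ofReal_ne_top,
    ENNReal.toReal_ofReal (by linarith)]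
  exact h

/-- The sharp `L^p` inequality for the Riesz transform with a deficit term. -/
theorem integral_gapForm_riesz_nonpos {p : ℝ} (hp : 2 < p) {e : E} (he : ‖e‖ = 1)
    (f : SchwartzMap E ℂ) :
    ∫ x, gapForm p (Real.cot (π / (2 * p))) (gapCoeff p)
      ‖𝓕⁻ (rieszSymbol e (𝓕 (f : E → ℂ))) x‖ ‖f x‖ ≤ 0 := by
  have hC := (cot_rieszAngle_pos hp).le
  have hκ := (gapCoeff_pos hp).le
  have p0 : 0 < p := by linarith
  have hR := memLp_fourierInv_rieszSymbol hp.le he f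
  have hf := f.memLp (ENNReal.ofReal p) volume
  have hRi := hR.integrable_norm_rpow (by simpa using p0) ENNReal.ofReal_ne_top
  have hfi := hf.integrable_norm_rpow (by simpa using p0) ENNReal.ofReal_ne_top
  rw [ENNReal.toReal_ofReal p0.le] at hRi hfi
  refine integral_gapForm_norm_nonpos (by linarith) hC hκ hf.1 hR.1 hfi hRi fun α => ?_
  set h : SchwartzMap E ℂ := Complex.exp (-(α * Complex.I)) • f with hh
  have e1 (x : E) : (h x).re = rePhase α (f x) := rfl
  have e2 (x : E) : (𝓕⁻ (rieszSymbol e (𝓕 (h : E → ℂ))) x).re =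
      rePhase α (𝓕⁻ (rieszSymbol e (𝓕 (f : E → ℂ))) x) := by
    rw [hh, fourierInv_rieszSymbol_smul]
    rfl
  have hm {G : E → ℂ} (hG : AEStronglyMeasurable G) :
      AEStronglyMeasurable fun x => rePhase α (G x) :=
    continuous_rePhase.comp_aestronglyMeasurable (f := fun x => (α, G x))
      (aestronglyMeasurable_const.prodMk hG)
  refine (integral_mono (integrable_gapForm p0.le hC hκ (hm hR.1) (hm hf.1)
    (fun _ => abs_rePhase_le _ _) (fun _ => abs_rePhase_le _ _) hfi hRi)
    (integrable_specU_riesz hp he h) fun x => ?_).trans (integral_specU_riesz_nonpos hp he h)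
  have := specU_ge hp ⟨(h x).re, (𝓕⁻ (rieszSymbol e (𝓕 (h : E → ℂ))) x).re⟩
  simp only [e1, e2] at this ⊢
  exact this

end

theorem cot_rieszAngle_le {p : ℝ} (hp : 2 < p) : Real.cot (π / (2 * p)) ≤ p - 1 := by
  set g : ℝ → ℝ := fun x => π / 2 * x⁻¹ - Real.cos x / Real.sin x with hg
  have hs : ∀ x ∈ Set.Icc (π / (2 * p)) (π / 4), 0 < x ∧ 0 < Real.sin x := fun x hx =>
    have h0 := (rieszAngle_pos hp).trans_le hx.1
    ⟨h0, Real.sin_pos_of_pos_of_lt_pi h0 (by linarith [hx.2, Real.pi_pos])⟩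
  have hd : ∀ x ∈ Set.Icc (π / (2 * p)) (π / 4), HasDerivAt g
      (π / 2 * (-(x ^ 2)⁻¹) - ((-Real.sin x) * Real.sin x - Real.cos x * Real.cos x) /
        Real.sin x ^ 2) x := fun x hx =>
    ((hasDerivAt_inv (hs x hx).1.ne').const_mul (π / 2)).sub
      ((Real.hasDerivAt_cos x).div (Real.hasDerivAt_sin x) (hs x hx).2.ne')
  have hanti : AntitoneOn g (Set.Icc (π / (2 * p)) (π / 4)) := by
    refine antitoneOn_of_hasDerivWithinAt_nonpos (convex_Icc _ _)
      (fun x hx => (hd x hx).continuousAt.continuousWithinAt)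
      (fun x hx => (hd x (interior_subset hx)).hasDerivWithinAt) fun x hx => ?_
    have hx' := interior_subset hx
    obtain ⟨h0, h1⟩ := hs x hx'
    have h4 : x < 0.8 := by linarith [hx'.2, Real.pi_lt_d2]
    have h5 := Real.sin_gt_sub_cube h0
    have h6 : 0.85 * x ≤ Real.sin x := by
      nlinarith [mul_nonneg h0.le (show (0 : ℝ) ≤ 0.64 - x ^ 2 by nlinarith)]
    have h7 : x ^ 2 ≤ π / 2 * Real.sin x ^ 2 := by
      nlinarith [Real.pi_gt_d2, sq_nonneg x, mul_self_le_mul_self (by positivity) h6]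
    have h8 := Real.sin_sq_add_cos_sq x
    rw [show (-Real.sin x) * Real.sin x - Real.cos x * Real.cos x = -1 by linarith]
    have : 1 / Real.sin x ^ 2 ≤ π / 2 * (x ^ 2)⁻¹ := by
      rw [div_le_iff₀ (by positivity)]
      field_simp
      linarith
    rw [neg_div, mul_neg]
    linarith
  have := hanti (Set.left_mem_Icc.2 (rieszAngle_lt hp).le) (Set.right_mem_Icc.2 (rieszAngle_lt hp).le)
    (rieszAngle_lt hp).le
  simp only [hg] at this
  rw [Real.cos_pi_div_four, Real.sin_pi_div_four, div_self (by positivity),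
    ← Real.cot_eq_cos_div_sin] at this
  have e1 : π / 2 * (π / 4)⁻¹ = 2 := by field_simp; norm_num
  have e2 : π / 2 * (π / (2 * p))⁻¹ = p := by field_simp
  linarith

theorem rpow_sub_rpow_le {p a b : ℝ} (hp : 1 ≤ p) (ha : 0 ≤ a) (hb : 0 ≤ b) :
    a ^ p - b ^ p ≤ p * a ^ (p - 1) * (a - b) := by
  rcases ha.eq_or_lt with rfl | h
  · have h1 : 0 ≤ b ^ p := by positivity
    rw [Real.zero_rpow (by linarith)]
    rcases hp.eq_or_lt with rfl | h2
    · simp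
    · rw [Real.zero_rpow (by linarith)]
      linarith
  · have h1 := one_add_mul_self_le_rpow_one_add (s := b / a - 1)
      (by linarith [div_nonneg hb ha]) hp
    rw [add_sub_cancel, Real.div_rpow hb ha, le_div_iff₀ (by positivity)] at h1
    have h2 : a ^ p = a ^ (p - 1) * a := by
      rw [← Real.rpow_add_one h.ne', sub_add_cancel]
    have h3 : (1 + p * (b / a - 1)) * a ^ p = a ^ p - p * a ^ (p - 1) * (a - b) := by
      rw [h2]
      field_simp
      ring
    linarith

theorem stability_constant_rpow {p : ℝ} (hp : 2 < p) :
    ((p - 1) * ((2 + Real.sqrt 2) * p ^ 2 / ((p - 1) * (p - 2))) ^ (1 / p)) ^ p =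
      (p - 1) ^ (p - 1) * p / gapCoeff p := by
  have h1 : 0 < p - 1 := by linarith
  have h2 : 0 < p - 2 := by linarith
  have h3 : 0 < p := by linarith
  rw [Real.mul_rpow h1.le (by positivity), one_div, Real.rpow_inv_rpow (by positivity) h3.ne',
    gapCoeff, show (p - 1) ^ p = (p - 1) ^ (p - 1) * (p - 1) by
      rw [← Real.rpow_add_one h1.ne', sub_add_cancel]]
  field_simp

theorem discrepancy_le_of_deficit {p ε n r δ : ℝ} (hp : 2 < p) (hε : 0 < ε) (hn : 0 ≤ n)
    (hr : 0 ≤ r) (hδ : 0 ≤ δ) (hlow : (Real.cot (π / (2 * p)) - ε) * n ≤ r)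
    (h : r ^ p - Real.cot (π / (2 * p)) ^ p * n ^ p + gapCoeff p * δ ^ p ≤ 0) :
    δ ≤ (p - 1) * ((2 + Real.sqrt 2) * p ^ 2 / ((p - 1) * (p - 2))) ^ (1 / p) * ε ^ (1 / p) * n := by
  have hC := (cot_rieszAngle_pos hp).le
  have hC1 := cot_rieszAngle_le hp
  have hκ := gapCoeff_pos hp
  set C := Real.cot (π / (2 * p))
  have h1 : 0 < p - 1 := by linarith
  have h2 : 0 < p - 2 := by linarith
  have p0 : 0 < p := by linarith
  refine (Real.rpow_le_rpow_iff hδ (by positivity) p0).1 ?_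
  have hn1 : n ^ p = n ^ (p - 1) * n := by
    rw [← Real.rpow_add_one' hn (by simpa using p0.ne'), sub_add_cancel]
  rw [Real.mul_rpow (by positivity) hn, Real.mul_rpow (by positivity) (by positivity),
    stability_constant_rpow hp, one_div, Real.rpow_inv_rpow hε.le p0.ne']
  have hb := rpow_sub_rpow_le (p := p) (by linarith) (mul_nonneg hC hn) hr
  rw [Real.mul_rpow hC hn, Real.mul_rpow hC hn] at hb
  have hb2 : p * (C ^ (p - 1) * n ^ (p - 1)) * (C * n - r) ≤
      p * ((p - 1) ^ (p - 1) * n ^ (p - 1)) * (ε * n) := by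
    have : C ^ (p - 1) ≤ (p - 1) ^ (p - 1) := by gcongr
    calc _ ≤ p * (C ^ (p - 1) * n ^ (p - 1)) * (ε * n) := by
          gcongr
          linarith
      _ ≤ _ := by gcongr
  rw [div_mul_eq_mul_div, div_mul_eq_mul_div, le_div_iff₀ hκ, hn1]
  linarith

theorem eq_fourierInv_rieszSymbol_single {d : ℕ} (j : Fin d)
    (g : EuclideanSpace ℝ (Fin d) → ℂ) :
    (fun ξ : EuclideanSpace ℝ (Fin d) => -Complex.I * (ξ j : ℂ) / (‖ξ‖ : ℂ) * g ξ) =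
      rieszSymbol (EuclideanSpace.single j 1) g := by
  funext ξ
  have : inner ℝ ξ (EuclideanSpace.single j (1 : ℝ)) = ξ j := by
    simp [EuclideanSpace.inner_single_right]
  rw [rieszSymbol, this, Complex.ofReal_div, mul_div_assoc]

theorem stmt_3 (d : ℕ) (hd : 1 ≤ d) (j : Fin d)
    (p ε : ℝ) (hp : 2 < p) (hε : 0 < ε)
    (c : ℝ)
    (hc : c = (p - 1) * ((2 + Real.sqrt 2) * p ^ 2 /
        ((p - 1) * (p - 2))) ^ (1 / p))
    (f : SchwartzMap (EuclideanSpace ℝ (Fin d)) ℂ)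
    (Rf : EuclideanSpace ℝ (Fin d) → ℂ)
    (hRf : Rf = 𝓕⁻ (fun ξ : EuclideanSpace ℝ (Fin d) =>
        -Complex.I * (ξ j : ℂ) / (‖ξ‖ : ℂ) * 𝓕 (fun x => f x) ξ))
    (hlow : ENNReal.ofReal (Real.cot (π / (2 * p)) - ε) *
          eLpNorm (fun x => f x) (ENNReal.ofReal p) volume ≤
        eLpNorm Rf (ENNReal.ofReal p) volume) :
    eLpNorm (fun x => ‖Rf x‖ - Real.cot (π / (2 * p)) * ‖f x‖)
        (ENNReal.ofReal p) volume ≤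
      ENNReal.ofReal (c * ε ^ (1 / p)) *
        eLpNorm (fun x => f x) (ENNReal.ofReal p) volume := by
  have p0 : 0 < p := by linarith
  have hp1 : 0 < p - 1 := by linarith
  have hp2 : 0 < p - 2 := by linarith
  have hq0 : ENNReal.ofReal p ≠ 0 := by simpa using p0
  have hqt : ENNReal.ofReal p ≠ ⊤ := ENNReal.ofReal_ne_top
  have hqr : (ENNReal.ofReal p).toReal = p := ENNReal.toReal_ofReal p0.le
  have he : ‖EuclideanSpace.single j (1 : ℝ)‖ = 1 := by simp
  rw [eq_fourierInv_rieszSymbol_single] at hRf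
  have hR := memLp_fourierInv_rieszSymbol hp.le he f
  have hdef := integral_gapForm_riesz_nonpos hp he f
  rw [← hRf] at hR hdef
  have hf : MemLp (fun x => f x) (ENNReal.ofReal p) := f.memLp _ _
  have hD : MemLp (fun x => ‖Rf x‖ - Real.cot (π / (2 * p)) * ‖f x‖) (ENNReal.ofReal p) :=
    hR.norm.sub (hf.norm.const_mul _)
  have hpow {F : Type} [NormedAddCommGroup F] {u : EuclideanSpace ℝ (Fin d) → F}
      (hu : MemLp u (ENNReal.ofReal p)) :
      Integrable (fun x => ‖u x‖ ^ p) ∧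
        lpNorm u (ENNReal.ofReal p) volume ^ p = ∫ x, ‖u x‖ ^ p := by
    have := hu.integrable_norm_rpow hq0 hqt
    rw [hqr] at this
    refine ⟨this, ?_⟩
    rw [lpNorm_eq_integral_norm_rpow_toReal hq0 hqt hu.1, hqr,
      Real.rpow_inv_rpow (integral_nonneg fun _ => by positivity) p0.ne']
  obtain ⟨iR, nR⟩ := hpow hR
  obtain ⟨jf, nf⟩ := hpow hf
  obtain ⟨iD, nD⟩ := hpow hD
  have hC := (cot_rieszAngle_pos hp).le
  rw [← ofReal_lpNorm hf, ← ofReal_lpNorm hR, ← ENNReal.ofReal_mul' lpNorm_nonneg,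
    ENNReal.ofReal_le_ofReal_iff lpNorm_nonneg] at hlow
  have hc0 : 0 ≤ c * ε ^ (1 / p) := by rw [hc]; positivity
  rw [← ofReal_lpNorm hf, ← ofReal_lpNorm hD, ← ENNReal.ofReal_mul hc0, hc]
  refine ENNReal.ofReal_le_ofReal
    (discrepancy_le_of_deficit hp hε lpNorm_nonneg lpNorm_nonneg lpNorm_nonneg hlow ?_)
  have iRf : Integrable fun x => ‖Rf x‖ ^ p - Real.cot (π / (2 * p)) ^ p * ‖f x‖ ^ p :=
    iR.sub (jf.const_mul _)
  rw [nR, nf, nD, ← integral_const_mul, ← integral_const_mul, ← integral_sub iR (jf.const_mul _),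
    ← integral_add iRf (iD.const_mul _)]
  refine le_of_eq_of_le (integral_congr_ae (Filter.Eventually.of_forall fun x => ?_)) hdef
  simp only [gapForm, abs_norm, Real.norm_eq_abs, Real.mul_rpow hC (norm_nonneg _)]
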